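/- arXiv:1809.10920 — 2 statements merged into one kernel-verified Lean document; each statement's English description precedes it below -/
import Mathlib

section
/- Let 0 < α < 1 and h₁, h₂ > 0, and suppose that the elements of the set L(α,h₁,h₂) := {h₁ log p : p prime} ∪ {h₂ log(m+α) : m ∈ ℕ₀} ∪ {π} are linearly independent over ℚ. Let 𝔅 = {b_m : m ∈ ℕ₀} be a periodic sequence of complex numbers with minimal positive period l ∈ ℕ, and let ζ(s,α;𝔅) be the associated periodic Hurwitz zeta-function. Fix σ₀* > 1/2, for n ∈ ℕ put v₂(m,n,α) := exp(−((m+α)/(n+α))^{σ₀*}) for m ∈ ℕ₀, and define ζ_n(s,α;𝔅) := Σ_{m=0}^∞ b_m v₂(m,n,α) (m+α)^{−s}, a series converging absolutely for Re s > 1/2. Then for every compact subset K of the strip {s ∈ ℂ : 1/2 < Re s < 1}, lim_{n→∞} limsup_{N→∞} (1/(N+1)) Σ_{k=0}^{N} sup_{s∈K} |ζ(s+ikh₂,α;𝔅) − ζ_n(s+ikh₂,α;𝔅)| = 0. -/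
open Complex Filter Topology MeasureTheory

/-- `b` is a periodic sequence with minimal positive period `l`. -/
def IsMinimalPeriod (b : ℕ → ℂ) (l : ℕ) : Prop :=
  0 < l ∧ Function.Periodic b l ∧ ∀ l' : ℕ, 0 < l' → Function.Periodic b l' → l ≤ l'

/-- The periodic Hurwitz zeta-function `ζ(s,α;𝔅)`, given by its meromorphic continuation
`l^{-s} ∑_{r=0}^{l-1} b r ζ(s,(r+α)/l)` in terms of the classical Hurwitz zeta-function. -/
noncomputable def periodicHurwitzZeta (b : ℕ → ℂ) (l : ℕ) (α : ℝ) (s : ℂ) : ℂ :=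
  (l : ℂ) ^ (-s) *
    ∑ r ∈ Finset.range l, b r * HurwitzZeta.hurwitzZeta (↑(((r : ℝ) + α) / l)) s

/-- The mollified partial series
`ζ_n(s,α;𝔅) = ∑_{m≥0} b m v₂(m,n,α) (m+α)^{-s}` with
`v₂(m,n,α) = exp(-((m+α)/(n+α))^{σ₀*})`. -/
noncomputable def periodicHurwitzZetaApprox (b : ℕ → ℂ) (α σ₀star : ℝ) (n : ℕ) (s : ℂ) : ℂ :=
  ∑' m : ℕ, b m * Real.exp (-(((m + α) / (n + α)) ^ σ₀star)) * ((m + α : ℝ) : ℂ) ^ (-s)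

/-- The set `L(α,h₁,h₂) = {h₁ log p : p prime} ∪ {h₂ log(m+α) : m ∈ ℕ₀} ∪ {π}`. -/
def Lset (α h₁ h₂ : ℝ) : Set ℝ :=
  {x : ℝ | ∃ p : ℕ, p.Prime ∧ x = h₁ * Real.log p} ∪
    {x : ℝ | ∃ m : ℕ, x = h₂ * Real.log (m + α)} ∪ {Real.pi}

lemma norm_integral_cexp_le {T x : ℝ} (hx : x ≠ 0) :
    ‖∫ t in (-T)..T, cexp (t * x * I)‖ ≤ 2 / |x| := by
  have hxc : (x * I : ℂ) ≠ 0 := by simp [hx]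
  have h : ∀ t : ℝ, cexp (t * x * I) = cexp ((x * I) * t) := fun t ↦ by ring_nf
  simp_rw [h, integral_exp_mul_complex hxc, norm_div]
  have e : ∀ t : ℝ, ‖cexp (x * I * t)‖ = 1 := fun t ↦ by
    rw [show (x * I * t : ℂ) = ((x * t : ℝ) : ℂ) * I by push_cast; ring, norm_exp_ofReal_mul_I]
  have : ‖(x * I : ℂ)‖ = |x| := by simp
  rw [this]
  gcongr
  refine (norm_sub_le _ _).trans ?_
  rw [e, e]; norm_num

lemma log_sub_log_ge {x y : ℝ} (hx : 0 < x) (hxy : x ≤ y) :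
    (y - x) / y ≤ Real.log y - Real.log x := by
  have hy := hx.trans_le hxy
  have := Real.one_sub_inv_le_log_of_pos (div_pos hy hx)
  rw [Real.log_div hy.ne' hx.ne', inv_div] at this
  rwa [sub_div, div_self hy.ne']

lemma norm_integral_offdiag_le {a : ℝ} (ha : 0 < a) {i j : ℕ} (hij : i ≠ j) {u v B T : ℝ}
    (hu : 0 ≤ u) (hv : 0 ≤ v) (hui : u * (i + a) ≤ B) (hvj : v * (j + a) ≤ B) :
    u * v * ‖∫ t in (-T)..T, cexp (t * (Real.log (j + a) - Real.log (i + a) : ℝ) * I)‖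
      ≤ 2 * B * (u + v) * |(i : ℝ) - j|⁻¹ := by
  have hB : 0 ≤ B := le_trans (by positivity) hui
  wlog h : i < j generalizing i j u v
  · have := this hij.symm hv hu hvj hui (lt_of_le_of_ne (not_lt.1 h) hij.symm)
    rw [abs_sub_comm, add_comm u v, mul_comm u v]
    refine le_trans (le_of_eq ?_) this
    congr 1
    have hneg := intervalIntegral.integral_comp_neg (a := -T) (b := T)
      (fun t : ℝ ↦ cexp (t * (Real.log (i + a) - Real.log (j + a) : ℝ) * I))
    rw [neg_neg] at hneg
    rw [← hneg]
    congr 1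
    refine intervalIntegral.integral_congr fun t _ ↦ ?_
    congr 1
    push_cast
    ring
  have hij' : (i : ℝ) < j := by exact_mod_cast h
  have hi : 0 < (i : ℝ) + a := by positivity
  have hj : 0 < (j : ℝ) + a := by positivity
  have h1 := log_sub_log_ge hi (by linarith : (i : ℝ) + a ≤ j + a)
  have hd : 0 < (j : ℝ) - i := by linarith
  have h0 : 0 < ((j : ℝ) + a - (i + a)) / (j + a) := by
    rw [add_sub_add_right_eq_sub]; positivity
  have hlog := h0.trans_le h1
  have h2 : ‖∫ t in (-T)..T, cexp (t * (Real.log (j + a) - Real.log (i + a) : ℝ) * I)‖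
      ≤ 2 * ((j + a) * |(i : ℝ) - j|⁻¹) := by
    refine (norm_integral_cexp_le hlog.ne').trans ?_
    rw [abs_of_pos hlog, abs_sub_comm, abs_of_pos hd]
    refine (div_le_div_of_nonneg_left (by norm_num) h0 h1).trans (le_of_eq ?_)
    rw [add_sub_add_right_eq_sub]
    field_simp
  calc u * v * _ ≤ u * v * (2 * ((j + a) * |(i : ℝ) - j|⁻¹)) := by gcongr
    _ = 2 * (v * (j + a)) * u * |(i : ℝ) - j|⁻¹ := by ring
    _ ≤ 2 * B * (u + v) * |(i : ℝ) - j|⁻¹ := by gcongr; linarith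

lemma sum_range_inv_succ_le (M : ℕ) :
    ∑ d ∈ Finset.range M, ((d : ℝ) + 1)⁻¹ ≤ 1 + Real.log M := by
  have := harmonic_le_one_add_log M
  simpa [harmonic] using this

lemma sum_inv_abs_sub_le {i M : ℕ} (hi : i < M) :
    ∑ j ∈ Finset.range M, |(i : ℝ) - j|⁻¹ ≤ 2 * (1 + Real.log M) := by
  rw [← Finset.sum_range_add_sum_Ico _ hi.le, ← Finset.sum_range_reflect,
    Finset.sum_Ico_eq_sum_range, two_mul]
  have hsub : ∀ n ≤ M, ∑ d ∈ Finset.range n, ((d : ℝ) + 1)⁻¹ ≤ 1 + Real.log M := fun n hn ↦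
    (Finset.sum_le_sum_of_subset_of_nonneg (Finset.range_mono hn)
      (fun _ _ _ ↦ by positivity)).trans (sum_range_inv_succ_le M)
  refine add_le_add ((Finset.sum_le_sum fun d hd ↦ ?_).trans (hsub i hi.le)) ?_
  · rw [Finset.mem_range] at hd
    rw [Nat.sub_sub, Nat.cast_sub (by omega)]
    push_cast
    rw [abs_of_nonneg (by linarith)]
    exact le_of_eq (by congr 1; ring)
  · obtain ⟨k, hk⟩ : ∃ k, M - i = k + 1 := ⟨M - i - 1, by omega⟩
    rw [hk, Finset.sum_range_succ']
    simp only [add_zero, sub_self, abs_zero, inv_zero]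
    refine (Finset.sum_le_sum fun d hd ↦ ?_).trans (hsub k (by omega))
    push_cast
    rw [sub_add_cancel_left, abs_neg, abs_of_nonneg (by positivity)]

/-- A mean value estimate of Montgomery–Vaughan type with a logarithmic loss. -/
lemma integral_norm_sq_dirichletPoly_le {a : ℝ} (ha : 0 < a) (m M : ℕ) (c : ℕ → ℂ) {B T : ℝ}
    (hT : 0 ≤ T) (hB : ∀ j ∈ Finset.Ico m M, ‖c j‖ * (j + a) ≤ B) :
    ∫ t in (-T)..T, ‖∑ j ∈ Finset.Ico m M, c j * cexp (-(t * Real.log (j + a) * I))‖ ^ 2 ≤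
      2 * T * ∑ j ∈ Finset.Ico m M, ‖c j‖ ^ 2 +
        8 * B * (1 + Real.log M) * ∑ j ∈ Finset.Ico m M, ‖c j‖ := by
  set S := Finset.Ico m M
  have hSM : S ⊆ Finset.range M := fun j hj ↦ by
    rw [Finset.mem_range]; exact (Finset.mem_Ico.1 hj).2
  have hexp : ∀ t : ℝ, ((‖∑ j ∈ S, c j * cexp (-(t * Real.log (j + a) * I))‖ ^ 2 : ℝ) : ℂ) =
      ∑ i ∈ S, ∑ j ∈ S, c i * (starRingEnd ℂ) (c j) *
        cexp (t * (Real.log (j + a) - Real.log (i + a) : ℝ) * I) := fun t ↦ by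
    push_cast
    rw [← mul_conj', map_sum, Finset.sum_mul_sum]
    refine Finset.sum_congr rfl fun i _ ↦ Finset.sum_congr rfl fun j _ ↦ ?_
    rw [map_mul, ← exp_conj, mul_mul_mul_comm, ← Complex.exp_add]
    congr 2
    simp only [map_neg, map_mul, conj_ofReal, conj_I]
    ring
  have hint : ((∫ t in (-T)..T, ‖∑ j ∈ S, c j * cexp (-(t * Real.log (j + a) * I))‖ ^ 2 : ℝ) : ℂ) =
      ∑ i ∈ S, ∑ j ∈ S, c i * (starRingEnd ℂ) (c j) *
        ∫ t in (-T)..T, cexp (t * (Real.log (j + a) - Real.log (i + a) : ℝ) * I) := by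
    rw [← intervalIntegral.integral_ofReal]
    simp_rw [hexp]
    rw [intervalIntegral.integral_finsetSum]
    · refine Finset.sum_congr rfl fun i _ ↦ ?_
      rw [intervalIntegral.integral_finsetSum]
      · simp_rw [intervalIntegral.integral_const_mul]
      · intro j _
        exact Continuous.intervalIntegrable (by fun_prop) _ _
    · intro i _
      exact Continuous.intervalIntegrable (by fun_prop) _ _
  have hterm : ∀ i ∈ S, ∀ j ∈ S, ‖c i * (starRingEnd ℂ) (c j) *
        ∫ t in (-T)..T, cexp (t * (Real.log (j + a) - Real.log (i + a) : ℝ) * I)‖ ≤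
      (if i = j then 2 * T * ‖c i‖ ^ 2 else 0) +
        2 * B * (‖c i‖ + ‖c j‖) * |(i : ℝ) - j|⁻¹ := fun i hi j hj ↦ by
    rw [norm_mul, norm_mul, RCLike.norm_conj]
    split_ifs with h
    · subst h
      simp only [sub_self, ofReal_zero, mul_zero, zero_mul, Complex.exp_zero, abs_zero, inv_zero,
        add_zero]
      rw [intervalIntegral.integral_const, norm_smul]
      simp only [sub_neg_eq_add, norm_one, mul_one, Real.norm_eq_abs]
      rw [abs_of_nonneg (by linarith)]
      exact le_of_eq (by ring)
    · rw [zero_add]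
      exact norm_integral_offdiag_le ha h (norm_nonneg _) (norm_nonneg _) (hB i hi) (hB j hj)
  have hnn : 0 ≤ ∫ t in (-T)..T, ‖∑ j ∈ S, c j * cexp (-(t * Real.log (j + a) * I))‖ ^ 2 :=
    intervalIntegral.integral_nonneg (by linarith) fun _ _ ↦ by positivity
  have hoff : ∀ i ∈ S, ∑ j ∈ S, |(i : ℝ) - j|⁻¹ ≤ 2 * (1 + Real.log M) := fun i hi ↦
    (Finset.sum_le_sum_of_subset_of_nonneg hSM fun _ _ _ ↦ by positivity).trans
      (sum_inv_abs_sub_le (Finset.mem_range.1 (hSM hi)))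
  rcases S.eq_empty_or_nonempty with hS | ⟨i₀, hi₀⟩
  · simp [hS]
  have hB0 : 0 ≤ B := le_trans (by positivity) (hB i₀ hi₀)
  calc _ = ‖((∫ t in (-T)..T,
        ‖∑ j ∈ S, c j * cexp (-(t * Real.log (j + a) * I))‖ ^ 2 : ℝ) : ℂ)‖ := by
        rw [norm_real, Real.norm_of_nonneg hnn]
    _ ≤ ∑ i ∈ S, ∑ j ∈ S, ((if i = j then 2 * T * ‖c i‖ ^ 2 else 0) +
        2 * B * (‖c i‖ + ‖c j‖) * |(i : ℝ) - j|⁻¹) := by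
        rw [hint]
        exact norm_sum_le_of_le _ fun i hi ↦ norm_sum_le_of_le _ (hterm i hi)
    _ = 2 * T * ∑ j ∈ S, ‖c j‖ ^ 2 +
        4 * B * ∑ i ∈ S, ‖c i‖ * ∑ j ∈ S, |(i : ℝ) - j|⁻¹ := by
        simp only [Finset.sum_add_distrib, mul_add, add_mul]
        have e1 : ∑ i ∈ S, ∑ j ∈ S, (if i = j then 2 * T * ‖c i‖ ^ 2 else 0) =
            2 * T * ∑ j ∈ S, ‖c j‖ ^ 2 := by
          rw [Finset.mul_sum]
          exact Finset.sum_congr rfl fun i hi ↦ by simp [hi]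
        have e2 : ∑ i ∈ S, ∑ j ∈ S, 2 * B * ‖c i‖ * |(i : ℝ) - j|⁻¹ =
            2 * B * ∑ i ∈ S, ‖c i‖ * ∑ j ∈ S, |(i : ℝ) - j|⁻¹ := by
          simp only [Finset.mul_sum, mul_assoc]
        have e3 : ∑ i ∈ S, ∑ j ∈ S, 2 * B * ‖c j‖ * |(i : ℝ) - j|⁻¹ =
            2 * B * ∑ i ∈ S, ‖c i‖ * ∑ j ∈ S, |(i : ℝ) - j|⁻¹ := by
          rw [← e2, Finset.sum_comm]
          simp only [abs_sub_comm]
        rw [e1, e2, e3]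
        ring
    _ ≤ 2 * T * ∑ j ∈ S, ‖c j‖ ^ 2 + 4 * B * ∑ i ∈ S, ‖c i‖ * (2 * (1 + Real.log M)) := by
        gcongr with i hi
        exact hoff i hi
    _ = _ := by
        rw [← Finset.sum_mul]
        ring

/-- The difference between a term of the Hurwitz zeta series and its integral analogue. -/
noncomputable def hurwitzTerm (A : ℝ) (s : ℂ) : ℂ :=
  (A : ℂ) ^ (-s) - ((A : ℂ) ^ (1 - s) - ((A + 1 : ℝ) : ℂ) ^ (1 - s)) / (s - 1)

lemma hasDerivAt_ofReal_cpow_add {A u : ℝ} (h : 0 < A + u) (r : ℂ) :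
    HasDerivAt (fun u : ℝ ↦ ((A + u : ℝ) : ℂ) ^ r) (r * ((A + u : ℝ) : ℂ) ^ (r - 1)) u := by
  have h1 : HasDerivAt (fun z : ℂ ↦ ((A : ℂ) + z) ^ r) (r * ((A : ℂ) + u) ^ (r - 1) * 1) u := by
    refine HasDerivAt.cpow_const ((hasDerivAt_id _).const_add _) ?_
    left
    simpa using h
  simpa using h1.comp_ofReal

lemma continuousOn_ofReal_add_cpow {A : ℝ} (hA : 0 < A) (r : ℂ) :
    ContinuousOn (fun u : ℝ ↦ ((A + u : ℝ) : ℂ) ^ r) (Set.uIcc 0 1) := fun u hu ↦ by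
  rw [Set.uIcc_of_le zero_le_one] at hu
  exact (hasDerivAt_ofReal_cpow_add (by linarith [hu.1]) r).continuousAt.continuousWithinAt

lemma hurwitzTerm_eq_integral {A : ℝ} (hA : 0 < A) {s : ℂ} (hs : s ≠ 1) :
    hurwitzTerm A s = s * ∫ u in (0 : ℝ)..1, (1 - u) * ((A + u : ℝ) : ℂ) ^ (-s - 1) := by
  have hs' : 1 - s ≠ 0 := sub_ne_zero.2 hs.symm
  have hs'' : s - 1 ≠ 0 := sub_ne_zero.2 hs
  rw [← intervalIntegral.integral_const_mul]
  have hd : ∀ u ∈ Set.uIcc (0 : ℝ) 1, HasDerivAt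
      (fun u : ℝ ↦ -((1 - u : ℂ) * ((A + u : ℝ) : ℂ) ^ (-s)) - ((A + u : ℝ) : ℂ) ^ (1 - s) / (1 - s))
      (s * ((1 - u) * ((A + u : ℝ) : ℂ) ^ (-s - 1))) u := fun u hu ↦ by
    rw [Set.uIcc_of_le zero_le_one] at hu
    have hp : 0 < A + u := by linarith [hu.1]
    have h1 : HasDerivAt (fun u : ℝ ↦ (1 - u : ℂ)) (-1) u := by
      simpa using (HasDerivAt.ofReal_comp (hasDerivAt_id u)).const_sub 1
    refine ((h1.mul (hasDerivAt_ofReal_cpow_add hp (-s))).neg.sub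
      ((hasDerivAt_ofReal_cpow_add hp (1 - s)).div_const (1 - s))).congr_deriv ?_
    rw [show 1 - s - 1 = -s by ring, mul_div_cancel_left₀ _ hs']
    ring
  rw [intervalIntegral.integral_eq_sub_of_hasDerivAt hd]
  · rw [hurwitzTerm, ← neg_sub 1 s]
    simp only [ofReal_one, sub_self, zero_mul, neg_zero, zero_sub, add_zero, ofReal_zero, sub_zero,
      one_mul]
    field_simp
    ring
  · refine ContinuousOn.intervalIntegrable (continuousOn_const.mul (ContinuousOn.mul ?_
      (continuousOn_ofReal_add_cpow hA _)))
    fun_prop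

lemma norm_hurwitzTerm_le {A : ℝ} (hA : 0 < A) {s : ℂ} (hs : s ≠ 1) (hs0 : 0 ≤ s.re) :
    ‖hurwitzTerm A s‖ ≤ ‖s‖ * A ^ (-s.re - 1) := by
  rw [hurwitzTerm_eq_integral hA hs, norm_mul]
  gcongr
  have := intervalIntegral.norm_integral_le_of_norm_le_const (a := 0) (b := 1)
    (f := fun u : ℝ ↦ (1 - u) * ((A + u : ℝ) : ℂ) ^ (-s - 1)) (C := A ^ (-s.re - 1)) fun u hu ↦ ?_
  · simpa using this
  · rw [Set.uIoc_of_le zero_le_one] at hu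
    have hp : 0 < A + u := by linarith [hu.1]
    rw [norm_mul, norm_cpow_eq_rpow_re_of_pos hp, ← ofReal_one, ← ofReal_sub, norm_real,
      Real.norm_of_nonneg (by linarith [hu.2])]
    simp only [sub_re, neg_re, ofReal_re]
    calc (1 - u) * (A + u) ^ (-s.re - 1) ≤ 1 * A ^ (-s.re - 1) := by
          exact mul_le_mul (by linarith [hu.1]) (Real.rpow_le_rpow_of_nonpos hA
            (by linarith [hu.1]) (by linarith)) (by positivity) zero_le_one
      _ = _ := one_mul _

lemma sum_range_hurwitzTerm (a : ℝ) (s : ℂ) (M : ℕ) :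
    ∑ j ∈ Finset.range M, hurwitzTerm (j + a) s =
      ∑ j ∈ Finset.range M, ((j + a : ℝ) : ℂ) ^ (-s) -
        ((a : ℂ) ^ (1 - s) - ((M + a : ℝ) : ℂ) ^ (1 - s)) / (s - 1) := by
  have h : ∀ j : ℕ, hurwitzTerm (j + a) s = ((j + a : ℝ) : ℂ) ^ (-s) -
      (((j + a : ℝ) : ℂ) ^ (1 - s) - (((j + 1 : ℕ) + a : ℝ) : ℂ) ^ (1 - s)) / (s - 1) := fun j ↦ by
    rw [hurwitzTerm]
    push_cast
    ring_nf
  simp_rw [h]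
  rw [Finset.sum_sub_distrib, ← Finset.sum_div,
    Finset.sum_range_sub' (fun j : ℕ ↦ ((j + a : ℝ) : ℂ) ^ (1 - s))]
  simp

lemma rpow_neg_le_mul {a x p σ R : ℝ} (ha : 0 < a) (ha1 : a ≤ 1) (hx : a ≤ x) (hp : p ≤ σ)
    (hR : σ ≤ p + R) : x ^ (-σ) ≤ a ^ (-R) * x ^ (-p) := by
  have hx0 := ha.trans_le hx
  calc x ^ (-σ) = x ^ (-(σ - p)) * x ^ (-p) := by rw [← Real.rpow_add hx0]; ring_nf
    _ ≤ a ^ (-R) * x ^ (-p) := by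
      gcongr
      exact (Real.rpow_le_rpow_of_nonpos ha hx (by linarith)).trans
        (Real.rpow_le_rpow_of_exponent_ge ha ha1 (by linarith))

lemma summable_nat_add_rpow {a p : ℝ} (ha : 0 < a) (hp : p < -1) :
    Summable fun j : ℕ ↦ ((j : ℝ) + a) ^ p := by
  rw [← summable_nat_add_iff 1]
  refine Summable.of_nonneg_of_le (fun _ ↦ by positivity) (fun j ↦ ?_)
    ((summable_nat_add_iff 1).2 (Real.summable_nat_rpow.2 hp))
  exact Real.rpow_le_rpow_of_nonpos (by positivity) (by linarith) (by linarith)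

lemma summable_hurwitzTerm {a : ℝ} (ha : 0 < a) {s : ℂ} (hs : s ≠ 1) (hs0 : 0 < s.re) :
    Summable fun j : ℕ ↦ hurwitzTerm (j + a) s :=
  Summable.of_norm_bounded ((summable_nat_add_rpow ha (by linarith)).mul_left ‖s‖)
    fun j ↦ norm_hurwitzTerm_le (by positivity) hs hs0.le

lemma differentiableAt_hurwitzTerm {A : ℝ} (hA : 0 < A) {s : ℂ} (hs : s ≠ 1) :
    DifferentiableAt ℂ (hurwitzTerm A) s := by
  have h1 : (A : ℂ) ≠ 0 := by exact_mod_cast hA.ne'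
  have h2 : ((A + 1 : ℝ) : ℂ) ≠ 0 := by exact_mod_cast (by positivity : (A + 1) ≠ 0)
  unfold hurwitzTerm
  refine DifferentiableAt.sub ?_ (DifferentiableAt.div (DifferentiableAt.sub ?_ ?_) ?_
    (sub_ne_zero.2 hs))
  · exact (differentiableAt_id.neg).const_cpow (Or.inl h1)
  · exact (differentiableAt_id.const_sub 1).const_cpow (Or.inl h1)
  · exact (differentiableAt_id.const_sub 1).const_cpow (Or.inl h2)
  · fun_prop

lemma differentiableAt_tsum_hurwitzTerm {a : ℝ} (ha : 0 < a) (ha1 : a ≤ 1) {s : ℂ} (hs : s ≠ 1)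
    (hs0 : 0 < s.re) : DifferentiableAt ℂ (fun s ↦ ∑' j : ℕ, hurwitzTerm (j + a) s) s := by
  set δ := s.re / 2
  set R := ‖s‖ + 1
  have hδ : 0 < δ := half_pos hs0
  set V : Set ℂ := {z | δ < z.re} ∩ {z | ‖z‖ < R} ∩ {1}ᶜ
  have hV : IsOpen V := ((isOpen_lt continuous_const continuous_re).inter
    (isOpen_lt continuous_norm continuous_const)).inter isOpen_compl_singleton
  have hsV : s ∈ V := ⟨⟨half_lt_self hs0, lt_add_one ‖s‖⟩, hs⟩
  refine (differentiableOn_tsum_of_summable_norm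
    (u := fun j : ℕ ↦ R * (a ^ (-R) * ((j : ℝ) + a) ^ (-(δ + 1))))
    (((summable_nat_add_rpow ha (by linarith)).mul_left _).mul_left _)
    (fun j z hz ↦ (differentiableAt_hurwitzTerm (by positivity) hz.2).differentiableWithinAt)
    hV fun j z hz ↦ ?_).differentiableAt (hV.mem_nhds hsV)
  have hz1 : δ < z.re := hz.1.1
  have hz2 : ‖z‖ < R := hz.1.2
  refine (norm_hurwitzTerm_le (by positivity) hz.2 (by linarith)).trans ?_
  have hre := (re_le_norm z).trans hz2.le
  refine mul_le_mul hz2.le ?_ (by positivity) (by positivity)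
  rw [show -z.re - 1 = -(z.re + 1) by ring]
  exact rpow_neg_le_mul ha ha1 (le_add_of_nonneg_left (by positivity)) (by linarith) (by linarith)

lemma isPreconnected_re_pos_diff_one : IsPreconnected ({s : ℂ | 0 < s.re} \ {1}) := by
  have h1 : IsPreconnected ({s : ℂ | 0 < s.re} ∩ {s | 0 < s.im}) :=
    ((convex_halfSpace_re_gt 0).inter (convex_halfSpace_im_gt 0)).isPreconnected
  have h2 : IsPreconnected ({s : ℂ | 0 < s.re} ∩ {s | s.im < 0}) :=
    ((convex_halfSpace_re_gt 0).inter (convex_halfSpace_im_lt 0)).isPreconnected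
  have h3 : IsPreconnected {s : ℂ | 1 < s.re} := (convex_halfSpace_re_gt 1).isPreconnected
  have h4 : IsPreconnected ({s : ℂ | 0 < s.re} ∩ {s | s.re < 1}) :=
    ((convex_halfSpace_re_gt 0).inter (convex_halfSpace_re_lt 1)).isPreconnected
  have h13 := h1.union (2 + I) (by simp) (by simp) h3
  have h134 := h13.union (1 / 2 + I) (by norm_num) (by norm_num) h4
  have h := h134.union (2 - I) (by norm_num) (by norm_num) h2
  convert h using 1
  ext s
  simp only [Set.mem_sdiff, Set.mem_singleton_iff, Set.mem_union, Set.mem_inter_iff,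
    Set.mem_ofPred_eq, Complex.ext_iff, one_re, one_im]
  grind

lemma hurwitzZeta_eq_tsum_hurwitzTerm {a : ℝ} (ha : 0 < a) (ha1 : a ≤ 1) {s : ℂ} (hs : s ≠ 1)
    (hs0 : 0 < s.re) :
    HurwitzZeta.hurwitzZeta a s =
      (a : ℂ) ^ (1 - s) / (s - 1) + ∑' j : ℕ, hurwitzTerm (j + a) s := by
  have ha' : (a : ℂ) ≠ 0 := by exact_mod_cast ha.ne'
  set U : Set ℂ := {s : ℂ | 0 < s.re} \ {1}
  have hU : IsOpen U := (isOpen_lt continuous_const continuous_re).sdiff isClosed_singleton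
  have hf : DifferentiableOn ℂ (HurwitzZeta.hurwitzZeta a) U := fun z hz ↦
    (HurwitzZeta.differentiableAt_hurwitzZeta a hz.2).differentiableWithinAt
  have hg : DifferentiableOn ℂ (fun s ↦ (a : ℂ) ^ (1 - s) / (s - 1) +
      ∑' j : ℕ, hurwitzTerm (j + a) s) U := fun z hz ↦ by
    have hz1 : z ≠ 1 := hz.2
    have hc : DifferentiableAt ℂ (fun s : ℂ ↦ (a : ℂ) ^ (1 - s)) z :=
      (differentiableAt_id.const_sub 1).const_cpow (Or.inl ha')
    have hd : DifferentiableAt ℂ (fun s : ℂ ↦ s - 1) z := by fun_prop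
    exact ((hc.div hd (sub_ne_zero.2 hz1)).add
      (differentiableAt_tsum_hurwitzTerm ha ha1 hz1 hz.1)).differentiableWithinAt
  have h2U : (2 : ℂ) ∈ U := ⟨by simp, by simp⟩
  refine (hf.analyticOnNhd hU).eqOn_of_preconnected_of_eventuallyEq (hg.analyticOnNhd hU)
    isPreconnected_re_pos_diff_one h2U ?_ ⟨hs0, hs⟩
  have hnear : ∀ᶠ z : ℂ in 𝓝 2, 1 < z.re :=
    (isOpen_lt continuous_const continuous_re).mem_nhds (by simp)
  filter_upwards [hnear] with z hz
  have hz1 : z ≠ 1 := by rintro rfl; simp at hz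
  have e1 := (HurwitzZeta.hasSum_hurwitzZeta_of_one_lt_re ⟨ha.le, ha1⟩ hz).tendsto_sum_nat
  have e2 := (summable_hurwitzTerm ha hz1 (by linarith)).hasSum.tendsto_sum_nat
  simp_rw [sum_range_hurwitzTerm] at e2
  have e3 : Tendsto (fun M : ℕ ↦ ((M + a : ℝ) : ℂ) ^ (1 - z)) atTop (𝓝 0) := by
    rw [tendsto_zero_iff_norm_tendsto_zero]
    have h : ∀ M : ℕ, ‖((M + a : ℝ) : ℂ) ^ (1 - z)‖ = ((M : ℝ) + a) ^ (-(z.re - 1)) := fun M ↦ by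
      rw [norm_cpow_eq_rpow_re_of_pos (by positivity)]
      simp
    simp_rw [h]
    exact (tendsto_rpow_neg_atTop (by linarith)).comp
      (tendsto_atTop_add_const_right _ _ tendsto_natCast_atTop_atTop)
  have e4 := e1.sub (((tendsto_const_nhds (x := (a : ℂ) ^ (1 - z))).sub e3).div_const (z - 1))
  have e5 := tendsto_nhds_unique e2 (e4.congr fun M ↦ by
    congr 1
    refine Finset.sum_congr rfl fun j _ ↦ ?_
    rw [cpow_neg, one_div]
    simp)
  simp only [e5]
  ring

lemma hurwitzZeta_approx {a : ℝ} (ha : 0 < a) (ha1 : a ≤ 1) {s : ℂ} (hs : s ≠ 1)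
    (hs0 : 0 < s.re) (M : ℕ) :
    HurwitzZeta.hurwitzZeta a s = ∑ j ∈ Finset.range M, ((j + a : ℝ) : ℂ) ^ (-s) +
      ((M + a : ℝ) : ℂ) ^ (1 - s) / (s - 1) + ∑' j : ℕ, hurwitzTerm ((j + M : ℕ) + a) s := by
  rw [hurwitzZeta_eq_tsum_hurwitzTerm ha ha1 hs hs0,
    ← (summable_hurwitzTerm ha hs hs0).sum_add_tsum_nat_add M, sum_range_hurwitzTerm]
  ring

lemma ofReal_cpow_neg_add_mul_I {A : ℝ} (hA : 0 < A) (σ t : ℝ) :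
    (A : ℂ) ^ (-(σ + t * I)) = (A ^ (-σ) : ℝ) * cexp (-(t * Real.log A * I)) := by
  have hA' : (A : ℂ) ≠ 0 := by exact_mod_cast hA.ne'
  rw [neg_add, cpow_add _ _ hA', ofReal_cpow hA.le, cpow_def_of_ne_zero hA' (-(t * I)), ofReal_log hA.le]
  push_cast
  congr 2
  ring

/-- Cauchy–Schwarz against the constant function on the unit interval. -/
lemma sq_intervalIntegral_le {f : ℝ → ℝ} (hf : ContinuousOn f (Set.uIcc 0 1)) :
    (∫ u in (0 : ℝ)..1, f u) ^ 2 ≤ ∫ u in (0 : ℝ)..1, f u ^ 2 := by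
  set m := ∫ u in (0 : ℝ)..1, f u
  have h1 : IntervalIntegrable f volume 0 1 := hf.intervalIntegrable
  have h2 : IntervalIntegrable (fun u ↦ f u ^ 2) volume 0 1 := (hf.pow 2).intervalIntegrable
  have h : 0 ≤ ∫ u in (0 : ℝ)..1, (f u ^ 2 - 2 * m * f u + m ^ 2) :=
    intervalIntegral.integral_nonneg zero_le_one fun u _ ↦ by nlinarith [sq_nonneg (f u - m)]
  rw [intervalIntegral.integral_add (h2.sub (h1.const_mul _)) (by simp),
    intervalIntegral.integral_sub h2 (h1.const_mul _), intervalIntegral.integral_const_mul] at h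
  simp only [intervalIntegral.integral_const, sub_zero, one_smul] at h
  change 0 ≤ _ - 2 * m * m + m ^ 2 at h
  linarith

lemma sum_range_weighted_le {a p : ℝ} (ha : 0 < a) (hp : 1 / 2 < p) (M : ℕ) :
    ∑ j ∈ Finset.range M, ((j : ℝ) + a) ^ (-p) ≤
      (∑' j : ℕ, ((j : ℝ) + a) ^ (-(p + 1 / 2))) * ((M : ℝ) + a) ^ (1 / 2 : ℝ) := by
  have hs := summable_nat_add_rpow ha (show -(p + 1 / 2) < -1 by linarith)
  calc _ ≤ ∑ j ∈ Finset.range M, ((j : ℝ) + a) ^ (-(p + 1 / 2)) * ((M : ℝ) + a) ^ (1 / 2 : ℝ) := by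
        refine Finset.sum_le_sum fun j hj ↦ ?_
        have hjM : (j : ℝ) ≤ M := by exact_mod_cast (Finset.mem_range.1 hj).le
        calc ((j : ℝ) + a) ^ (-p) = ((j : ℝ) + a) ^ (-(p + 1 / 2)) * ((j : ℝ) + a) ^ (1 / 2 : ℝ) := by
              rw [← Real.rpow_add (by positivity)]; ring_nf
          _ ≤ _ := by gcongr
    _ ≤ _ := by
        rw [← Finset.sum_mul]
        gcongr
        exact hs.sum_le_tsum _ fun _ _ ↦ by positivity

lemma sum_Ico_rpow_le {a p r : ℝ} (ha : 0 < a) (hp : 1 / 2 < p) (hr : 0 ≤ r) {M : ℕ} (hM : 1 ≤ M)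
    (L : ℕ) : ∑ j ∈ Finset.Ico M L, ((j : ℝ) + a) ^ (-(p + 1 / 2 + r)) ≤
      (∑' j : ℕ, ((j : ℝ) + a) ^ (-(p + 1 / 2))) * (M : ℝ) ^ (-r) := by
  have hs := summable_nat_add_rpow ha (show -(p + 1 / 2) < -1 by linarith)
  have hM0 : (0 : ℝ) < M := by exact_mod_cast hM
  calc _ ≤ ∑ j ∈ Finset.Ico M L, ((j : ℝ) + a) ^ (-(p + 1 / 2)) * (M : ℝ) ^ (-r) := by
        refine Finset.sum_le_sum fun j hj ↦ ?_
        have hjM : (M : ℝ) ≤ j := by exact_mod_cast (Finset.mem_Ico.1 hj).1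
        rw [neg_add (p + 1 / 2), Real.rpow_add (by positivity)]
        exact mul_le_mul_of_nonneg_left
          (Real.rpow_le_rpow_of_nonpos hM0 (by linarith) (by linarith)) (by positivity)
    _ ≤ _ := by
        rw [← Finset.sum_mul]
        gcongr
        exact hs.sum_le_tsum _ fun _ _ ↦ by positivity

lemma integral_norm_sq_sum_range_le {a p σ T : ℝ} (ha : 0 < a) (ha1 : a ≤ 1) (hp : 1 / 2 < p)
    (hp1 : p < 1) (hpσ : p ≤ σ) (hσ : σ < 1) (hT : 0 ≤ T) {v : ℕ → ℝ} (hv0 : ∀ j, 0 ≤ v j)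
    (hv1 : ∀ j, v j ≤ 1) {M : ℕ} (hM : 1 ≤ M) :
    ∫ t in (-T)..T, ‖∑ j ∈ Finset.range M, (v j : ℂ) * ((j + a : ℝ) : ℂ) ^ (-(σ + t * I))‖ ^ 2 ≤
      2 * T * (a⁻¹ ^ 2 * ∑' j, v j * ((j : ℝ) + a) ^ (-(2 * p))) +
      16 * a⁻¹ ^ 2 * (∑' j : ℕ, ((j : ℝ) + a) ^ (-(p + 1 / 2))) *
        ((M : ℝ) ^ (3 / 2 - p) * (1 + Real.log M)) := by
  have hM1 : (1 : ℝ) ≤ M := by exact_mod_cast hM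
  have hlog : 0 ≤ 1 + Real.log M := by linarith [Real.log_nonneg hM1]
  have hS0 : 0 ≤ ∑' j : ℕ, ((j : ℝ) + a) ^ (-(p + 1 / 2)) := tsum_nonneg fun _ ↦ by positivity
  set c : ℕ → ℂ := fun j ↦ ((v j * ((j : ℝ) + a) ^ (-σ) : ℝ) : ℂ)
  have hc : ∀ j, ‖c j‖ ≤ v j * (a⁻¹ * ((j : ℝ) + a) ^ (-p)) := fun j ↦ by
    have := hv0 j
    rw [norm_real, Real.norm_of_nonneg (by positivity)]
    gcongr
    rw [← Real.rpow_neg_one]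
    exact rpow_neg_le_mul ha ha1 (le_add_of_nonneg_left (by positivity)) hpσ (by linarith)
  have hc' : ∀ j, ‖c j‖ ≤ a⁻¹ * ((j : ℝ) + a) ^ (-p) := fun j ↦
    (hc j).trans (mul_le_of_le_one_left (by positivity) (hv1 j))
  have h1 := integral_norm_sq_dirichletPoly_le ha 0 M c (B := a⁻¹ * ((M : ℝ) + a) ^ (1 - p)) hT
    fun j hj ↦ by
      have hjM : (j : ℝ) ≤ M := by exact_mod_cast (Finset.mem_Ico.1 hj).2.le
      calc ‖c j‖ * (j + a) ≤ a⁻¹ * ((j : ℝ) + a) ^ (-p) * (j + a) := by gcongr; exact hc' j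
        _ = a⁻¹ * ((j : ℝ) + a) ^ (1 - p) := by
          rw [mul_assoc, ← Real.rpow_add_one (by positivity)]; ring_nf
        _ ≤ _ := by gcongr
  rw [← Finset.range_eq_Ico] at h1
  have e : ∀ t : ℝ, ∑ j ∈ Finset.range M, (v j : ℂ) * ((j + a : ℝ) : ℂ) ^ (-(σ + t * I)) =
      ∑ j ∈ Finset.range M, c j * cexp (-(t * Real.log (j + a) * I)) := fun t ↦
    Finset.sum_congr rfl fun j _ ↦ by
      rw [ofReal_cpow_neg_add_mul_I (by positivity), ← mul_assoc, ← ofReal_mul]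
  simp_rw [e]
  refine h1.trans (add_le_add ?_ ?_)
  · have hsum : Summable fun j : ℕ ↦ v j * ((j : ℝ) + a) ^ (-(2 * p)) :=
      Summable.of_nonneg_of_le (fun j ↦ mul_nonneg (hv0 j) (by positivity))
        (fun j ↦ mul_le_of_le_one_left (by positivity) (hv1 j))
        (summable_nat_add_rpow ha (by linarith))
    gcongr
    refine le_trans ?_ (mul_le_mul_of_nonneg_left
      (hsum.sum_le_tsum (Finset.range M) fun j _ ↦ mul_nonneg (hv0 j) (by positivity))
      (by positivity))
    rw [Finset.mul_sum]
    refine Finset.sum_le_sum fun j _ ↦ ?_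
    have := hv0 j
    calc ‖c j‖ ^ 2 ≤ (v j * (a⁻¹ * ((j : ℝ) + a) ^ (-p))) ^ 2 := by gcongr; exact hc j
      _ = v j * (v j * (a⁻¹ ^ 2 * ((j : ℝ) + a) ^ (-(2 * p)))) := by
        rw [show -(2 * p) = -p + -p by ring, Real.rpow_add (by positivity)]; ring
      _ ≤ v j * (1 * (a⁻¹ ^ 2 * ((j : ℝ) + a) ^ (-(2 * p)))) := by gcongr; exact hv1 j
      _ = _ := by ring
  · have h3 : ∑ j ∈ Finset.range M, ‖c j‖ ≤
        a⁻¹ * ((∑' j : ℕ, ((j : ℝ) + a) ^ (-(p + 1 / 2))) * ((M : ℝ) + a) ^ (1 / 2 : ℝ)) :=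
      (Finset.sum_le_sum fun j _ ↦ hc' j).trans (by
        rw [← Finset.mul_sum]; gcongr; exact sum_range_weighted_le ha hp M)
    have h4 : ((M : ℝ) + a) ^ (3 / 2 - p) ≤ 2 * (M : ℝ) ^ (3 / 2 - p) := by
      calc ((M : ℝ) + a) ^ (3 / 2 - p) ≤ (2 * (M : ℝ)) ^ (3 / 2 - p) :=
            Real.rpow_le_rpow (by positivity) (by linarith) (by linarith)
        _ = 2 ^ (3 / 2 - p) * (M : ℝ) ^ (3 / 2 - p) := Real.mul_rpow (by norm_num) (by positivity)
        _ ≤ 2 ^ (1 : ℝ) * (M : ℝ) ^ (3 / 2 - p) := by gcongr <;> linarith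
        _ = _ := by rw [Real.rpow_one]
    calc _ ≤ 8 * (a⁻¹ * ((M : ℝ) + a) ^ (1 - p)) * (1 + Real.log M) *
          (a⁻¹ * ((∑' j : ℕ, ((j : ℝ) + a) ^ (-(p + 1 / 2))) * ((M : ℝ) + a) ^ (1 / 2 : ℝ))) := by
          gcongr
      _ = 8 * a⁻¹ ^ 2 * (∑' j : ℕ, ((j : ℝ) + a) ^ (-(p + 1 / 2))) *
          (((M : ℝ) + a) ^ (3 / 2 - p) * (1 + Real.log M)) := by
          rw [show 3 / 2 - p = (1 - p) + 1 / 2 by ring, Real.rpow_add (by positivity)]; ring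
      _ ≤ 8 * a⁻¹ ^ 2 * (∑' j : ℕ, ((j : ℝ) + a) ^ (-(p + 1 / 2))) *
          ((2 * (M : ℝ) ^ (3 / 2 - p)) * (1 + Real.log M)) := by gcongr
      _ = _ := by ring

lemma continuousOn_sum_cpow {a : ℝ} (ha : 0 < a) (σ T : ℝ) (S : Finset ℕ) :
    ContinuousOn (fun x : ℝ × ℝ ↦
      ∑ j ∈ S, ((j + a + x.2 : ℝ) : ℂ) ^ (-(σ + x.1 * I) - 1)) (Set.uIcc (-T) T ×ˢ Set.uIcc 0 1) := by
  refine continuousOn_finsetSum _ fun j _ ↦ ContinuousOn.cpow (by fun_prop) (by fun_prop) ?_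
  rintro ⟨t, u⟩ ⟨-, hu⟩
  rw [Set.uIcc_of_le zero_le_one] at hu
  have := hu.1
  left
  simp only [ofReal_re]
  simp only at this
  positivity

lemma integral_norm_sq_sum_cpow_le {a p σ T u : ℝ} (ha : 0 < a) (hp : 1 / 2 < p)
    (hpσ : p ≤ σ) (hT : 0 ≤ T) (hu : 0 ≤ u) {M : ℕ} (hM : 1 ≤ M) {L : ℕ} (hL : 1 ≤ L) :
    ∫ t in (-T)..T, ‖∑ j ∈ Finset.Ico M L, ((j + a + u : ℝ) : ℂ) ^ (-(σ + t * I) - 1)‖ ^ 2 ≤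
      2 * T * ((∑' j : ℕ, ((j : ℝ) + a) ^ (-(p + 1 / 2))) * (M : ℝ) ^ (-(p + 3 / 2))) +
      8 * (M : ℝ) ^ (-p) * (1 + Real.log L) *
        ((∑' j : ℕ, ((j : ℝ) + a) ^ (-(p + 1 / 2))) * (M : ℝ) ^ (-(1 / 2 : ℝ))) := by
  have hM1 : (1 : ℝ) ≤ M := by exact_mod_cast hM
  have hM0 : (0 : ℝ) < M := by linarith
  have hlog : 0 ≤ 1 + Real.log L := by
    linarith [Real.log_nonneg (show (1 : ℝ) ≤ L by exact_mod_cast hL)]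
  have hau : 0 < a + u := by positivity
  set c : ℕ → ℂ := fun j ↦ ((((j : ℝ) + (a + u)) ^ (-(σ + 1)) : ℝ) : ℂ)
  have hc : ∀ j ∈ Finset.Ico M L, ‖c j‖ ≤ ((j : ℝ) + a) ^ (-(p + 1)) := fun j hj ↦ by
    have hjM : (M : ℝ) ≤ j := by exact_mod_cast (Finset.mem_Ico.1 hj).1
    rw [norm_real, Real.norm_of_nonneg (by positivity)]
    exact (Real.rpow_le_rpow_of_exponent_le (by linarith) (by linarith)).trans
      (Real.rpow_le_rpow_of_nonpos (by linarith) (by linarith) (by linarith))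
  have h1 := integral_norm_sq_dirichletPoly_le hau M L c (B := (M : ℝ) ^ (-p)) hT
    fun j hj ↦ by
      have hjM : (M : ℝ) ≤ j := by exact_mod_cast (Finset.mem_Ico.1 hj).1
      rw [norm_real, Real.norm_of_nonneg (by positivity), ← Real.rpow_add_one (by positivity)]
      exact (Real.rpow_le_rpow_of_exponent_le (by linarith) (by linarith)).trans
        (Real.rpow_le_rpow_of_nonpos hM0 (by linarith) (by linarith))
  have e : ∀ t : ℝ, ∑ j ∈ Finset.Ico M L, ((j + a + u : ℝ) : ℂ) ^ (-(σ + t * I) - 1) =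
      ∑ j ∈ Finset.Ico M L, c j * cexp (-(t * Real.log (j + (a + u)) * I)) := fun t ↦
    Finset.sum_congr rfl fun j _ ↦ by
      rw [← ofReal_cpow_neg_add_mul_I (by positivity), add_assoc]
      congr 1
      push_cast
      ring
  simp_rw [e]
  refine h1.trans ?_
  gcongr
  · refine (Finset.sum_le_sum fun j hj ↦ ?_).trans
      ((sum_Ico_rpow_le ha hp (show 0 ≤ p + 3 / 2 by linarith) hM L))
    calc ‖c j‖ ^ 2 ≤ (((j : ℝ) + a) ^ (-(p + 1))) ^ 2 := by gcongr; exact hc j hj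
      _ = _ := by rw [sq, ← Real.rpow_add (by positivity)]; ring_nf
  · refine (Finset.sum_le_sum hc).trans ?_
    refine le_trans (le_of_eq ?_) (sum_Ico_rpow_le ha hp (show (0 : ℝ) ≤ 1 / 2 by norm_num) hM L)
    exact Finset.sum_congr rfl fun j _ ↦ by congr 1; ring

lemma integral_norm_sq_sum_hurwitzTerm_le {a p σ T : ℝ} (ha : 0 < a) (hp : 1 / 2 < p)
    (hpσ : p ≤ σ) (hσ : σ < 1) (hT : 0 ≤ T) {M : ℕ} (hM : 1 ≤ M) {L : ℕ} (hL : 1 ≤ L) :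
    ∫ t in (-T)..T, ‖∑ j ∈ Finset.Ico M L, hurwitzTerm (j + a) (σ + t * I)‖ ^ 2 ≤
      (1 + T) ^ 2 * (2 * T * ((∑' j : ℕ, ((j : ℝ) + a) ^ (-(p + 1 / 2))) * (M : ℝ) ^ (-(p + 3 / 2))) +
      8 * (M : ℝ) ^ (-p) * (1 + Real.log L) *
        ((∑' j : ℕ, ((j : ℝ) + a) ^ (-(p + 1 / 2))) * (M : ℝ) ^ (-(1 / 2 : ℝ)))) := by
  set V := 2 * T * ((∑' j : ℕ, ((j : ℝ) + a) ^ (-(p + 1 / 2))) * (M : ℝ) ^ (-(p + 3 / 2))) +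
      8 * (M : ℝ) ^ (-p) * (1 + Real.log L) *
        ((∑' j : ℕ, ((j : ℝ) + a) ^ (-(p + 1 / 2))) * (M : ℝ) ^ (-(1 / 2 : ℝ)))
  set G : ℝ → ℝ → ℂ := fun t u ↦
    ∑ j ∈ Finset.Ico M L, ((j + a + u : ℝ) : ℂ) ^ (-(σ + t * I) - 1)
  have hG : ContinuousOn (fun x : ℝ × ℝ ↦ G x.1 x.2) (Set.uIcc (-T) T ×ˢ Set.uIcc 0 1) :=
    continuousOn_sum_cpow ha σ T _
  have hGt : ∀ t ∈ Set.uIcc (-T) T, ContinuousOn (G t) (Set.uIcc 0 1) := fun t ht ↦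
    hG.comp (f := fun u ↦ (t, u)) (by fun_prop) fun u hu ↦ ⟨ht, hu⟩
  have hne : ∀ t : ℝ, (σ + t * I : ℂ) ≠ 1 := fun t h ↦ by
    have := congrArg re h
    simp at this
    linarith
  have hpt : ∀ t ∈ Set.Icc (-T) T, ‖∑ j ∈ Finset.Ico M L, hurwitzTerm (j + a) (σ + t * I)‖ ^ 2 ≤
      (1 + T) ^ 2 * ∫ u in (0 : ℝ)..1, ‖G t u‖ ^ 2 := fun t ht ↦ by
    have hct := hGt t (by rwa [Set.uIcc_of_le (by linarith)])
    have e : ∑ j ∈ Finset.Ico M L, hurwitzTerm (j + a) (σ + t * I) =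
        (σ + t * I) * ∫ u in (0 : ℝ)..1, (1 - u) * G t u := by
      simp_rw [G, Finset.mul_sum]
      rw [intervalIntegral.integral_finsetSum, Finset.mul_sum]
      · exact Finset.sum_congr rfl fun j _ ↦ hurwitzTerm_eq_integral (by positivity) (hne t)
      · intro j _
        exact (ContinuousOn.mul (by fun_prop)
          (continuousOn_ofReal_add_cpow (by positivity) _)).intervalIntegrable
    have hs : ‖(σ + t * I : ℂ)‖ ≤ 1 + T := by
      refine (norm_add_le _ _).trans (add_le_add ?_ ?_)
      · rw [norm_real, Real.norm_of_nonneg (by linarith)]; exact hσ.le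
      · rw [norm_mul, norm_I, mul_one, norm_real]; exact abs_le.2 ht
    have hi : ‖∫ u in (0 : ℝ)..1, (1 - u) * G t u‖ ≤ ∫ u in (0 : ℝ)..1, ‖G t u‖ := by
      refine intervalIntegral.norm_integral_le_of_norm_le zero_le_one ?_
        hct.norm.intervalIntegrable
      refine ae_of_all _ fun u hu ↦ ?_
      rw [norm_mul, ← ofReal_one, ← ofReal_sub, norm_real, Real.norm_of_nonneg (by linarith [hu.2])]
      exact mul_le_of_le_one_left (norm_nonneg _) (by linarith [hu.1])
    rw [e, norm_mul, mul_pow]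
    gcongr
    exact (by gcongr : _ ≤ _).trans (sq_intervalIntegral_le hct.norm)
  have hGint : Integrable (Function.uncurry fun t u ↦ ‖G t u‖ ^ 2)
      ((volume.restrict (Set.uIoc (-T) T)).prod (volume.restrict (Set.uIoc 0 1))) := by
    rw [Measure.prod_restrict]
    refine IntegrableOn.mono_set (ContinuousOn.integrableOn_compact
      (isCompact_uIcc.prod isCompact_uIcc) (hG.norm.pow 2)) ?_
    exact Set.prod_mono Set.uIoc_subset_uIcc Set.uIoc_subset_uIcc
  have hswap : ∫ t in (-T)..T, ∫ u in (0 : ℝ)..1, ‖G t u‖ ^ 2 =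
      ∫ u in (0 : ℝ)..1, ∫ t in (-T)..T, ‖G t u‖ ^ 2 := by
    simp_rw [intervalIntegral.integral_of_le zero_le_one]
    rw [Set.uIoc_of_le zero_le_one] at hGint
    exact intervalIntegral_integral_swap hGint
  have hinner : IntervalIntegrable (fun t ↦ ∫ u in (0 : ℝ)..1, ‖G t u‖ ^ 2) volume (-T) T := by
    simp_rw [intervalIntegral.integral_of_le zero_le_one]
    rw [Set.uIoc_of_le zero_le_one] at hGint
    rw [intervalIntegrable_iff]
    exact hGint.integral_prod_left
  have hinner' : IntervalIntegrable (fun u ↦ ∫ t in (-T)..T, ‖G t u‖ ^ 2) volume 0 1 := by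
    simp_rw [intervalIntegral.integral_of_le (show -T ≤ T by linarith)]
    rw [Set.uIoc_of_le (show -T ≤ T by linarith)] at hGint
    rw [intervalIntegrable_iff]
    exact hGint.integral_prod_right
  have hcont : Continuous fun t : ℝ ↦ ∑ j ∈ Finset.Ico M L, hurwitzTerm (j + a) (σ + t * I) := by
    refine continuous_finsetSum _ fun j _ ↦ continuous_iff_continuousAt.2 fun t ↦ ?_
    exact (differentiableAt_hurwitzTerm (by positivity) (hne t)).continuousAt.comp
      (f := fun t : ℝ ↦ (σ + t * I : ℂ)) (by fun_prop)
  calc _ ≤ ∫ t in (-T)..T, (1 + T) ^ 2 * ∫ u in (0 : ℝ)..1, ‖G t u‖ ^ 2 :=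
        intervalIntegral.integral_mono_on (by linarith)
          ((hcont.norm.pow 2).intervalIntegrable _ _) (hinner.const_mul _) hpt
    _ = (1 + T) ^ 2 * ∫ u in (0 : ℝ)..1, ∫ t in (-T)..T, ‖G t u‖ ^ 2 := by
        rw [intervalIntegral.integral_const_mul, hswap]
    _ ≤ (1 + T) ^ 2 * ∫ _ in (0 : ℝ)..1, V := by
        gcongr
        refine intervalIntegral.integral_mono_on zero_le_one hinner' (by simp) fun u hu ↦ ?_
        exact integral_norm_sq_sum_cpow_le ha hp hpσ hT hu.1 hM hL
    _ = _ := by simp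

noncomputable def smoothWeight (a κ X : ℝ) (j : ℕ) : ℝ := Real.exp (-(((j + a) / X) ^ κ))

noncomputable def smoothedSum (a κ X : ℝ) (s : ℂ) : ℂ :=
  ∑' j : ℕ, (smoothWeight a κ X j : ℂ) * ((j + a : ℝ) : ℂ) ^ (-s)

noncomputable def smoothedError (a κ X : ℝ) (s : ℂ) : ℂ :=
  HurwitzZeta.hurwitzZeta a s - smoothedSum a κ X s

lemma smoothWeight_pos (a κ X : ℝ) (j : ℕ) : 0 < smoothWeight a κ X j := Real.exp_pos _

lemma smoothWeight_le_one {a κ X : ℝ} (ha : 0 < a) (hX : 0 < X) (j : ℕ) :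
    smoothWeight a κ X j ≤ 1 := by
  rw [smoothWeight, Real.exp_le_one_iff, neg_nonpos]
  positivity

lemma summable_smoothWeight {a κ X : ℝ} (ha : 0 < a) (hκ : 0 < κ) (hX : 0 < X) :
    Summable (smoothWeight a κ X) := by
  obtain ⟨k, hk⟩ := exists_nat_gt (1 / κ)
  have hk1 : 1 < κ * k := by rwa [div_lt_iff₀' hκ] at hk
  refine Summable.of_nonneg_of_le (fun j ↦ (smoothWeight_pos a κ X j).le) (fun j ↦ ?_)
    ((summable_nat_add_rpow ha (show -(κ * k) < -1 by linarith)).mul_left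
      (k.factorial * X ^ (κ * k)))
  have hy : 0 < (((j : ℝ) + a) / X) ^ κ := by positivity
  have h := Real.pow_div_factorial_le_exp _ hy.le k
  rw [smoothWeight, Real.exp_neg]
  have e : (((j : ℝ) + a) / X) ^ (κ * k) = ((j : ℝ) + a) ^ (κ * k) / X ^ (κ * k) :=
    Real.div_rpow (by positivity) hX.le _
  rw [← Real.rpow_mul_natCast (by positivity), e] at h
  refine (inv_anti₀ (by positivity) h).trans (le_of_eq ?_)
  rw [Real.rpow_neg (by positivity)]
  field_simp

lemma norm_smoothWeight_mul_cpow_le {a κ X : ℝ} (ha : 0 < a) (ha1 : a ≤ 1) {s : ℂ}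
    (hs0 : 0 ≤ s.re) (hs1 : s.re ≤ 1) (j : ℕ) :
    ‖(smoothWeight a κ X j : ℂ) * ((j + a : ℝ) : ℂ) ^ (-s)‖ ≤ a⁻¹ * smoothWeight a κ X j := by
  rw [norm_mul, norm_real, Real.norm_of_nonneg (smoothWeight_pos a κ X j).le,
    norm_cpow_eq_rpow_re_of_pos (by positivity), neg_re, mul_comm]
  gcongr
  · exact (smoothWeight_pos a κ X j).le
  · have := rpow_neg_le_mul ha ha1 (le_add_of_nonneg_left (Nat.cast_nonneg j)) hs0
      (show s.re ≤ 0 + 1 by linarith)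
    simpa [Real.rpow_neg_one] using this

lemma summable_smoothWeight_mul_cpow {a κ X : ℝ} (ha : 0 < a) (ha1 : a ≤ 1) (hκ : 0 < κ)
    (hX : 0 < X) {s : ℂ} (hs0 : 0 ≤ s.re) (hs1 : s.re ≤ 1) :
    Summable fun j : ℕ ↦ (smoothWeight a κ X j : ℂ) * ((j + a : ℝ) : ℂ) ^ (-s) :=
  Summable.of_norm_bounded ((summable_smoothWeight ha hκ hX).mul_left _)
    (norm_smoothWeight_mul_cpow_le ha ha1 hs0 hs1)

lemma differentiableOn_smoothedError {a κ X : ℝ} (ha : 0 < a) (ha1 : a ≤ 1) (hκ : 0 < κ)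
    (hX : 0 < X) : DifferentiableOn ℂ (smoothedError a κ X) {s | 0 < s.re ∧ s.re < 1} := by
  have hopen : IsOpen {s : ℂ | 0 < s.re ∧ s.re < 1} :=
    (isOpen_lt continuous_const continuous_re).inter (isOpen_lt continuous_re continuous_const)
  refine DifferentiableOn.sub (fun s hs ↦ ?_) ?_
  · refine (HurwitzZeta.differentiableAt_hurwitzZeta _ ?_).differentiableWithinAt
    rintro rfl
    exact absurd hs.2 (by simp)
  · refine differentiableOn_tsum_of_summable_norm ((summable_smoothWeight ha hκ hX).mul_left a⁻¹)
      (fun j s _ ↦ ?_) hopen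
      fun j s hs ↦ norm_smoothWeight_mul_cpow_le ha ha1 hs.1.le hs.2.le j
    have h0 : ((j + a : ℝ) : ℂ) ≠ 0 := by
      have : (0 : ℝ) < j + a := by positivity
      exact_mod_cast this.ne'
    exact ((differentiableAt_id.neg.const_cpow (Or.inl h0)).const_mul _).differentiableWithinAt

lemma tendsto_tsum_one_sub_smoothWeight {a κ p : ℝ} (ha : 0 < a) (hκ : 0 < κ) (hp : 1 / 2 < p) :
    Tendsto (fun X ↦ ∑' j : ℕ, (1 - smoothWeight a κ X j) * ((j : ℝ) + a) ^ (-(2 * p)))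
      atTop (𝓝 0) := by
  have h := tendsto_tsum_of_dominated_convergence (𝓕 := atTop)
    (f := fun X (j : ℕ) ↦ (1 - smoothWeight a κ X j) * ((j : ℝ) + a) ^ (-(2 * p)))
    (g := fun _ ↦ 0) (summable_nat_add_rpow ha (show -(2 * p) < -1 by linarith)) (fun j ↦ ?_) ?_
  · simpa using h
  · have h1 : Tendsto (fun X : ℝ ↦ (((j : ℝ) + a) / X) ^ κ) atTop (𝓝 0) := by
      have := (tendsto_id.const_div_atTop ((j : ℝ) + a)).rpow_const (p := κ) (Or.inr hκ.le)
      simpa [Real.zero_rpow hκ.ne'] using this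
    have h2 : Tendsto (fun X : ℝ ↦ smoothWeight a κ X j) atTop (𝓝 1) := by
      simpa [smoothWeight, Function.comp_def] using (Real.continuous_exp.tendsto _).comp h1.neg
    simpa using (h2.const_sub 1).mul_const (((j : ℝ) + a) ^ (-(2 * p)))
  · filter_upwards [eventually_gt_atTop 0] with X hX j
    have h1 := smoothWeight_pos a κ X j
    have h2 := smoothWeight_le_one (κ := κ) ha hX j
    rw [Real.norm_of_nonneg (mul_nonneg (by linarith) (by positivity))]
    exact mul_le_of_le_one_left (by positivity) (by linarith)

lemma norm_tsum_hurwitzTerm_tail_le {a p : ℝ} (ha : 0 < a) (hp : 1 / 2 < p) {s : ℂ}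
    (hps : p ≤ s.re) (hs : s ≠ 1) {L : ℕ} (hL : 1 ≤ L) :
    ‖∑' j : ℕ, hurwitzTerm ((j + L : ℕ) + a) s‖ ≤
      ‖s‖ * ((∑' j : ℕ, ((j : ℝ) + a) ^ (-(p + 1 / 2))) * (L : ℝ) ^ (-(1 / 2 : ℝ))) := by
  have hL1 : (1 : ℝ) ≤ L := by exact_mod_cast hL
  rw [← tsum_mul_right, ← tsum_mul_left]
  refine tsum_of_norm_bounded (Summable.hasSum (((summable_nat_add_rpow ha
    (show -(p + 1 / 2) < -1 by linarith)).mul_right _).mul_left _)) fun j ↦ ?_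
  refine (norm_hurwitzTerm_le (by positivity) hs (by linarith)).trans ?_
  push_cast
  have hj : (0 : ℝ) ≤ j := by positivity
  gcongr
  calc ((j : ℝ) + L + a) ^ (-s.re - 1) ≤ ((j : ℝ) + L + a) ^ (-(p + 1 / 2) + -(1 / 2 : ℝ)) :=
        Real.rpow_le_rpow_of_exponent_le (by linarith) (by linarith)
    _ = ((j : ℝ) + L + a) ^ (-(p + 1 / 2)) * ((j : ℝ) + L + a) ^ (-(1 / 2 : ℝ)) :=
        Real.rpow_add (by positivity) _ _
    _ ≤ _ := by
        refine mul_le_mul ?_ ?_ (by positivity) (by positivity)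
        · exact Real.rpow_le_rpow_of_nonpos (by positivity) (by linarith) (by linarith)
        · exact Real.rpow_le_rpow_of_nonpos (by positivity) (by linarith) (by norm_num)

lemma norm_tsum_smoothWeight_tail_le {a κ X : ℝ} (ha : 0 < a) (ha1 : a ≤ 1) (hκ : 0 < κ)
    (hX : 0 < X) {s : ℂ} (hs0 : 0 ≤ s.re) (hs1 : s.re ≤ 1) (M : ℕ) :
    ‖∑' j : ℕ, (smoothWeight a κ X (j + M) : ℂ) * (((j + M : ℕ) + a : ℝ) : ℂ) ^ (-s)‖ ≤
      a⁻¹ * ∑' j : ℕ, smoothWeight a κ X (j + M) := by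
  rw [← tsum_mul_left]
  exact tsum_of_norm_bounded (Summable.hasSum
    (((summable_nat_add_iff M).2 (summable_smoothWeight ha hκ hX)).mul_left _))
    fun j ↦ norm_smoothWeight_mul_cpow_le ha ha1 hs0 hs1 (j + M)

lemma norm_sq_cpow_div_le {a p q σ : ℝ} (ha : 0 < a) (hp0 : 0 < p) (hpσ : p ≤ σ) (hσq : σ ≤ q)
    (hq : q < 1) (t : ℝ) {M : ℕ} (hM : 1 ≤ M) :
    ‖((M + a : ℝ) : ℂ) ^ (1 - (σ + t * I)) / (σ + t * I - 1)‖ ^ 2 ≤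
      ((M + a) ^ (1 - p) / (1 - q)) ^ 2 * (1 + t ^ 2)⁻¹ := by
  have hM1 : (1 : ℝ) ≤ M := by exact_mod_cast hM
  have h1 : ‖(σ + t * I - 1 : ℂ)‖ ^ 2 = (1 - σ) ^ 2 + t ^ 2 := by
    rw [← normSq_eq_norm_sq, normSq_apply]
    simp
    ring
  have h2 : (1 - q) ^ 2 * (1 + t ^ 2) ≤ (1 - σ) ^ 2 + t ^ 2 := by
    nlinarith [sq_nonneg t, mul_nonneg (sub_nonneg.2 hσq) (sub_nonneg.2 hq.le),
      mul_nonneg (sub_nonneg.2 hσq) (sub_nonneg.2 hσq),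
      mul_nonneg (sq_nonneg t) (show 0 ≤ 1 - (1 - q) ^ 2 by nlinarith)]
  have hq0 : 0 < 1 - q := by linarith
  rw [norm_div, div_pow, h1, norm_cpow_eq_rpow_re_of_pos (by positivity), div_pow, div_mul_eq_mul_div,
    ← div_eq_mul_inv, div_div, mul_comm (1 + t ^ 2)]
  gcongr
  · linarith
  · simp
    linarith

lemma smoothedError_eq {a κ X : ℝ} (ha : 0 < a) (ha1 : a ≤ 1) (hκ : 0 < κ) (hX : 0 < X) {s : ℂ}
    (hs0 : 0 < s.re) (hs1 : s.re < 1) {M L : ℕ} (hML : M ≤ L) :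
    smoothedError a κ X s =
      ∑ j ∈ Finset.range M, ((1 - smoothWeight a κ X j : ℝ) : ℂ) * ((j + a : ℝ) : ℂ) ^ (-s) +
      ∑ j ∈ Finset.Ico M L, hurwitzTerm (j + a) s +
      (((M + a : ℝ) : ℂ) ^ (1 - s) / (s - 1) + ∑' j : ℕ, hurwitzTerm ((j + L : ℕ) + a) s -
        ∑' j : ℕ, (smoothWeight a κ X (j + M) : ℂ) * (((j + M : ℕ) + a : ℝ) : ℂ) ^ (-s)) := by
  have hs : s ≠ 1 := by
    rintro rfl
    simp at hs1
  have hsum := summable_hurwitzTerm ha hs hs0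
  have h1 := hsum.sum_add_tsum_nat_add M
  have h2 := hsum.sum_add_tsum_nat_add L
  have h3 := (summable_smoothWeight_mul_cpow ha ha1 hκ hX hs0.le hs1.le).sum_add_tsum_nat_add M
  rw [smoothedError, smoothedSum, hurwitzZeta_approx ha ha1 hs hs0 M, ← h3,
    Finset.sum_Ico_eq_sub _ hML]
  simp_rw [ofReal_sub, sub_mul, Finset.sum_sub_distrib]
  simp only [ofReal_one, one_mul]
  linear_combination h1 - h2

lemma sq_norm_add_three_le (x y z : ℂ) : ‖x + y + z‖ ^ 2 ≤ 3 * (‖x‖ ^ 2 + ‖y‖ ^ 2 + ‖z‖ ^ 2) := by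
  have h : ‖x + y + z‖ ≤ ‖x‖ + ‖y‖ + ‖z‖ := norm_add₃_le
  have h0 := norm_nonneg (x + y + z)
  nlinarith [sq_nonneg (‖x‖ - ‖y‖), sq_nonneg (‖y‖ - ‖z‖), sq_nonneg (‖x‖ - ‖z‖),
    mul_self_le_mul_self h0 h]

lemma integral_inv_one_add_sq_le_pi (T : ℝ) : ∫ t in (-T)..T, (1 + t ^ 2)⁻¹ ≤ Real.pi := by
  rw [integral_inv_one_add_sq, Real.arctan_neg]
  linarith [Real.arctan_lt_pi_div_two T]

lemma continuous_smoothedError_vertical {a κ X σ : ℝ} (ha : 0 < a) (ha1 : a ≤ 1) (hκ : 0 < κ)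
    (hX : 0 < X) (h0 : 0 < σ) (h1 : σ < 1) :
    Continuous fun t : ℝ ↦ smoothedError a κ X (σ + t * I) :=
  (differentiableOn_smoothedError ha ha1 hκ hX).continuousOn.comp_continuous (by fun_prop)
    fun t ↦ by simpa using ⟨h0, h1⟩

lemma integral_norm_sq_smoothedError_le {a κ X p q σ T : ℝ} (ha : 0 < a) (ha1 : a ≤ 1)
    (hκ : 0 < κ) (hX : 0 < X) (hp : 1 / 2 < p) (hpσ : p ≤ σ) (hσq : σ ≤ q) (hq : q < 1)
    (hT : 0 ≤ T) {M L : ℕ} (hM : 1 ≤ M) (hML : M ≤ L) :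
    ∫ t in (-T)..T, ‖smoothedError a κ X (σ + t * I)‖ ^ 2 ≤
      3 * (2 * T * (a⁻¹ ^ 2 * ∑' j, (1 - smoothWeight a κ X j) * ((j : ℝ) + a) ^ (-(2 * p))) +
        16 * a⁻¹ ^ 2 * (∑' j : ℕ, ((j : ℝ) + a) ^ (-(p + 1 / 2))) *
          ((M : ℝ) ^ (3 / 2 - p) * (1 + Real.log M))) +
      3 * ((1 + T) ^ 2 *
        (2 * T * ((∑' j : ℕ, ((j : ℝ) + a) ^ (-(p + 1 / 2))) * (M : ℝ) ^ (-(p + 3 / 2))) +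
        8 * (M : ℝ) ^ (-p) * (1 + Real.log L) *
          ((∑' j : ℕ, ((j : ℝ) + a) ^ (-(p + 1 / 2))) * (M : ℝ) ^ (-(1 / 2 : ℝ))))) +
      (9 * (((M + a) ^ (1 - p) / (1 - q)) ^ 2 * Real.pi) +
        2 * T * (9 * (((1 + T) * ((∑' j : ℕ, ((j : ℝ) + a) ^ (-(p + 1 / 2))) *
          (L : ℝ) ^ (-(1 / 2 : ℝ)))) ^ 2 + (a⁻¹ * ∑' j : ℕ, smoothWeight a κ X (j + M)) ^ 2))) := by
  have hσ0 : 0 < σ := by linarith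
  have hσ1 : σ < 1 := by linarith
  have hs1 : ∀ t : ℝ, (σ + t * I : ℂ) ≠ 1 := fun t h ↦ by
    have := congrArg re h
    simp at this
    linarith
  set P : ℝ → ℂ := fun t ↦ ∑ j ∈ Finset.range M,
    ((1 - smoothWeight a κ X j : ℝ) : ℂ) * ((j + a : ℝ) : ℂ) ^ (-(σ + t * I))
  set R : ℝ → ℂ := fun t ↦ ∑ j ∈ Finset.Ico M L, hurwitzTerm (j + a) (σ + t * I)
  set r := (1 + T) * ((∑' j : ℕ, ((j : ℝ) + a) ^ (-(p + 1 / 2))) * (L : ℝ) ^ (-(1 / 2 : ℝ)))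
  set w := a⁻¹ * ∑' j : ℕ, smoothWeight a κ X (j + M)
  set d := ((M + a) ^ (1 - p) / (1 - q)) ^ 2
  have hP : Continuous P := by
    refine continuous_finsetSum _ fun j _ ↦ Continuous.mul continuous_const ?_
    refine Continuous.const_cpow (by fun_prop) (Or.inl ?_)
    have : (0 : ℝ) < j + a := by positivity
    exact_mod_cast this.ne'
  have hR : Continuous R := by
    refine continuous_finsetSum _ fun j _ ↦ continuous_iff_continuousAt.2 fun t ↦ ?_
    exact (differentiableAt_hurwitzTerm (by positivity) (hs1 t)).continuousAt.comp
      (f := fun t : ℝ ↦ (σ + t * I : ℂ)) (by fun_prop)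
  have hinv : Continuous fun t : ℝ ↦ (1 + t ^ 2)⁻¹ :=
    Continuous.inv₀ (by fun_prop) fun t ↦ by positivity
  have hpt : ∀ t ∈ Set.Icc (-T) T, ‖smoothedError a κ X (σ + t * I)‖ ^ 2 ≤
      3 * ‖P t‖ ^ 2 + 3 * ‖R t‖ ^ 2 + (9 * (d * (1 + t ^ 2)⁻¹) + 9 * (r ^ 2 + w ^ 2)) := fun t ht ↦ by
    have hre : (σ + t * I : ℂ).re = σ := by simp
    have hs : ‖(σ + t * I : ℂ)‖ ≤ 1 + T := by
      refine (norm_add_le _ _).trans (add_le_add ?_ ?_)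
      · rw [norm_real, Real.norm_of_nonneg (by linarith)]; exact hσ1.le
      · rw [norm_mul, norm_I, mul_one, norm_real]; exact abs_le.2 ht
    rw [smoothedError_eq ha ha1 hκ hX (hre.symm ▸ hσ0) (hre.symm ▸ hσ1) hML]
    refine (sq_norm_add_three_le _ _ _).trans ?_
    rw [sub_eq_add_neg]
    have h3 := sq_norm_add_three_le (((M + a : ℝ) : ℂ) ^ (1 - (σ + t * I : ℂ)) / (σ + t * I - 1))
      (∑' j : ℕ, hurwitzTerm ((j + L : ℕ) + a) (σ + t * I))
      (-∑' j : ℕ, (smoothWeight a κ X (j + M) : ℂ) * (((j + M : ℕ) + a : ℝ) : ℂ) ^ (-(σ + t * I : ℂ)))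
    have hd := norm_sq_cpow_div_le ha (by linarith) hpσ hσq hq t hM
    have hr : ‖∑' j : ℕ, hurwitzTerm ((j + L : ℕ) + a) (σ + t * I)‖ ^ 2 ≤ r ^ 2 := by
      gcongr
      refine (norm_tsum_hurwitzTerm_tail_le ha hp (by rwa [hre]) (hs1 t) (hM.trans hML)).trans ?_
      exact mul_le_mul_of_nonneg_right hs
        (mul_nonneg (tsum_nonneg fun _ ↦ by positivity) (by positivity))
    have hw : ‖-∑' j : ℕ, (smoothWeight a κ X (j + M) : ℂ) *
        (((j + M : ℕ) + a : ℝ) : ℂ) ^ (-(σ + t * I : ℂ))‖ ^ 2 ≤ w ^ 2 := by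
      rw [norm_neg]
      gcongr
      exact norm_tsum_smoothWeight_tail_le ha ha1 hκ hX (hre.symm ▸ hσ0.le) (hre.symm ▸ hσ1.le) M
    linarith
  have hPi := integral_norm_sq_sum_range_le ha ha1 hp (by linarith) hpσ hσ1 hT
    (fun j ↦ sub_nonneg.2 (smoothWeight_le_one (κ := κ) ha hX j))
    (fun j ↦ sub_le_self 1 (smoothWeight_pos a κ X j).le) hM
  have hRi := integral_norm_sq_sum_hurwitzTerm_le ha hp hpσ hσ1 hT hM (hM.trans hML)
  have hd0 : 0 ≤ d := sq_nonneg _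
  calc _ ≤ ∫ t in (-T)..T,
        (3 * ‖P t‖ ^ 2 + 3 * ‖R t‖ ^ 2 + (9 * (d * (1 + t ^ 2)⁻¹) + 9 * (r ^ 2 + w ^ 2))) := by
        refine intervalIntegral.integral_mono_on (by linarith) ?_ ?_ hpt
        · exact ((continuous_smoothedError_vertical ha ha1 hκ hX hσ0 hσ1).norm.pow
            2).intervalIntegrable _ _
        · exact Continuous.intervalIntegrable (by fun_prop) _ _
    _ = 3 * (∫ t in (-T)..T, ‖P t‖ ^ 2) + 3 * (∫ t in (-T)..T, ‖R t‖ ^ 2) +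
        (9 * (d * ∫ t in (-T)..T, (1 + t ^ 2)⁻¹) + 2 * T * (9 * (r ^ 2 + w ^ 2))) := by
        rw [intervalIntegral.integral_add, intervalIntegral.integral_add,
          intervalIntegral.integral_add, intervalIntegral.integral_const_mul,
          intervalIntegral.integral_const_mul, intervalIntegral.integral_const_mul,
          intervalIntegral.integral_const_mul, intervalIntegral.integral_const]
        · simp only [smul_eq_mul]
          ring
        all_goals exact Continuous.intervalIntegrable (by fun_prop) _ _
    _ ≤ _ := by
        gcongr
        exact integral_inv_one_add_sq_le_pi T

lemma exists_integral_norm_sq_smoothedError_le {a κ p q c : ℝ} (ha : 0 < a) (ha1 : a ≤ 1)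
    (hκ : 0 < κ) (hp : 1 / 2 < p) (hq : q < 1) (hc : 0 < c) :
    ∃ C : ℝ, ∀ X : ℝ, 0 < X → ∀ M : ℕ, 1 ≤ M → ∀ σ ∈ Set.Icc p q,
      ∫ t in (-(c * M))..(c * M), ‖smoothedError a κ X (σ + t * I)‖ ^ 2 ≤
        6 * c * a⁻¹ ^ 2 * (∑' j, (1 - smoothWeight a κ X j) * ((j : ℝ) + a) ^ (-(2 * p))) * M +
        C * ((M : ℝ) ^ (3 / 2 - p) * (1 + Real.log M)) +
        18 * c * (a⁻¹ * ∑' j : ℕ, smoothWeight a κ X (j + M)) ^ 2 * M := by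
  set S := ∑' j : ℕ, ((j : ℝ) + a) ^ (-(p + 1 / 2)) with hSdef
  have hS : 0 ≤ S := tsum_nonneg fun _ ↦ by positivity
  refine ⟨48 * a⁻¹ ^ 2 * S + 3 * (1 + c) ^ 2 * S * (2 * c + 32) + 36 * Real.pi / (1 - q) ^ 2 +
    18 * c * (1 + c) ^ 2 * S ^ 2, fun X hX M hM σ hσ ↦ ?_⟩
  have hM1 : (1 : ℝ) ≤ M := by exact_mod_cast hM
  have hM0 : (0 : ℝ) < M := by linarith
  have hlog := Real.log_nonneg hM1
  have hp1 : p < 1 := (hσ.1.trans hσ.2).trans_lt hq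
  have hq0 : 0 < 1 - q := by linarith
  have h := integral_norm_sq_smoothedError_le ha ha1 hκ hX hp hσ.1 hσ.2 hq
    (show 0 ≤ c * M by positivity) hM (Nat.le_self_pow (n := 4) (by norm_num) M)
  rw [← hSdef] at h
  refine h.trans ?_
  set Y := (M : ℝ) ^ (3 / 2 - p)
  have hY1 : 1 ≤ Y := Real.one_le_rpow hM1 (by linarith)
  have hYZ : Y ≤ Y * (1 + Real.log M) := le_mul_of_one_le_right (by linarith) (by linarith)
  set Z := Y * (1 + Real.log M)
  have hT : (1 + c * M) ^ 2 ≤ (1 + c) ^ 2 * (M : ℝ) ^ (2 : ℝ) := by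
    rw [Real.rpow_two, ← mul_pow]
    gcongr
    linarith
  have h2 : (1 + c * M) ^ 2 * (2 * (c * M) * (S * (M : ℝ) ^ (-(p + 3 / 2))) +
      8 * (M : ℝ) ^ (-p) * (1 + Real.log (M ^ 4 : ℕ)) * (S * (M : ℝ) ^ (-(1 / 2 : ℝ)))) ≤
      (1 + c) ^ 2 * S * (2 * c + 32) * Z := by
    have e1 : (M : ℝ) ^ (2 : ℝ) * (M * (M : ℝ) ^ (-(p + 3 / 2))) = Y := by
      rw [mul_comm (M : ℝ) (_ ^ (-_)), ← Real.rpow_add_one hM0.ne', ← Real.rpow_add hM0]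
      congr 1
      ring
    have e2 : (M : ℝ) ^ (2 : ℝ) * ((M : ℝ) ^ (-p) * (M : ℝ) ^ (-(1 / 2 : ℝ))) = Y := by
      rw [← Real.rpow_add hM0, ← Real.rpow_add hM0]
      congr 1
      ring
    have hl : 1 + Real.log (M ^ 4 : ℕ) ≤ 4 * (1 + Real.log M) := by
      push_cast
      rw [Real.log_pow]
      push_cast
      linarith
    calc _ ≤ (1 + c) ^ 2 * (M : ℝ) ^ (2 : ℝ) * (2 * (c * M) * (S * (M : ℝ) ^ (-(p + 3 / 2))) +
          8 * (M : ℝ) ^ (-p) * (4 * (1 + Real.log M)) * (S * (M : ℝ) ^ (-(1 / 2 : ℝ)))) := by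
          gcongr
      _ = (1 + c) ^ 2 * S * (2 * c * ((M : ℝ) ^ (2 : ℝ) * (M * (M : ℝ) ^ (-(p + 3 / 2)))) +
          32 * (1 + Real.log M) *
            ((M : ℝ) ^ (2 : ℝ) * ((M : ℝ) ^ (-p) * (M : ℝ) ^ (-(1 / 2 : ℝ))))) := by ring
      _ = (1 + c) ^ 2 * S * (2 * c * Y + 32 * Z) := by rw [e1, e2]; ring
      _ ≤ (1 + c) ^ 2 * S * (2 * c * Z + 32 * Z) := by gcongr
      _ = _ := by ring
  have h3 : (((M : ℝ) + a) ^ (1 - p) / (1 - q)) ^ 2 * Real.pi ≤ 4 * Real.pi / (1 - q) ^ 2 * Z := by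
    have h4 : ((M : ℝ) + a) ^ (1 - p) ≤ 2 * (M : ℝ) ^ (1 - p) := by
      calc ((M : ℝ) + a) ^ (1 - p) ≤ (2 * (M : ℝ)) ^ (1 - p) :=
            Real.rpow_le_rpow (by positivity) (by linarith) (by linarith)
        _ = 2 ^ (1 - p) * (M : ℝ) ^ (1 - p) := Real.mul_rpow (by norm_num) (by positivity)
        _ ≤ 2 ^ (1 : ℝ) * (M : ℝ) ^ (1 - p) := by gcongr <;> linarith
        _ = _ := by rw [Real.rpow_one]
    have h5 : (2 * (M : ℝ) ^ (1 - p)) ^ 2 ≤ 4 * Z := by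
      rw [mul_pow, sq ((M : ℝ) ^ _), ← Real.rpow_add hM0]
      have : (M : ℝ) ^ (1 - p + (1 - p)) ≤ Y :=
        Real.rpow_le_rpow_of_exponent_le hM1 (by linarith)
      linarith
    calc _ ≤ (2 * (M : ℝ) ^ (1 - p) / (1 - q)) ^ 2 * Real.pi := by gcongr
      _ = (2 * (M : ℝ) ^ (1 - p)) ^ 2 * Real.pi / (1 - q) ^ 2 := by rw [div_pow]; ring
      _ ≤ 4 * Z * Real.pi / (1 - q) ^ 2 := by gcongr
      _ = _ := by ring
  have h4 : 2 * (c * M) * ((1 + c * M) * (S * ((M ^ 4 : ℕ) : ℝ) ^ (-(1 / 2 : ℝ)))) ^ 2 ≤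
      2 * c * (1 + c) ^ 2 * S ^ 2 * Z := by
    have e : ((M ^ 4 : ℕ) : ℝ) ^ (-(1 / 2 : ℝ)) = (M : ℝ) ^ (-2 : ℝ) := by
      push_cast
      rw [← Real.rpow_natCast, ← Real.rpow_mul hM0.le]
      norm_num
    have e1 : M * (M : ℝ) ^ (2 : ℝ) * ((M : ℝ) ^ (-2 : ℝ)) ^ 2 = (M : ℝ)⁻¹ := by
      rw [Real.rpow_neg hM0.le, Real.rpow_two]
      field_simp
    have e2 : (M : ℝ)⁻¹ ≤ Z := (inv_le_one_of_one_le₀ hM1).trans (hY1.trans hYZ)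
    calc _ = 2 * (c * M) * ((1 + c * M) ^ 2 * S ^ 2 * ((M : ℝ) ^ (-2 : ℝ)) ^ 2) := by rw [e]; ring
      _ ≤ 2 * (c * M) * ((1 + c) ^ 2 * (M : ℝ) ^ (2 : ℝ) * S ^ 2 * ((M : ℝ) ^ (-2 : ℝ)) ^ 2) := by
          gcongr
      _ = 2 * c * (1 + c) ^ 2 * S ^ 2 * (M * (M : ℝ) ^ (2 : ℝ) * ((M : ℝ) ^ (-2 : ℝ)) ^ 2) := by ring
      _ ≤ _ := by rw [e1]; gcongr
  linear_combination 3 * h2 + 9 * h3 + 9 * h4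

lemma tendsto_rpow_mul_one_add_log_div {θ : ℝ} (hθ : θ < 1) :
    Tendsto (fun M : ℕ ↦ (M : ℝ) ^ θ * (1 + Real.log M) / M) atTop (𝓝 0) := by
  have h1 : Tendsto (fun x : ℝ ↦ x ^ (-(1 - θ))) atTop (𝓝 0) :=
    tendsto_rpow_neg_atTop (by linarith)
  have h2 : Tendsto (fun x : ℝ ↦ Real.log x / x ^ (1 - θ)) atTop (𝓝 0) :=
    (isLittleO_log_rpow_atTop (by linarith)).tendsto_div_nhds_zero
  have h3 := (h1.add h2).comp tendsto_natCast_atTop_atTop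
  rw [add_zero] at h3
  refine h3.congr' ?_
  filter_upwards [eventually_gt_atTop 0] with M hM
  have hM0 : (0 : ℝ) < M := by exact_mod_cast hM
  have e : (M : ℝ) ^ (1 - θ) = M / (M : ℝ) ^ θ := by rw [Real.rpow_sub hM0, Real.rpow_one]
  simp only [Function.comp_apply]
  rw [Real.rpow_neg hM0.le, e]
  field_simp

/-- The mean square of the smoothed error on vertical segments of length `≍ M` is `≤ ε M`. -/
lemma eventually_integral_norm_sq_smoothedError_le {a κ p q c : ℝ} (ha : 0 < a) (ha1 : a ≤ 1)
    (hκ : 0 < κ) (hp : 1 / 2 < p) (hq : q < 1) (hc : 0 < c) {ε : ℝ} (hε : 0 < ε) :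
    ∀ᶠ X : ℝ in atTop, ∀ᶠ M : ℕ in atTop, ∀ σ ∈ Set.Icc p q,
      ∫ t in (-(c * M))..(c * M), ‖smoothedError a κ X (σ + t * I)‖ ^ 2 ≤ ε * M := by
  obtain ⟨C, hC⟩ := exists_integral_norm_sq_smoothedError_le ha ha1 hκ hp hq hc
  have h1 := (tendsto_tsum_one_sub_smoothWeight ha hκ hp).const_mul (6 * c * a⁻¹ ^ 2)
  rw [mul_zero] at h1
  filter_upwards [h1.eventually (gt_mem_nhds hε), eventually_gt_atTop 0] with X hXε hX
  have h2 := (tendsto_rpow_mul_one_add_log_div (show 3 / 2 - p < 1 by linarith)).const_mul C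
  have h3 := (((tendsto_sum_nat_add (smoothWeight a κ X)).const_mul a⁻¹).pow 2).const_mul (18 * c)
  have h4 := (h2.const_add (6 * c * a⁻¹ ^ 2 *
    ∑' j, (1 - smoothWeight a κ X j) * ((j : ℝ) + a) ^ (-(2 * p)))).add h3
  simp only [mul_zero, add_zero, ne_eq, OfNat.ofNat_ne_zero, not_false_eq_true, zero_pow] at h4
  filter_upwards [h4.eventually (gt_mem_nhds hXε), eventually_ge_atTop 1] with M hMε hM σ hσ
  have hM0 : (0 : ℝ) < M := by exact_mod_cast hM
  refine (hC X hX M hM σ hσ).trans (le_trans (le_of_eq ?_) (mul_le_mul_of_nonneg_right hMε.le hM0.le))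
  field_simp

lemma ofReal_two_pi_mul_enorm_le_lintegral_circleMap {G : ℂ → ℂ} {z : ℂ} {ρ : ℝ} (hρ : 0 ≤ ρ)
    (hG : DiffContOnCl ℂ G (Metric.ball z ρ)) :
    ENNReal.ofReal (2 * Real.pi) * ‖G z‖ₑ ≤
      ∫⁻ θ in Set.Ioo (-Real.pi) Real.pi, ‖G (circleMap z ρ θ)‖ₑ := by
  have h1 := DiffContOnCl.circleAverage (c := z) (R := ρ) (by rwa [abs_of_nonneg hρ])
  have h2 : ∫ θ in (-Real.pi)..Real.pi, G (circleMap z ρ θ) = (2 * Real.pi : ℝ) * G z := by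
    have hper : Function.Periodic (fun θ ↦ G (circleMap z ρ θ)) (2 * Real.pi) := fun θ ↦ by
      simp only [periodic_circleMap z ρ θ]
    have h3 := hper.intervalIntegral_add_eq (-Real.pi) 0
    rw [show -Real.pi + 2 * Real.pi = Real.pi by ring, zero_add] at h3
    rw [h3, ← h1, Real.circleAverage, real_smul, ← mul_assoc, ← ofReal_mul,
      mul_inv_cancel₀ (by positivity), ofReal_one, one_mul]
  have h3 : ENNReal.ofReal (2 * Real.pi) = ‖((2 * Real.pi : ℝ) : ℂ)‖ₑ := by
    rw [← ofReal_norm, norm_real, Real.norm_of_nonneg (by positivity)]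
  rw [h3, ← enorm_mul, ← h2, intervalIntegral.integral_of_le (by linarith [Real.pi_pos]),
    integral_Ioc_eq_integral_Ioo]
  exact enorm_integral_le_lintegral_enorm _

/-- The value of a holomorphic function at the centre of a disc is controlled by its `L¹` norm on
any rectangle containing the disc. -/
lemma norm_le_integral_rectangle {G : ℂ → ℂ} {z : ℂ} {r p q A B : ℝ} (hr : 0 < r)
    (hG : DifferentiableOn ℂ G {s | s.re ∈ Set.Icc p q}) (hp : p ≤ z.re - r) (hq : z.re + r ≤ q)
    (hA : A ≤ z.im - r) (hB : z.im + r ≤ B) :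
    Real.pi * r ^ 2 * ‖G z‖ ≤ ∫ σ in p..q, ∫ t in A..B, ‖G (σ + t * I)‖ := by
  have hball : ∀ ρ ≤ r, Metric.closedBall z ρ ⊆ {s | s.re ∈ Set.Icc p q} := fun ρ hρ s hs ↦ by
    have h1 := (abs_re_le_norm (s - z)).trans ((mem_closedBall_iff_norm.1 hs).trans hρ)
    rw [sub_re, abs_le] at h1
    constructor <;> linarith
  set R : Set (ℝ × ℝ) := Set.Icc p q ×ˢ Set.Icc A B
  set H : ℝ × ℝ → ENNReal := R.indicator fun v ↦ ‖G (v.1 + v.2 * I)‖ₑ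
  have hmap : ContinuousOn (fun v : ℝ × ℝ ↦ G (v.1 + v.2 * I)) R :=
    hG.continuousOn.comp (by fun_prop) fun v hv ↦ by simpa using hv.1
  have hpolar := lintegral_comp_polarCoord_symm fun v ↦ H ((z.re, z.im) + v)
  rw [lintegral_add_left_eq_self, polarCoord_target, lintegral_indicator
    (measurableSet_Icc.prod measurableSet_Icc)] at hpolar
  have hval : ∀ ρ ∈ Set.Ioc 0 r, ∀ θ, H ((z.re, z.im) + polarCoord.symm (ρ, θ)) =
      ‖G (circleMap z ρ θ)‖ₑ := fun ρ hρ θ ↦ by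
    have h1 := abs_le.1 (Real.abs_cos_le_one θ)
    have h2 := abs_le.1 (Real.abs_sin_le_one θ)
    have hmem : (z.re, z.im) + polarCoord.symm (ρ, θ) ∈ R := by
      simp only [polarCoord_symm_apply, Prod.mk_add_mk, R, Set.mem_prod, Set.mem_Icc]
      refine ⟨⟨?_, ?_⟩, ?_, ?_⟩ <;> nlinarith [hρ.1, hρ.2]
    simp only [H]
    rw [Set.indicator_of_mem hmem]
    congr 2
    apply Complex.ext <;> simp [polarCoord_symm_apply, circleMap]
    · exact Or.inl (cos_ofReal_re θ)
    · exact Or.inl (sin_ofReal_re θ)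
  have hcirc : ContinuousOn (fun v : ℝ × ℝ ↦ G (circleMap z v.1 v.2))
      (Set.Ioc 0 r ×ˢ Set.Ioo (-Real.pi) Real.pi) := by
    refine hG.continuousOn.comp (by unfold circleMap; fun_prop) fun v hv ↦ ?_
    exact hball v.1 hv.1.2 (circleMap_mem_closedBall z hv.1.1.le v.2)
  have hlow : ENNReal.ofReal (Real.pi * r ^ 2) * ‖G z‖ₑ ≤ ∫⁻ v in R, ‖G (v.1 + v.2 * I)‖ₑ := by
    calc ENNReal.ofReal (Real.pi * r ^ 2) * ‖G z‖ₑ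
        = ∫⁻ ρ in Set.Ioc 0 r, ENNReal.ofReal ρ * (ENNReal.ofReal (2 * Real.pi) * ‖G z‖ₑ) := by
          rw [lintegral_mul_const _ (by fun_prop), ← ofReal_integral_eq_lintegral_ofReal,
            ← intervalIntegral.integral_of_le hr.le, integral_id, ← mul_assoc,
            ← ENNReal.ofReal_mul (show 0 ≤ (r ^ 2 - 0 ^ 2) / 2 by simp; positivity)]
          · ring_nf
          · exact (continuous_id.integrableOn_Icc).mono_set Set.Ioc_subset_Icc_self
          · filter_upwards [ae_restrict_mem measurableSet_Ioc] with ρ hρ using hρ.1.le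
      _ ≤ ∫⁻ ρ in Set.Ioc 0 r, ∫⁻ θ in Set.Ioo (-Real.pi) Real.pi,
            ENNReal.ofReal ρ * ‖G (circleMap z ρ θ)‖ₑ := by
          refine setLIntegral_mono' measurableSet_Ioc fun ρ hρ ↦ ?_
          rw [lintegral_const_mul' _ _ ENNReal.ofReal_ne_top]
          gcongr
          refine ofReal_two_pi_mul_enorm_le_lintegral_circleMap hρ.1.le ?_
          refine DifferentiableOn.diffContOnCl (hG.mono ?_)
          exact Metric.closure_ball_subset_closedBall.trans (hball ρ hρ.2)
      _ = ∫⁻ v in Set.Ioc 0 r ×ˢ Set.Ioo (-Real.pi) Real.pi,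
            ENNReal.ofReal v.1 * ‖G (circleMap z v.1 v.2)‖ₑ := by
          rw [Measure.volume_eq_prod, ← Measure.prod_restrict, lintegral_prod]
          rw [Measure.prod_restrict]
          refine AEMeasurable.mul measurable_fst.ennreal_ofReal.aemeasurable ?_
          exact (hcirc.enorm).aemeasurable (measurableSet_Ioc.prod measurableSet_Ioo)
      _ = ∫⁻ v in Set.Ioc 0 r ×ˢ Set.Ioo (-Real.pi) Real.pi,
            ENNReal.ofReal v.1 • H ((z.re, z.im) + polarCoord.symm v) := by
          refine setLIntegral_congr_fun (measurableSet_Ioc.prod measurableSet_Ioo) fun v hv ↦ ?_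
          simp only [smul_eq_mul]
          rw [← hval v.1 hv.1 v.2]
      _ ≤ ∫⁻ v in Set.Ioi 0 ×ˢ Set.Ioo (-Real.pi) Real.pi,
            ENNReal.ofReal v.1 • H ((z.re, z.im) + polarCoord.symm v) :=
          lintegral_mono_set (Set.prod_mono Set.Ioc_subset_Ioi_self subset_rfl)
      _ = _ := hpolar
  have hint : IntegrableOn (fun v : ℝ × ℝ ↦ G (v.1 + v.2 * I)) R :=
    hmap.integrableOn_compact (isCompact_Icc.prod isCompact_Icc)
  rw [← ofReal_integral_norm_eq_lintegral_enorm hint, ← ofReal_norm,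
    ← ENNReal.ofReal_mul (by positivity), ENNReal.ofReal_le_ofReal_iff
      (integral_nonneg fun _ ↦ norm_nonneg _)] at hlow
  refine hlow.trans (le_of_eq ?_)
  rw [Measure.volume_eq_prod, setIntegral_prod _ hint.norm, intervalIntegral.integral_of_le
    (by linarith), integral_Icc_eq_integral_Ioc]
  refine setIntegral_congr_fun measurableSet_Ioc fun σ _ ↦ ?_
  simp only
  rw [intervalIntegral.integral_of_le (by linarith), integral_Icc_eq_integral_Ioc]

lemma sum_integral_shifted_le {g : ℝ → ℝ} (hg : Continuous g) (hg0 : ∀ t, 0 ≤ g t) {h : ℝ}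
    (hh : 0 < h) (Q : ℕ) {M : ℕ} (hM : 1 ≤ M) :
    ∑ k ∈ Finset.range M, ∫ t in ((k - Q) * h)..((k + Q) * h), g t ≤
      2 * Q * ∫ t in (-((Q + 1) * h * M))..((Q + 1) * h * M), g t := by
  have hint : ∀ x y, IntervalIntegrable g volume x y := fun x y ↦ hg.intervalIntegrable x y
  have hM1 : (1 : ℝ) ≤ M := by exact_mod_cast hM
  have hQ0 : (0 : ℝ) ≤ Q := Nat.cast_nonneg Q
  have e1 : ∀ k : ℕ, ∫ t in ((k - Q) * h)..((k + Q) * h), g t =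
      ∑ i ∈ Finset.range (2 * Q), ∫ t in ((k + i - Q) * h)..((k + (i + 1 : ℕ) - Q) * h), g t :=
    fun k ↦ by
      rw [intervalIntegral.sum_integral_adjacent_intervals
        (a := fun i : ℕ ↦ ((k : ℝ) + i - Q) * h) fun _ _ ↦ hint _ _]
      congr 1 <;> push_cast <;> ring
  have e2 : ∀ i : ℕ, ∑ k ∈ Finset.range M,
      ∫ t in (((k : ℝ) + i - Q) * h)..((k + (i + 1 : ℕ) - Q) * h), g t =
      ∫ t in ((i - Q) * h)..((M + i - Q) * h), g t := fun i ↦ by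
    have := intervalIntegral.sum_integral_adjacent_intervals (μ := volume) (f := g) (n := M)
      (a := fun k : ℕ ↦ ((k : ℝ) + i - Q) * h) fun _ _ ↦ hint _ _
    simp only [Nat.cast_zero, zero_add] at this
    rw [← this]
    refine Finset.sum_congr rfl fun k _ ↦ ?_
    congr 1
    push_cast
    ring
  simp_rw [e1]
  rw [Finset.sum_comm]
  calc _ ≤ ∑ _i ∈ Finset.range (2 * Q), ∫ t in (-((Q + 1) * h * M))..((Q + 1) * h * M), g t := by
        refine Finset.sum_le_sum fun i hi ↦ ?_
        have hi2 : (i : ℝ) ≤ 2 * Q := by exact_mod_cast (Finset.mem_range.1 hi).le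
        have hi0 : (0 : ℝ) ≤ i := Nat.cast_nonneg i
        rw [e2]
        refine intervalIntegral.integral_mono_interval ?_ ?_ ?_ (ae_of_all _ hg0) (hint _ _)
        · have : (0 : ℝ) ≤ i + (Q * (M - 1) + M) := by
            have := mul_nonneg hQ0 (sub_nonneg.2 hM1)
            linarith
          nlinarith
        · gcongr
          linarith
        · have : (0 : ℝ) ≤ Q * (M - 1) + (2 * Q - i) := by
            have := mul_nonneg hQ0 (sub_nonneg.2 hM1)
            linarith
          nlinarith
    _ = _ := by simp

lemma intervalIntegrable_integral_norm {G : ℂ → ℂ} {p q A B : ℝ} (hpq : p ≤ q) (hAB : A ≤ B)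
    (hG : ContinuousOn G {s | s.re ∈ Set.Icc p q}) :
    IntervalIntegrable (fun σ : ℝ ↦ ∫ t in A..B, ‖G (σ + t * I)‖) volume p q := by
  have hmap : ContinuousOn (fun v : ℝ × ℝ ↦ ‖G (v.1 + v.2 * I)‖) (Set.Icc p q ×ˢ Set.Icc A B) :=
    (hG.comp (by fun_prop) fun v hv ↦ by simpa using hv.1).norm
  have hint : Integrable (fun v : ℝ × ℝ ↦ ‖G (v.1 + v.2 * I)‖)
      ((volume.restrict (Set.Ioc p q)).prod (volume.restrict (Set.Ioc A B))) := by
    rw [Measure.prod_restrict]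
    exact (hmap.integrableOn_compact (isCompact_Icc.prod isCompact_Icc)).mono_set
      (Set.prod_mono Set.Ioc_subset_Icc_self Set.Ioc_subset_Icc_self)
  simp_rw [intervalIntegral.integral_of_le hAB]
  rw [intervalIntegrable_iff, Set.uIoc_of_le hpq]
  exact hint.integral_prod_left

lemma integral_norm_le_of_integral_norm_sq_le {g : ℝ → ℂ} (hg : Continuous g) {T V η : ℝ}
    (hT : 0 ≤ T) (hη : 0 < η) (h : ∫ t in (-T)..T, ‖g t‖ ^ 2 ≤ V) :
    ∫ t in (-T)..T, ‖g t‖ ≤ 2 * T * η + V / (4 * η) := by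
  calc _ ≤ ∫ t in (-T)..T, (η + ‖g t‖ ^ 2 / (4 * η)) := by
        refine intervalIntegral.integral_mono_on (by linarith)
          (hg.norm.intervalIntegrable _ _) (Continuous.intervalIntegrable (by fun_prop) _ _)
          fun t _ ↦ ?_
        rw [← sub_nonneg]
        have : η + ‖g t‖ ^ 2 / (4 * η) - ‖g t‖ = (2 * η - ‖g t‖) ^ 2 / (4 * η) := by
          field_simp
          ring
        rw [this]
        positivity
    _ = 2 * T * η + (∫ t in (-T)..T, ‖g t‖ ^ 2) / (4 * η) := by
        rw [intervalIntegral.integral_add (by simp)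
          (Continuous.intervalIntegrable (by fun_prop) _ _), intervalIntegral.integral_div,
          intervalIntegral.integral_const, smul_eq_mul]
        ring
    _ ≤ _ := by gcongr

lemma IsCompact.exists_subset_strip {K : Set ℂ} (hK : IsCompact K) (hne : K.Nonempty)
    (hKsub : K ⊆ {s : ℂ | 1 / 2 < s.re ∧ s.re < 1}) :
    ∃ p q r : ℝ, 1 / 2 < p ∧ p ≤ q ∧ q < 1 ∧ 0 < r ∧ ∀ s ∈ K, p ≤ s.re - r ∧ s.re + r ≤ q := by
  obtain ⟨x, hx, hxmin⟩ := hK.exists_isMinOn hne continuous_re.continuousOn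
  obtain ⟨y, hy, hymax⟩ := hK.exists_isMaxOn hne continuous_re.continuousOn
  have h1 := (hKsub hx).1
  have h2 := (hKsub hy).2
  have hxy : x.re ≤ y.re := hxmin hy
  set r := min ((x.re - 1 / 2) / 2) ((1 - y.re) / 2)
  have hr1 : r ≤ (x.re - 1 / 2) / 2 := min_le_left _ _
  have hr2 : r ≤ (1 - y.re) / 2 := min_le_right _ _
  have hr : 0 < r := lt_min (by linarith) (by linarith)
  refine ⟨x.re - r, y.re + r, r, by linarith, by linarith, by linarith, hr, fun s hs ↦ ⟨?_, ?_⟩⟩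
  · linarith [show x.re ≤ s.re from hxmin hs]
  · linarith [show s.re ≤ y.re from hymax hs]

/-- The mean over the progression `s + ikh` of the smoothed error, uniformly for `s ∈ K`. -/
lemma eventually_sum_norm_smoothedError_le {a κ h : ℝ} (ha : 0 < a) (ha1 : a ≤ 1) (hκ : 0 < κ)
    (hh : 0 < h) {K : Set ℂ} (hK : IsCompact K) (hKsub : K ⊆ {s : ℂ | 1 / 2 < s.re ∧ s.re < 1})
    {ε : ℝ} (hε : 0 < ε) :
    ∀ᶠ X : ℝ in atTop, ∀ᶠ N : ℕ in atTop, ∃ S : ℕ → ℝ,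
      (∀ k, 0 ≤ S k) ∧ (∀ k : ℕ, ∀ s ∈ K, ‖smoothedError a κ X (s + k * h * I)‖ ≤ S k) ∧
        ∑ k ∈ Finset.range (N + 1), S k ≤ ε * (N + 1) := by
  obtain rfl | hne := K.eq_empty_or_nonempty
  · exact Eventually.of_forall fun X ↦ Eventually.of_forall fun N ↦
      ⟨0, by simp, by simp, by simpa using by positivity⟩
  obtain ⟨p, q, r, hp, hpq, hq, hr, hKr⟩ := hK.exists_subset_strip hne hKsub
  obtain ⟨A, hA⟩ := hK.isBounded.exists_norm_le
  obtain ⟨Q, hQ⟩ := exists_nat_ge ((A + r) / h)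
  rw [div_le_iff₀ hh] at hQ
  set c := (Q + 1) * h
  have hc : 0 < c := by positivity
  set D := (Real.pi * r ^ 2)⁻¹ * (2 * Q)
  have hD : 0 ≤ D := by positivity
  set η := ε / (4 * c * (D + 1))
  have hη : 0 < η := by positivity
  filter_upwards [eventually_integral_norm_sq_smoothedError_le ha ha1 hκ hp hq hc
    (show 0 < 2 * η * ε / (D + 1) by positivity), eventually_gt_atTop 0] with X hmean hX
  filter_upwards [(tendsto_add_atTop_nat 1).eventually hmean] with N hN
  have hdiff : DifferentiableOn ℂ (smoothedError a κ X) {s | s.re ∈ Set.Icc p q} :=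
    (differentiableOn_smoothedError ha ha1 hκ hX).mono fun s hs ↦
      ⟨by linarith [hs.1], by linarith [hs.2]⟩
  refine ⟨fun k ↦ (Real.pi * r ^ 2)⁻¹ * ∫ σ in p..q, ∫ t in ((k - Q) * h)..((k + Q) * h),
    ‖smoothedError a κ X (σ + t * I)‖, fun k ↦ ?_, fun k s hs ↦ ?_, ?_⟩
  · exact mul_nonneg (by positivity) (intervalIntegral.integral_nonneg hpq fun σ _ ↦
      intervalIntegral.integral_nonneg (by gcongr; linarith) fun t _ ↦ norm_nonneg _)
  · have him := abs_le.1 ((abs_im_le_norm s).trans (hA s hs))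
    beta_reduce
    rw [← div_eq_inv_mul, le_div_iff₀' (by positivity)]
    refine norm_le_integral_rectangle hr hdiff ?_ ?_ ?_ ?_
    · simpa using (hKr s hs).1
    · simpa using (hKr s hs).2
    · simp
      linarith
    · simp
      linarith
  · rw [← Finset.mul_sum, ← intervalIntegral.integral_finsetSum]
    · set V := 2 * Q * (2 * (c * (N + 1 : ℕ)) * η + 2 * η * ε / (D + 1) * (N + 1 : ℕ) / (4 * η))
      have hV : 0 ≤ V := by positivity
      calc _ ≤ (Real.pi * r ^ 2)⁻¹ * ∫ _ in p..q, V := by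
            gcongr
            refine intervalIntegral.integral_mono_on hpq ?_ (by simp) fun σ hσ ↦ ?_
            · have hi := IntervalIntegrable.sum (Finset.range (N + 1)) fun k _ ↦
                intervalIntegrable_integral_norm (A := (k - Q) * h) (B := (k + Q) * h) hpq
                  (by gcongr; linarith) hdiff.continuousOn
              rwa [Finset.sum_fn] at hi
            · have hcont := continuous_smoothedError_vertical (σ := σ) ha ha1 hκ hX
                (by linarith [hσ.1]) (by linarith [hσ.2])
              refine (sum_integral_shifted_le hcont.norm (fun _ ↦ norm_nonneg _) hh Q
                (Nat.le_add_left 1 N)).trans ?_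
              exact mul_le_mul_of_nonneg_left (integral_norm_le_of_integral_norm_sq_le hcont
                (by positivity) hη (hN σ hσ)) (by positivity)
        _ = (q - p) * ((Real.pi * r ^ 2)⁻¹ * V) := by
            rw [intervalIntegral.integral_const, smul_eq_mul]
            ring
        _ ≤ 1 * ((Real.pi * r ^ 2)⁻¹ * V) := by
            gcongr
            linarith
        _ = D / (D + 1) * (ε * (N + 1)) := by
            simp only [V, D, η]
            push_cast
            field_simp
            ring
        _ ≤ _ := mul_le_of_le_one_left (by positivity)
            ((div_le_one (by positivity)).2 (by linarith))
    · intro k _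
      exact intervalIntegrable_integral_norm hpq (by gcongr; linarith) hdiff.continuousOn

lemma Function.Periodic.norm_le_sum_range {b : ℕ → ℂ} {l : ℕ} (hl : 0 < l)
    (hb : Function.Periodic b l) (m : ℕ) : ‖b m‖ ≤ ∑ r ∈ Finset.range l, ‖b r‖ := by
  rw [← hb.map_mod_nat m]
  exact Finset.single_le_sum (f := fun r ↦ ‖b r‖) (fun _ _ ↦ norm_nonneg _)
    (Finset.mem_range.2 (m.mod_lt hl))

lemma tsum_eq_sum_range_tsum_residue {f : ℕ → ℂ} (hf : Summable f) {l : ℕ} (hl : 0 < l) :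
    ∑' m, f m = ∑ r ∈ Finset.range l, ∑' j, f (r + l * j) := by
  obtain ⟨k, rfl⟩ := Nat.exists_eq_add_of_lt hl
  rw [zero_add, Nat.sumByResidueClasses hf (k + 1), Finset.sum_range]
  rfl

lemma summable_periodicHurwitzZetaApprox {α κ : ℝ} (hα0 : 0 < α) (hα1 : α ≤ 1) (hκ : 0 < κ)
    {b : ℕ → ℂ} {l : ℕ} (hl : 0 < l) (hb : Function.Periodic b l) (n : ℕ) {s : ℂ} (hs0 : 0 ≤ s.re)
    (hs1 : s.re ≤ 1) :
    Summable fun m : ℕ ↦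
      b m * Real.exp (-(((m + α) / (n + α)) ^ κ)) * ((m + α : ℝ) : ℂ) ^ (-s) := by
  refine Summable.of_norm_bounded (((summable_smoothWeight hα0 hκ
    (show 0 < (n : ℝ) + α by positivity)).mul_left α⁻¹).mul_left (∑ r ∈ Finset.range l, ‖b r‖))
    fun m ↦ ?_
  rw [mul_assoc, norm_mul]
  exact mul_le_mul (hb.norm_le_sum_range hl m)
    (norm_smoothWeight_mul_cpow_le hα0 hα1 hs0 hs1 m) (norm_nonneg _)
    (Finset.sum_nonneg fun _ _ ↦ norm_nonneg _)

lemma periodicHurwitzZeta_sub_approx {α κ : ℝ} (hα0 : 0 < α) (hα1 : α ≤ 1) (hκ : 0 < κ)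
    {b : ℕ → ℂ} {l : ℕ} (hl : 0 < l) (hb : Function.Periodic b l) (n : ℕ) {s : ℂ} (hs0 : 0 ≤ s.re)
    (hs1 : s.re ≤ 1) :
    periodicHurwitzZeta b l α s - periodicHurwitzZetaApprox b α κ n s =
      (l : ℂ) ^ (-s) *
        ∑ r ∈ Finset.range l, b r * smoothedError ((r + α) / l) κ ((n + α) / l) s := by
  have hl0 : (0 : ℝ) < l := by exact_mod_cast hl
  have hterm : ∀ r j : ℕ, b (r + l * j) *
      Real.exp (-((((r + l * j : ℕ) + α) / (n + α)) ^ κ)) * (((r + l * j : ℕ) + α : ℝ) : ℂ) ^ (-s) =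
      (l : ℂ) ^ (-s) * (b r * ((smoothWeight ((r + α) / l) κ ((n + α) / l) j : ℂ) *
        ((j + (r + α) / l : ℝ) : ℂ) ^ (-s))) := fun r j ↦ by
    have hn : (0 : ℝ) < n + α := by positivity
    have e1 : (((r + l * j : ℕ) : ℝ) + α) = l * (j + (r + α) / l) := by
      push_cast
      field_simp
      ring
    have e2 : (((r + l * j : ℕ) : ℝ) + α) / (n + α) = (j + (r + α) / l) / ((n + α) / l) := by
      rw [e1]
      field_simp
    have e3 : b (r + l * j) = b r := by
      rw [mul_comm l]
      exact hb.nat_mul j r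
    rw [e2, e3, e1, smoothWeight, ofReal_mul, mul_cpow_ofReal_nonneg hl0.le (by positivity),
      ofReal_natCast]
    ring
  rw [periodicHurwitzZeta, periodicHurwitzZetaApprox, tsum_eq_sum_range_tsum_residue
    (summable_periodicHurwitzZetaApprox hα0 hα1 hκ hl hb n hs0 hs1) hl]
  simp_rw [hterm, tsum_mul_left]
  rw [← Finset.mul_sum, ← mul_sub, ← Finset.sum_sub_distrib]
  simp_rw [← mul_sub]
  rfl

lemma norm_periodicHurwitzZeta_sub_approx_le {α κ : ℝ} (hα0 : 0 < α) (hα1 : α ≤ 1) (hκ : 0 < κ)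
    {b : ℕ → ℂ} {l : ℕ} (hl : 0 < l) (hb : Function.Periodic b l) (n : ℕ) {s : ℂ} (hs0 : 0 ≤ s.re)
    (hs1 : s.re ≤ 1) :
    ‖periodicHurwitzZeta b l α s - periodicHurwitzZetaApprox b α κ n s‖ ≤
      ∑ r ∈ Finset.range l, ‖b r‖ * ‖smoothedError ((r + α) / l) κ ((n + α) / l) s‖ := by
  have hl1 : (1 : ℝ) ≤ l := by exact_mod_cast hl
  rw [periodicHurwitzZeta_sub_approx hα0 hα1 hκ hl hb n hs0 hs1, norm_mul,
    norm_natCast_cpow_of_pos hl, neg_re]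
  refine (mul_le_of_le_one_left (norm_nonneg _)
    (Real.rpow_le_one_of_one_le_of_nonpos hl1 (by linarith))).trans ((norm_sum_le _ _).trans ?_)
  exact (Finset.sum_congr rfl fun r _ ↦ norm_mul _ _).le

/-- Approximation in the mean of the periodic Hurwitz zeta-function by its
mollified partial series along the arithmetic progression with common difference `h₂`:
for every compact subset `K` of the strip `1/2 < Re s < 1`,
`lim_{n→∞} limsup_{N→∞} (1/(N+1)) ∑_{k=0}^N sup_{s∈K} |ζ(s+ikh₂,α;𝔅) − ζ_n(s+ikh₂,α;𝔅)| = 0`. -/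
theorem approximation_in_mean_periodicHurwitzZeta
    (α h₁ h₂ : ℝ) (hα0 : 0 < α) (hα1 : α < 1) (hh₁ : 0 < h₁) (hh₂ : 0 < h₂)
    (hind : LinearIndependent ℚ ((↑) : (Lset α h₁ h₂) → ℝ))
    (b : ℕ → ℂ) (l : ℕ) (hb : IsMinimalPeriod b l)
    (σ₀star : ℝ) (hσ₀star : 1 / 2 < σ₀star)
    (K : Set ℂ) (hK : IsCompact K) (hKsub : K ⊆ {s : ℂ | 1 / 2 < s.re ∧ s.re < 1}) :
    Tendsto (fun n : ℕ =>
      Filter.limsup (fun N : ℕ => (N + 1 : ℝ)⁻¹ *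
        ∑ k ∈ Finset.range (N + 1),
          ⨆ s ∈ K, ‖
            (periodicHurwitzZeta b l α (s + k * h₂ * Complex.I) -
              periodicHurwitzZetaApprox b α σ₀star n (s + k * h₂ * Complex.I))‖)
        Filter.atTop)
      Filter.atTop (𝓝 0) := by
  obtain ⟨hl, hper, -⟩ := hb
  have hκ : 0 < σ₀star := by linarith
  have hl0 : (0 : ℝ) < l := by exact_mod_cast hl
  have hXlim : Tendsto (fun n : ℕ ↦ ((n : ℝ) + α) / l) atTop atTop :=
    (tendsto_natCast_atTop_atTop.atTop_add tendsto_const_nhds).atTop_div_const hl0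
  set u : ℕ → ℕ → ℝ := fun n N ↦ (N + 1 : ℝ)⁻¹ * ∑ k ∈ Finset.range (N + 1),
    ⨆ s ∈ K, ‖(periodicHurwitzZeta b l α (s + k * h₂ * I) -
      periodicHurwitzZetaApprox b α σ₀star n (s + k * h₂ * I))‖
  have hu0 : ∀ n N, 0 ≤ u n N := fun n N ↦ mul_nonneg (by positivity) <|
    Finset.sum_nonneg fun k _ ↦ Real.iSup_nonneg fun s ↦ Real.iSup_nonneg fun _ ↦ norm_nonneg _
  have hu : ∀ ε > 0, ∀ᶠ n in atTop, ∀ᶠ N in atTop, u n N ≤ ε := fun ε hε ↦ by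
    set B := ∑ r ∈ Finset.range l, ‖b r‖
    have hB : 0 ≤ B := Finset.sum_nonneg fun _ _ ↦ norm_nonneg _
    have hr : ∀ r ∈ Finset.range l, ∀ᶠ n : ℕ in atTop, ∀ᶠ N : ℕ in atTop, ∃ S : ℕ → ℝ,
        (∀ k, 0 ≤ S k) ∧ (∀ k : ℕ, ∀ s ∈ K,
          ‖smoothedError ((r + α) / l) σ₀star ((n + α) / l) (s + k * h₂ * I)‖ ≤ S k) ∧
          ∑ k ∈ Finset.range (N + 1), S k ≤ ε / (B + 1) * (N + 1) := fun r hr ↦ by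
      have hrl : (r : ℝ) + 1 ≤ l := by exact_mod_cast Finset.mem_range.1 hr
      exact hXlim.eventually (eventually_sum_norm_smoothedError_le (by positivity)
        ((div_le_one hl0).2 (by linarith)) hκ hh₂ hK hKsub (by positivity))
    filter_upwards [(Filter.eventually_all_finset _).2 hr] with n hn
    filter_upwards [(Filter.eventually_all_finset _).2 hn] with N hN
    choose! S hS0 hSK hSsum using hN
    rw [inv_mul_le_iff₀ (by positivity)]
    calc _ ≤ ∑ k ∈ Finset.range (N + 1), ∑ r ∈ Finset.range l, ‖b r‖ * S r k := by
          refine Finset.sum_le_sum fun k _ ↦ ?_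
          have h0 : 0 ≤ ∑ r ∈ Finset.range l, ‖b r‖ * S r k :=
            Finset.sum_nonneg fun r hr ↦ mul_nonneg (norm_nonneg _) (hS0 r hr k)
          refine Real.iSup_le (fun s ↦ Real.iSup_le (fun hs ↦ ?_) h0) h0
          have hre : (s + k * h₂ * I).re = s.re := by simp
          have hs' := hKsub hs
          refine (norm_periodicHurwitzZeta_sub_approx_le hα0 hα1.le hκ hl hper n
            (by rw [hre]; linarith [hs'.1]) (by rw [hre]; exact hs'.2.le)).trans ?_
          gcongr with r hr
          exact hSK r hr k s hs
      _ = ∑ r ∈ Finset.range l, ‖b r‖ * ∑ k ∈ Finset.range (N + 1), S r k := by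
          rw [Finset.sum_comm]
          simp_rw [Finset.mul_sum]
      _ ≤ ∑ r ∈ Finset.range l, ‖b r‖ * (ε / (B + 1) * (N + 1)) := by
          gcongr with r hr
          exact hSsum r hr
      _ = B / (B + 1) * ((N + 1) * ε) := by
          rw [← Finset.sum_mul]
          ring
      _ ≤ _ := mul_le_of_le_one_left (by positivity)
          ((div_le_one (by positivity)).2 (by linarith))
  rw [Metric.tendsto_nhds]
  intro ε hε
  filter_upwards [hu (ε / 2) (by positivity)] with n hn
  have hle : limsup (u n) atTop ≤ ε / 2 :=
    limsup_le_of_le (isCoboundedUnder_le_of_le atTop (hu0 n)) hn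
  have hge : 0 ≤ limsup (u n) atTop :=
    le_limsup_of_frequently_le (Eventually.of_forall (hu0 n)).frequently ⟨ε / 2, hn⟩
  rw [Real.dist_0_eq_abs, abs_of_nonneg hge]
  linarith
end

section
/- Let φ belong to the class M of Matsumoto zeta-functions, with abscissa σ₀ ∈ [1/2,1), Dirichlet coefficients (c_k)_{k≥1} (so φ(s) = Σ_{k=1}^∞ c_k k^{−s} for Re s > 1), and poles s₁(φ),…,s_l(φ) in the region Re s ≥ σ₀. Let 0 < α < 1 and h₁, h₂ > 0, and suppose that the elements of the set L(α,h₁,h₂) := {h₁ log p : p prime} ∪ {h₂ log(m+α) : m ∈ ℕ₀} ∪ {π} are linearly independent over ℚ. Fix σ₀* > 1/2, for n ∈ ℕ put v₁(m,n) := exp(−(m/n)^{σ₀*}) for m ∈ ℕ, and define φ_n(s) := Σ_{m=1}^∞ c_m v₁(m,n) m^{−s}, a series converging absolutely for Re s > 1/2. Then for every compact subset K of D_φ := {s ∈ ℂ : Re s > σ₀ and Re s ≠ Re s_j(φ) for j = 1,…,l}, lim_{n→∞} limsup_{N→∞} (1/(N+1)) Σ_{k=0}^{N} sup_{s∈K}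 |φ(s+ikh₁) − φ_n(s+ikh₁)| = 0. -/
open Complex Filter Topology MeasureTheory

/-- The class `M` of Matsumoto zeta-functions: `φ` arises as the shift
`φ(s) = φ̃(s+α+β)` of a polynomial Euler product `φ̃` over the primes (with degree and
coefficient bounds), has Dirichlet coefficients `c`, continues meromorphically to
`Re s ≥ σ₀` with poles `spole 1, …, spole l` lying in a compact set not meeting the line
`Re s = σ₀`, is of polynomial growth in `|Im s|` there, and satisfies the mean square bound
`∫_0^T |φ(σ₀+it)|² dt = O(T)`. -/
structure MatsumotoClass (φ : ℂ → ℂ) (σ₀ : ℝ) (c : ℕ → ℂ) (l : ℕ) (spole : Fin l → ℂ) :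
    Prop where
  sigma_mem : 1 / 2 ≤ σ₀ ∧ σ₀ < 1
  dirichlet : ∀ s : ℂ, 1 < s.re → HasSum (fun k : ℕ => c (k + 1) / ((k : ℂ) + 1) ^ s) (φ s)
  euler : ∃ (C₁ A B : ℝ) (g : ℕ → ℕ) (f : ℕ → ℕ → ℕ) (coef : ℕ → ℕ → ℂ),
    0 < C₁ ∧ 0 ≤ A ∧ 0 ≤ B ∧
    (∀ m, 0 < g m) ∧ (∀ m j, j < g m → 0 < f j m) ∧
    (∀ m, (g m : ℝ) ≤ C₁ * (Nat.nth Nat.Prime m : ℝ) ^ A) ∧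
    (∀ m j, j < g m → ‖coef m j‖ ≤ (Nat.nth Nat.Prime m : ℝ) ^ B) ∧
    (∀ s : ℂ, 1 < s.re → φ s = ∏' m : ℕ,
      (∏ j ∈ Finset.range (g m),
        (1 - coef m j *
          ((Nat.nth Nat.Prime m : ℕ) : ℂ) ^ (-(f j m : ℂ) * (s + (A : ℂ) + (B : ℂ)))))⁻¹)
  poles_re : ∀ j, σ₀ ≤ (spole j).re
  poles_compact : ∃ Kc : Set ℂ, IsCompact Kc ∧ (∀ j, spole j ∈ Kc) ∧ ∀ s ∈ Kc, s.re ≠ σ₀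
  continuation : DifferentiableOn ℂ φ {s : ℂ | σ₀ ≤ s.re ∧ ∀ j, s ≠ spole j}
  poles_are_poles : ∀ j, ∃ (q : ℕ) (L : ℂ),
    Tendsto (fun s : ℂ => (s - spole j) ^ q * φ s) (𝓝[≠] (spole j)) (𝓝 L)
  growth : ∃ C₂ : ℝ, 0 < C₂ ∧ ∃ C : ℝ, 0 < C ∧ ∃ T₀ : ℝ, 1 ≤ T₀ ∧
    ∀ s : ℂ, σ₀ ≤ s.re → T₀ ≤ |s.im| → ‖φ s‖ ≤ C * |s.im| ^ C₂
  meansq : ∃ C : ℝ, 0 < C ∧ ∀ T : ℝ, 1 ≤ T →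
    (∫ t in (0:ℝ)..T, ‖φ (σ₀ + t * Complex.I)‖ ^ 2) ≤ C * T

/-- The mollified partial Dirichlet series
`φ_n(s) = ∑_{m≥1} c m v₁(m,n) m^{-s}` with `v₁(m,n) = exp(-(m/n)^{σ₀*})`. -/
noncomputable def matsumotoZetaApprox (c : ℕ → ℂ) (σ₀star : ℝ) (n : ℕ) (s : ℂ) : ℂ :=
  ∑' m : ℕ, c (m + 1) * Real.exp (-((((m : ℝ) + 1) / n) ^ σ₀star)) * ((m : ℂ) + 1) ^ (-s)

/-- On a vertical strip in the right half-plane the Gamma function decays faster than any power. -/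
lemma norm_Gamma_le_inv_one_add_abs_im_pow (P : ℕ) {x₀ x₁ : ℝ} (hx₀ : 0 < x₀) :
    ∃ C : ℝ, 0 < C ∧ ∀ z : ℂ, x₀ ≤ z.re → z.re ≤ x₁ →
      ‖Complex.Gamma z‖ ≤ C * ((1 + |z.im|) ^ P)⁻¹ := by
  induction P generalizing x₀ x₁ with
  | zero =>
    obtain ⟨C, hC⟩ := (isCompact_Icc (a := x₀) (b := x₁)).exists_bound_of_continuousOn
      (f := Real.Gamma) fun x hx =>
        (Real.differentiableAt_Gamma fun m => by
          have : (0 : ℝ) ≤ m := m.cast_nonneg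
          linarith [hx.1]).continuousAt.continuousWithinAt
    refine ⟨max C 1, by positivity, fun z h0 h1 => ?_⟩
    have hz : 0 < z.re := by linarith
    have h2 := hC z.re ⟨h0, h1⟩
    simp only [pow_zero, inv_one, mul_one]
    refine le_trans ?_ (h2.trans (le_max_left _ _))
    rw [Complex.Gamma_eq_integral hz, Real.Gamma_eq_integral hz, Complex.GammaIntegral]
    refine (norm_integral_le_integral_norm _).trans ((le_of_eq ?_).trans (Real.le_norm_self _))
    refine setIntegral_congr_fun measurableSet_Ioi fun t ht => ?_
    rw [norm_mul, Complex.norm_cpow_eq_rpow_re_of_pos ht, Complex.norm_real,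
      Real.norm_of_nonneg (Real.exp_pos _).le]
    simp
  | succ P ih =>
    obtain ⟨C, hC0, hC⟩ := ih (x₀ := x₀ + 1) (x₁ := x₁ + 1) (by linarith)
    refine ⟨C * (1 / x₀ + 1), by positivity, fun z h0 h1 => ?_⟩
    have hz : z ≠ 0 := fun h => by simp [h] at h0; linarith
    have h2 := hC (z + 1) (by simpa using h0) (by simpa using h1)
    rw [Complex.Gamma_add_one z hz, norm_mul] at h2
    have h3 : 1 + |z.im| ≤ (1 / x₀ + 1) * ‖z‖ := by
      have h4 : x₀ ≤ ‖z‖ := h0.trans (Complex.re_le_norm z)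
      have h5 := Complex.abs_im_le_norm z
      have h6 : 1 ≤ 1 / x₀ * ‖z‖ := by rw [one_div, inv_mul_eq_div, le_div_iff₀ hx₀]; linarith
      linarith
    have h7 : 0 < 1 + |z.im| := by positivity
    simp only [Complex.add_im, Complex.one_im, add_zero] at h2
    rw [pow_succ, mul_inv, ← div_eq_mul_inv _ (1 + |z.im|), mul_div_assoc', le_div_iff₀ h7]
    calc ‖Complex.Gamma z‖ * (1 + |z.im|)
        ≤ ‖Complex.Gamma z‖ * ((1 / x₀ + 1) * ‖z‖) := by gcongr
      _ = (1 / x₀ + 1) * (‖z‖ * ‖Complex.Gamma z‖) := by ring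
      _ ≤ (1 / x₀ + 1) * (C * ((1 + |z.im|) ^ P)⁻¹) := by gcongr
      _ = _ := by ring

lemma integrable_inv_one_add_abs_sq : Integrable fun u : ℝ => ((1 + |u|) ^ 2)⁻¹ := by
  have h := integrable_one_add_norm (E := ℝ) (μ := volume) (r := 2) (by norm_num)
  refine h.congr (ae_of_all _ fun x => ?_)
  simp only [Real.norm_eq_abs]
  rw [Real.rpow_neg (by positivity)]
  norm_cast

lemma continuous_inv_one_add_abs_pow (P : ℕ) : Continuous fun u : ℝ => ((1 + |u|) ^ P)⁻¹ :=
  Continuous.inv₀ (by fun_prop) fun x => by positivity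

lemma inv_one_add_abs_pow_anti {P Q : ℕ} (h : Q ≤ P) (u : ℝ) :
    ((1 + |u|) ^ P)⁻¹ ≤ ((1 + |u|) ^ Q)⁻¹ := by
  have : 1 ≤ 1 + |u| := by simp
  gcongr

lemma inv_one_add_abs_pow_le_mul (P : ℕ) (u v : ℝ) :
    ((1 + |u|) ^ P)⁻¹ ≤ (1 + |v|) ^ P * ((1 + |u + v|) ^ P)⁻¹ := by
  rw [← div_eq_mul_inv, ← div_pow, ← inv_pow]
  gcongr
  rw [le_div_iff₀ (by positivity), inv_mul_le_iff₀ (by positivity)]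
  nlinarith [abs_add_le u v, abs_nonneg u, abs_nonneg v]

/-- Mellin inversion for `x ↦ exp (-x ^ a)`. -/
lemma exp_neg_rpow_eq_integral {a σ x : ℝ} (ha : 0 < a) (hσ : 0 < σ) (hx : 0 < x) :
    (Real.exp (-(x ^ a)) : ℂ) = (1 / (2 * Real.pi) : ℝ) * ∫ y : ℝ,
      (x : ℂ) ^ (-(σ + y * I)) * (Complex.Gamma ((σ + y * I) / a + 1) / (σ + y * I)) := by
  have hG : ∀ z : ℂ, 0 < z.re → mellin (fun t : ℝ => (Real.exp (-(t ^ a)) : ℂ)) z =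
      Complex.Gamma (z / a + 1) / z := by
    intro z hz
    have hz0 : z ≠ 0 := fun h => by simp [h] at hz
    have ha' : (a : ℂ) ≠ 0 := by exact_mod_cast ha.ne'
    have hre : 0 < (z / a).re := by rw [Complex.div_ofReal_re]; positivity
    rw [mellin_comp_rpow (fun t : ℝ => (Real.exp (-t) : ℂ)) z a,
      ← Complex.GammaIntegral_eq_mellin, ← Complex.Gamma_eq_integral hre,
      Complex.Gamma_add_one _ (div_ne_zero hz0 ha'), abs_of_pos ha, Complex.real_smul]
    push_cast
    field_simp
  have hre : ∀ y : ℝ, ((σ : ℂ) + y * I).re = σ := fun y => by simp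
  have hconv : MellinConvergent (fun t : ℝ => (Real.exp (-(t ^ a)) : ℂ)) σ := by
    rw [MellinConvergent.comp_rpow (f := fun t : ℝ => (Real.exp (-t) : ℂ)) ha.ne']
    have := Complex.GammaIntegral_convergent (s := (σ : ℂ) / a)
      (by rw [Complex.div_ofReal_re]; simp; positivity)
    rw [MellinConvergent]
    refine this.congr_fun (fun t _ => ?_) measurableSet_Ioi
    simp [mul_comm]
  have hvert : VerticalIntegrable (mellin fun t : ℝ => (Real.exp (-(t ^ a)) : ℂ)) σ := by
    obtain ⟨C, hC0, hC⟩ := norm_Gamma_le_inv_one_add_abs_im_pow 2 (x₀ := σ / a + 1)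
      (x₁ := σ / a + 1) (by positivity)
    have hne : ∀ y : ℝ, (σ : ℂ) + y * I ≠ 0 := fun y h => by
      have := hre y; rw [h] at this; simp at this; linarith
    have hbound : Integrable fun y : ℝ => C * (1 + a) ^ 2 / σ * ((1 + |y|) ^ 2)⁻¹ :=
      integrable_inv_one_add_abs_sq.const_mul _
    have hcong : (fun y : ℝ => Complex.Gamma ((σ + y * I) / a + 1) / (σ + y * I)) =
        fun y : ℝ => mellin (fun t : ℝ => (Real.exp (-(t ^ a)) : ℂ)) (σ + y * I) := by
      funext y; exact (hG _ (by rw [hre]; exact hσ)).symm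
    rw [VerticalIntegrable, ← hcong]
    refine hbound.mono' (Continuous.aestronglyMeasurable ?_) (ae_of_all _ fun y => ?_)
    · refine Continuous.div (continuous_iff_continuousAt.2 fun y => ?_) (by fun_prop) hne
      refine ContinuousAt.comp (g := Complex.Gamma)
        (f := fun y : ℝ => ((σ : ℂ) + y * I) / a + 1) ?_ (by fun_prop)
      refine (Complex.differentiableAt_Gamma _ fun m h => ?_).continuousAt
      have h1 := congrArg Complex.re h
      rw [Complex.add_re, Complex.div_ofReal_re, hre] at h1
      simp at h1
      have : 0 < σ / a := by positivity
      have : (0 : ℝ) ≤ m := m.cast_nonneg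
      linarith
    · have h1 := hC ((σ + y * I) / a + 1) (by simp [Complex.div_ofReal_re])
        (by simp [Complex.div_ofReal_re])
      have him : (((σ : ℂ) + y * I) / a + 1).im = y / a := by
        rw [Complex.add_im, Complex.div_ofReal_im]; simp
      rw [him] at h1
      have h2 : σ ≤ ‖(σ : ℂ) + y * I‖ := by
        have := Complex.re_le_norm ((σ : ℂ) + y * I); rwa [hre] at this
      have h3 : ((1 + |y / a|) ^ 2)⁻¹ ≤ (1 + a) ^ 2 * ((1 + |y|) ^ 2)⁻¹ := by
        rw [← div_eq_mul_inv, ← div_pow, ← inv_pow]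
        gcongr
        rw [le_div_iff₀ (by positivity), inv_mul_le_iff₀ (by positivity), abs_div, abs_of_pos ha]
        have : (1 + |y| / a) * (1 + a) = 1 + |y| + a + |y| / a := by field_simp; ring
        rw [this]
        have : 0 ≤ |y| / a := by positivity
        linarith
      rw [norm_div]
      calc _ ≤ C * ((1 + a) ^ 2 * ((1 + |y|) ^ 2)⁻¹) / σ := by
            gcongr
            exact h1.trans (by gcongr)
        _ = _ := by ring
  have hinv := mellinInv_mellin_eq σ (fun t : ℝ => (Real.exp (-(t ^ a)) : ℂ)) hx hconv hvert
    (by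
      refine Complex.continuous_ofReal.continuousAt.comp ?_
      refine Real.continuous_exp.continuousAt.comp ?_
      exact (Real.continuousAt_rpow_const _ _ (Or.inl hx.ne')).neg)
  rw [← hinv, mellinInv, Complex.real_smul]
  congr 1
  · refine integral_congr_ae (ae_of_all _ fun y => ?_)
    simp only [smul_eq_mul]
    rw [hG _ (by rw [hre]; exact hσ)]

lemma log_sub_log_neg_of_im_pos {z : ℂ} (h : 0 < z.im) :
    Complex.log z - Complex.log (-z) = Real.pi * I := by
  rw [Complex.log, Complex.log, Complex.arg_neg_eq_arg_sub_pi_of_im_pos h, norm_neg]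
  push_cast
  ring

/-- The horizontal integral of `1 / (w - s)` off the line through `s`. -/
lemma integral_inv_horizontal {s : ℂ} {y : ℝ} (hy : y ≠ s.im) (x₀ x₁ : ℝ) :
    ∫ x in x₀..x₁, 1 / ((x : ℂ) + y * I - s) =
      Complex.log (x₁ + y * I - s) - Complex.log (x₀ + y * I - s) := by
  have hs : ∀ x : ℝ, (x : ℂ) + y * I - s ∈ Complex.slitPlane := fun x =>
    Or.inr (by simpa using sub_ne_zero.2 hy)
  refine intervalIntegral.integral_eq_sub_of_hasDerivAt
    (f := fun x : ℝ => Complex.log (x + y * I - s)) (fun x _ => ?_)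
    (Continuous.intervalIntegrable (Continuous.div (by fun_prop) (by fun_prop)
      fun x => Complex.slitPlane_ne_zero (hs x)) _ _)
  refine HasDerivAt.clog_real ?_ (hs x)
  exact ((Complex.ofRealCLM.hasDerivAt (x := x)).add_const _).sub_const _

/-- The vertical integral of `1 / (w - s)` to the right of `s`. -/
lemma integral_inv_vertical_right {s : ℂ} {x : ℝ} (hx : s.re < x) (y₀ y₁ : ℝ) :
    I * ∫ y in y₀..y₁, 1 / ((x : ℂ) + y * I - s) =
      Complex.log (x + y₁ * I - s) - Complex.log (x + y₀ * I - s) := by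
  have hs : ∀ y : ℝ, (x : ℂ) + y * I - s ∈ Complex.slitPlane := fun y =>
    Or.inl (by simpa using hx)
  rw [← intervalIntegral.integral_const_mul]
  refine intervalIntegral.integral_eq_sub_of_hasDerivAt
    (f := fun y : ℝ => Complex.log (x + y * I - s)) (fun y _ => ?_)
    (Continuous.intervalIntegrable (continuous_const.mul (Continuous.div (by fun_prop) (by fun_prop)
      fun y => Complex.slitPlane_ne_zero (hs y))) _ _)
  rw [mul_one_div]
  refine HasDerivAt.clog_real ?_ (hs y)
  simpa using (((Complex.ofRealCLM.hasDerivAt (x := y)).mul_const I).const_add (x : ℂ)).sub_const s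

/-- The vertical integral of `1 / (w - s)` to the left of `s`. -/
lemma integral_inv_vertical_left {s : ℂ} {x : ℝ} (hx : x < s.re) (y₀ y₁ : ℝ) :
    I * ∫ y in y₀..y₁, 1 / ((x : ℂ) + y * I - s) =
      Complex.log (-(x + y₁ * I - s)) - Complex.log (-(x + y₀ * I - s)) := by
  have hs : ∀ y : ℝ, -((x : ℂ) + y * I - s) ∈ Complex.slitPlane := fun y =>
    Or.inl (by simpa using hx)
  rw [← intervalIntegral.integral_const_mul]
  refine intervalIntegral.integral_eq_sub_of_hasDerivAt
    (f := fun y : ℝ => Complex.log (-(x + y * I - s))) (fun y _ => ?_)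
    (Continuous.intervalIntegrable (continuous_const.mul (Continuous.div (by fun_prop) (by fun_prop)
      fun y => neg_ne_zero.1 (Complex.slitPlane_ne_zero (hs y)))) _ _)
  rw [mul_one_div, ← neg_div_neg_eq]
  refine HasDerivAt.clog_real ?_ (hs y)
  refine HasDerivAt.congr_deriv
    ((((Complex.ofRealCLM.hasDerivAt (x := y)).mul_const I).const_add (x : ℂ)).sub_const s).neg ?_
  simp

/-- Cauchy's integral formula for a rectangle. -/
lemma rect_cauchy_formula {F : ℂ → ℂ} {s : ℂ} {x₀ x₁ y₀ y₁ : ℝ}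
    (hx₀ : x₀ < s.re) (hx₁ : s.re < x₁) (hy₀ : y₀ < s.im) (hy₁ : s.im < y₁)
    (hc : ContinuousOn F (Set.Icc x₀ x₁ ×ℂ Set.Icc y₀ y₁))
    (hd : DifferentiableOn ℂ F (Set.Ioo x₀ x₁ ×ℂ Set.Ioo y₀ y₁)) :
    (∫ x in x₀..x₁, F (x + y₀ * I) / (x + y₀ * I - s)) -
      (∫ x in x₀..x₁, F (x + y₁ * I) / (x + y₁ * I - s)) +
      I * (∫ y in y₀..y₁, F (x₁ + y * I) / (x₁ + y * I - s)) -
      I * (∫ y in y₀..y₁, F (x₀ + y * I) / (x₀ + y * I - s)) = 2 * Real.pi * I * F s := by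
  have hx : x₀ ≤ x₁ := by linarith
  have hy : y₀ ≤ y₁ := by linarith
  have hopen : IsOpen (Set.Ioo x₀ x₁ ×ℂ Set.Ioo y₀ y₁) := isOpen_Ioo.reProdIm isOpen_Ioo
  have hsmem : s ∈ Set.Ioo x₀ x₁ ×ℂ Set.Ioo y₀ y₁ := ⟨⟨hx₀, hx₁⟩, ⟨hy₀, hy₁⟩⟩
  have hds : DifferentiableAt ℂ F s := hd.differentiableAt (hopen.mem_nhds hsmem)
  have hsub : Set.Ioo x₀ x₁ ×ℂ Set.Ioo y₀ y₁ ⊆ Set.Icc x₀ x₁ ×ℂ Set.Icc y₀ y₁ :=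
    Set.inter_subset_inter (Set.preimage_mono Set.Ioo_subset_Icc_self)
      (Set.preimage_mono Set.Ioo_subset_Icc_self)
  have hnhds : Set.Icc x₀ x₁ ×ℂ Set.Icc y₀ y₁ ∈ 𝓝 s :=
    mem_of_superset (hopen.mem_nhds hsmem) hsub
  have key := integral_boundary_rect_eq_zero_of_differentiable_on_off_countable
    (dslope F s) (x₀ + y₀ * I) (x₁ + y₁ * I) {s} (Set.countable_singleton s)
    (by
      simpa [Set.uIcc_of_le hx, Set.uIcc_of_le hy] using (continuousOn_dslope hnhds).2 ⟨hc, hds⟩)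
    (by
      rintro w ⟨hw, hws⟩
      rw [differentiableAt_dslope_of_ne (by simpa using hws)]
      refine hd.differentiableAt (hopen.mem_nhds ?_)
      simpa [hx, hy] using hw)
  simp only [add_re, add_im, ofReal_re, ofReal_im, mul_re, mul_im, I_re, I_im, mul_zero, mul_one,
    sub_zero, add_zero, zero_add, smul_eq_mul] at key
  have hH : ∀ y ∈ Set.Icc y₀ y₁, y ≠ s.im →
      ∫ x in x₀..x₁, dslope F s (x + y * I) = (∫ x in x₀..x₁, F (x + y * I) / (x + y * I - s)) -
        F s * ∫ x in x₀..x₁, 1 / ((x : ℂ) + y * I - s) := by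
    intro y hyI hyne
    have hne : ∀ x : ℝ, (x : ℂ) + y * I - s ≠ 0 := fun x h => by
      have := congrArg Complex.im h
      simp at this
      exact hyne (sub_eq_zero.1 this)
    rw [← intervalIntegral.integral_const_mul, ← intervalIntegral.integral_sub]
    · refine intervalIntegral.integral_congr fun x _ => ?_
      rw [dslope_of_ne _ (sub_ne_zero.1 (hne x)), slope_def_field]
      ring
    · refine ContinuousOn.intervalIntegrable ?_
      refine ContinuousOn.div (hc.comp (by fun_prop) fun x hx' => ?_) (by fun_prop)
        fun x _ => hne x
      rw [Set.uIcc_of_le hx] at hx'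
      exact ⟨by simpa using hx', by simpa using hyI⟩
    · exact Continuous.intervalIntegrable
        (continuous_const.mul (Continuous.div (by fun_prop) (by fun_prop) hne)) _ _
  have hV : ∀ x ∈ Set.Icc x₀ x₁, x ≠ s.re →
      ∫ y in y₀..y₁, dslope F s (x + y * I) = (∫ y in y₀..y₁, F (x + y * I) / (x + y * I - s)) -
        F s * ∫ y in y₀..y₁, 1 / ((x : ℂ) + y * I - s) := by
    intro x hxI hxne
    have hne : ∀ y : ℝ, (x : ℂ) + y * I - s ≠ 0 := fun y h => by
      have := congrArg Complex.re h
      simp at this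
      exact hxne (sub_eq_zero.1 this)
    rw [← intervalIntegral.integral_const_mul, ← intervalIntegral.integral_sub]
    · refine intervalIntegral.integral_congr fun y _ => ?_
      rw [dslope_of_ne _ (sub_ne_zero.1 (hne y)), slope_def_field]
      ring
    · refine ContinuousOn.intervalIntegrable ?_
      refine ContinuousOn.div (hc.comp (by fun_prop) fun y hy' => ?_) (by fun_prop)
        fun y _ => hne y
      rw [Set.uIcc_of_le hy] at hy'
      exact ⟨by simpa using hxI, by simpa using hy'⟩
    · exact Continuous.intervalIntegrable
        (continuous_const.mul (Continuous.div (by fun_prop) (by fun_prop) hne)) _ _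
  rw [hH y₀ (by simp [hy]) hy₀.ne, hH y₁ (by simp [hy]) hy₁.ne', hV x₁ (by simp [hx]) hx₁.ne',
    hV x₀ (by simp [hx]) hx₀.ne] at key
  have e1 := integral_inv_horizontal (s := s) hy₀.ne x₀ x₁
  have e2 := integral_inv_horizontal (s := s) hy₁.ne' x₀ x₁
  have e3 := integral_inv_vertical_right (s := s) hx₁ y₀ y₁
  have e4 := integral_inv_vertical_left (s := s) hx₀ y₀ y₁
  have l1 := log_sub_log_neg_of_im_pos (z := x₀ + y₁ * I - s) (by simpa using hy₁)
  have l2 := log_sub_log_neg_of_im_pos (z := -(x₀ + y₀ * I - s)) (by simpa using hy₀)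
  rw [neg_neg] at l2
  linear_combination key + F s * (e1 - e2 + e3 - e4 + l1 + l2)

/-- Cauchy's integral formula for an upper half-strip. -/
lemma halfStrip_cauchy_formula {F : ℂ → ℂ} {s : ℂ} {x₀ x₁ y₀ C : ℝ}
    (hx₀ : x₀ < s.re) (hx₁ : s.re < x₁) (hy₀ : y₀ < s.im)
    (hc : ContinuousOn F {w | (x₀ ≤ w.re ∧ w.re ≤ x₁) ∧ y₀ ≤ w.im})
    (hd : DifferentiableOn ℂ F {w | (x₀ < w.re ∧ w.re < x₁) ∧ y₀ < w.im})
    (hb : ∀ w : ℂ, x₀ ≤ w.re → w.re ≤ x₁ → y₀ ≤ w.im → ‖F w‖ ≤ C * ((1 + |w.im|) ^ 2)⁻¹) :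
    (∫ x in x₀..x₁, F (x + y₀ * I) / (x + y₀ * I - s)) +
      I * (∫ y in Set.Ioi y₀, F (x₁ + y * I) / (x₁ + y * I - s)) -
      I * (∫ y in Set.Ioi y₀, F (x₀ + y * I) / (x₀ + y * I - s)) = 2 * Real.pi * I * F s := by
  have hx : x₀ ≤ x₁ := by linarith
  have hV : ∀ x ∈ Set.Icc x₀ x₁, x ≠ s.re →
      Tendsto (fun T : ℝ => ∫ y in y₀..T, F (x + y * I) / (x + y * I - s)) atTop
        (𝓝 (∫ y in Set.Ioi y₀, F (x + y * I) / (x + y * I - s))) := by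
    intro x hxI hxne
    have hre : ∀ y : ℝ, ((x : ℂ) + y * I - s).re = x - s.re := fun y => by simp
    have hne : ∀ y : ℝ, (x : ℂ) + y * I - s ≠ 0 := fun y h => by
      have := hre y
      rw [h] at this
      exact hxne (sub_eq_zero.1 this.symm)
    refine intervalIntegral_tendsto_integral_Ioi _ ?_ tendsto_id
    have hbd : IntegrableOn (fun y : ℝ => C / |x - s.re| * ((1 + |y|) ^ 2)⁻¹) (Set.Ioi y₀) :=
      (integrable_inv_one_add_abs_sq.const_mul _).integrableOn
    refine hbd.mono' (ContinuousOn.aestronglyMeasurable ?_ measurableSet_Ioi) ?_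
    · refine ContinuousOn.div (hc.comp (by fun_prop) fun y hy => ?_) (by fun_prop)
        fun y _ => hne y
      exact ⟨by simpa using hxI, by simpa using le_of_lt hy⟩
    · refine (ae_restrict_iff' measurableSet_Ioi).2 (ae_of_all _ fun y hy => ?_)
      have h1 := hb (x + y * I) (by simpa using hxI.1) (by simpa using hxI.2)
        (by simpa using le_of_lt hy)
      have h2 : |x - s.re| ≤ ‖(x : ℂ) + y * I - s‖ := by
        rw [← hre y]; exact Complex.abs_re_le_norm _
      have h3 : 0 < |x - s.re| := abs_pos.2 (sub_ne_zero.2 hxne)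
      rw [norm_div]
      simp only [add_im, ofReal_im, mul_im, ofReal_re, I_im, I_re, mul_one, mul_zero, add_zero,
        zero_add] at h1
      calc _ ≤ (C * ((1 + |y|) ^ 2)⁻¹) / |x - s.re| := by
            have := (norm_nonneg _).trans h1
            gcongr
        _ = _ := by ring
  have hC : 0 ≤ C := by
    have h := (norm_nonneg _).trans (hb s hx₀.le hx₁.le hy₀.le)
    exact nonneg_of_mul_nonneg_left h (by positivity)
  have hTop : Tendsto (fun T : ℝ => ∫ x in x₀..x₁, F (x + T * I) / (x + T * I - s)) atTop
      (𝓝 0) := by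
    have hg : Tendsto (fun T : ℝ => C * (T - s.im)⁻¹ * |x₁ - x₀|) atTop (𝓝 0) := by
      have : Tendsto (fun T : ℝ => (T - s.im)⁻¹) atTop (𝓝 0) :=
        tendsto_inv_atTop_zero.comp (tendsto_atTop_add_const_right _ _ tendsto_id)
      simpa using (this.const_mul C).mul_const |x₁ - x₀|
    refine squeeze_zero_norm' ?_ hg
    filter_upwards [eventually_gt_atTop s.im] with T hT
    refine intervalIntegral.norm_integral_le_of_norm_le_const fun x hx' => ?_
    rw [Set.uIoc_of_le hx] at hx'
    have h1 := hb (x + T * I) (by simpa using hx'.1.le) (by simpa using hx'.2)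
      (by simpa using (hy₀.trans hT).le)
    have h2 : T - s.im ≤ ‖(x : ℂ) + T * I - s‖ := by
      have := Complex.abs_im_le_norm ((x : ℂ) + T * I - s)
      have h3 : ((x : ℂ) + T * I - s).im = T - s.im := by simp
      rw [h3] at this
      exact (le_abs_self _).trans this
    have h4 : 0 < T - s.im := by linarith
    rw [norm_div, div_eq_mul_inv]
    gcongr
    refine h1.trans (mul_le_of_le_one_right hC (inv_le_one_of_one_le₀ (one_le_pow₀ ?_)))
    simp
  have hconst : ∀ᶠ T : ℝ in atTop,
      (∫ x in x₀..x₁, F (x + y₀ * I) / (x + y₀ * I - s)) -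
      (∫ x in x₀..x₁, F (x + T * I) / (x + T * I - s)) +
      I * (∫ y in y₀..T, F (x₁ + y * I) / (x₁ + y * I - s)) -
      I * (∫ y in y₀..T, F (x₀ + y * I) / (x₀ + y * I - s)) = 2 * Real.pi * I * F s := by
    filter_upwards [eventually_gt_atTop s.im] with T hT
    exact rect_cauchy_formula hx₀ hx₁ hy₀ hT
      (hc.mono fun w hw => ⟨hw.1, hw.2.1⟩) (hd.mono fun w hw => ⟨hw.1, hw.2.1⟩)
  have hlim := (((tendsto_const_nhds (x := ∫ x in x₀..x₁, F (x + y₀ * I) / (x + y₀ * I - s))).sub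
    hTop).add ((hV x₁ (by simp [hx]) hx₁.ne').const_mul I)).sub
    ((hV x₀ (by simp [hx]) hx₀.ne).const_mul I)
  rw [sub_zero] at hlim
  exact tendsto_nhds_unique hlim ((tendsto_congr' hconst).2 tendsto_const_nhds)

/-- `l_n(w - s) = Γ(1 + (w - s)/a) n^{w - s}`, the numerator of the kernel that smooths `φ`. -/
noncomputable def smoothingKernel (a : ℝ) (n : ℕ) (s w : ℂ) : ℂ :=
  Complex.Gamma ((w - s) / a + 1) * (n : ℂ) ^ (w - s)

lemma differentiableAt_smoothingKernel {a : ℝ} (ha : 0 < a) {n : ℕ} (hn : 0 < n) {s w : ℂ}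
    (h : s.re - a < w.re) : DifferentiableAt ℂ (smoothingKernel a n s) w := by
  have hn' : (n : ℂ) ≠ 0 := by exact_mod_cast hn.ne'
  refine DifferentiableAt.mul ?_ (DifferentiableAt.const_cpow (by fun_prop) (Or.inl hn'))
  refine DifferentiableAt.comp (g := Complex.Gamma) (f := fun w : ℂ => (w - s) / a + 1) w
    (Complex.differentiableAt_Gamma _ fun m hm => ?_) (by fun_prop)
  have h1 := congrArg Complex.re hm
  rw [Complex.add_re, Complex.div_ofReal_re] at h1
  simp only [sub_re, one_re, neg_re, natCast_re] at h1
  have h2 : -1 < (w.re - s.re) / a := by rw [lt_div_iff₀ ha]; linarith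
  have : (0 : ℝ) ≤ m := m.cast_nonneg
  linarith

lemma exists_norm_smoothingKernel_le (P : ℕ) {a d₀ d₁ : ℝ} (ha : 0 < a) (hd₀ : -a < d₀) :
    ∃ C : ℝ, 0 < C ∧ ∀ n : ℕ, 0 < n → ∀ s w : ℂ, d₀ ≤ w.re - s.re → w.re - s.re ≤ d₁ →
      ‖smoothingKernel a n s w‖ ≤
        C * (n : ℝ) ^ (w.re - s.re) * ((1 + |w.im - s.im|) ^ P)⁻¹ := by
  obtain ⟨C, hC0, hC⟩ := norm_Gamma_le_inv_one_add_abs_im_pow P (x₀ := d₀ / a + 1)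
    (x₁ := d₁ / a + 1) (by
      have : -1 < d₀ / a := by rw [lt_div_iff₀ ha]; linarith
      linarith)
  refine ⟨C * (1 + a) ^ P, by positivity, fun n hn s w h0 h1 => ?_⟩
  have h2 := hC ((w - s) / a + 1)
    (by rw [Complex.add_re, Complex.div_ofReal_re]; simp only [sub_re, one_re]; gcongr)
    (by rw [Complex.add_re, Complex.div_ofReal_re]; simp only [sub_re, one_re]; gcongr)
  have him : ((w - s) / a + 1).im = (w.im - s.im) / a := by
    rw [Complex.add_im, Complex.div_ofReal_im]; simp
  rw [him] at h2
  have h3 : ((1 + |(w.im - s.im) / a|) ^ P)⁻¹ ≤ (1 + a) ^ P * ((1 + |w.im - s.im|) ^ P)⁻¹ := by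
    set y := w.im - s.im
    rw [← div_eq_mul_inv, ← div_pow, ← inv_pow]
    gcongr
    rw [le_div_iff₀ (by positivity), inv_mul_le_iff₀ (by positivity), abs_div, abs_of_pos ha]
    have : (1 + |y| / a) * (1 + a) = 1 + |y| + a + |y| / a := by field_simp; ring
    rw [this]
    have : 0 ≤ |y| / a := by positivity
    linarith
  rw [smoothingKernel, norm_mul, Complex.norm_natCast_cpow_of_pos hn, sub_re]
  calc _ ≤ C * ((1 + a) ^ P * ((1 + |w.im - s.im|) ^ P)⁻¹) * (n : ℝ) ^ (w.re - s.re) := by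
        gcongr
        exact h2.trans (by gcongr)
    _ = _ := by ring

lemma integrable_smoothingKernel_div {a b : ℝ} (ha : 0 < a) {s : ℂ} (hs : s.re < b) {n : ℕ}
    (hn : 0 < n) :
    Integrable fun u : ℝ => smoothingKernel a n s (b + u * I) / (b + u * I - s) := by
  obtain ⟨C, hC0, hC⟩ := exists_norm_smoothingKernel_le 2 (a := a) (d₀ := b - s.re)
    (d₁ := b - s.re) ha (by linarith)
  have hne : ∀ u : ℝ, (b : ℂ) + u * I - s ≠ 0 := fun y h => by
    have := congrArg Complex.re h
    simp at this
    linarith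
  have hbound : Integrable fun u : ℝ =>
      C * (n : ℝ) ^ (b - s.re) / (b - s.re) * ((1 + |u - s.im|) ^ 2)⁻¹ :=
    (integrable_inv_one_add_abs_sq.comp_sub_right s.im).const_mul _
  refine hbound.mono' (Continuous.aestronglyMeasurable ?_) (ae_of_all _ fun u => ?_)
  · refine Continuous.div (continuous_iff_continuousAt.2 fun u => ?_) (by fun_prop) hne
    refine ContinuousAt.comp (g := smoothingKernel a n s) (f := fun u : ℝ => (b : ℂ) + u * I)
      (differentiableAt_smoothingKernel ha hn ?_).continuousAt (by fun_prop)
    simp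
    linarith
  · have h1 := hC n hn s (b + u * I) (by simp) (by simp)
    have h2 : b - s.re ≤ ‖(b : ℂ) + u * I - s‖ := by
      have := Complex.re_le_norm ((b : ℂ) + u * I - s)
      simpa using this
    have h3 : 0 < b - s.re := by linarith
    simp only [add_re, add_im, ofReal_re, ofReal_im, mul_re, mul_im, I_re, I_im, mul_zero, mul_one,
      sub_zero, add_zero, zero_add] at h1
    rw [norm_div]
    calc _ ≤ (C * (n : ℝ) ^ (b - s.re) * ((1 + |u - s.im|) ^ 2)⁻¹) / (b - s.re) := by gcongr
      _ = _ := by ring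

lemma norm_div_natCast_add_one_cpow (z : ℂ) (k : ℕ) (w : ℂ) :
    ‖z / ((k : ℂ) + 1) ^ w‖ = ‖z‖ / ((k : ℝ) + 1) ^ w.re := by
  have h : (0 : ℝ) < (k : ℝ) + 1 := by positivity
  have h1 := Complex.norm_cpow_eq_rpow_re_of_pos h w
  push_cast at h1
  rw [norm_div, h1]

namespace MatsumotoClass

variable {φ : ℂ → ℂ} {σ₀ : ℝ} {c : ℕ → ℂ} {l : ℕ} {spole : Fin l → ℂ}

lemma summable_norm_coeff (hφ : MatsumotoClass φ σ₀ c l spole) {b : ℝ} (hb : 1 < b) :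
    Summable fun k : ℕ => ‖c (k + 1)‖ / ((k : ℝ) + 1) ^ b := by
  refine (hφ.dirichlet b (by simpa using hb)).summable.norm.congr fun k => ?_
  rw [norm_div_natCast_add_one_cpow, ofReal_re]

lemma norm_le_tsum (hφ : MatsumotoClass φ σ₀ c l spole) {w : ℂ} (hw : 1 < w.re) :
    ‖φ w‖ ≤ ∑' k : ℕ, ‖c (k + 1)‖ / ((k : ℝ) + 1) ^ w.re := by
  rw [← (hφ.dirichlet w hw).tsum_eq]
  have hterm := fun k => norm_div_natCast_add_one_cpow (c (k + 1)) k w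
  refine (norm_tsum_le_tsum_norm ?_).trans_eq (tsum_congr hterm)
  exact (hφ.summable_norm_coeff hw).congr fun k => (hterm k).symm

/-- The mollified series as an absolutely convergent integral over a vertical line. -/
lemma approx_eq_integral (hφ : MatsumotoClass φ σ₀ c l spole) {a b : ℝ} (ha : 0 < a)
    (hb : 1 < b) {s : ℂ} (hs : s.re < b) {n : ℕ} (hn : 0 < n) :
    matsumotoZetaApprox c a n s = (1 / (2 * Real.pi) : ℝ) * ∫ u : ℝ,
      φ (b + u * I) * smoothingKernel a n s (b + u * I) / (b + u * I - s) := by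
  have hn' : (0 : ℝ) < n := by exact_mod_cast hn
  set g : ℝ → ℂ := fun u => smoothingKernel a n s (b + u * I) / (b + u * I - s) with hg
  have hgi : Integrable g := integrable_smoothingKernel_div ha hs hn
  set F : ℕ → ℝ → ℂ := fun m u => c (m + 1) / ((m : ℂ) + 1) ^ ((b : ℂ) + u * I) * g u with hF
  have hnorm : ∀ (m : ℕ) (u : ℝ), ‖c (m + 1) / ((m : ℂ) + 1) ^ ((b : ℂ) + u * I)‖ =
      ‖c (m + 1)‖ / ((m : ℝ) + 1) ^ b := fun m u => by
    rw [norm_div_natCast_add_one_cpow]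
    simp
  have hne : ∀ m : ℕ, (m : ℂ) + 1 ≠ 0 := fun m => by exact_mod_cast m.succ_ne_zero
  have hFi : ∀ m, Integrable (F m) := fun m => by
    refine hgi.bdd_mul (c := ‖c (m + 1)‖ / ((m : ℝ) + 1) ^ b)
      (Continuous.aestronglyMeasurable ?_) (ae_of_all _ fun u => (hnorm m u).le)
    refine Continuous.div continuous_const ?_ fun u => by simp [Complex.cpow_eq_zero_iff, hne m]
    exact Continuous.const_cpow (by fun_prop) (Or.inl (hne m))
  have hsum := hasSum_integral_of_summable_integral_norm hFi (by
    refine ((hφ.summable_norm_coeff hb).mul_right (∫ u, ‖g u‖)).congr fun m => ?_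
    simp only [hF, norm_mul, hnorm]
    rw [integral_const_mul])
  have hFsum : ∀ u, ∑' m, F m u =
      φ (b + u * I) * smoothingKernel a n s (b + u * I) / (b + u * I - s) := fun u => by
    rw [((hφ.dirichlet (b + u * I) (by simpa using hb)).mul_right (g u)).tsum_eq, hg]
    ring
  simp only [hFsum] at hsum
  rw [← hsum.tsum_eq, ← tsum_mul_left, matsumotoZetaApprox]
  refine tsum_congr fun m => ?_
  have hm : (0 : ℝ) < (m : ℝ) + 1 := by positivity
  have hint : ∫ u, F m u = c (m + 1) * ((m : ℂ) + 1) ^ (-s) * ∫ y : ℝ,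
      ((((m : ℝ) + 1) / n : ℝ) : ℂ) ^ (-((b - s.re : ℝ) + y * I)) *
        (Complex.Gamma (((b - s.re : ℝ) + y * I) / a + 1) / ((b - s.re : ℝ) + y * I)) := by
    rw [← integral_const_mul]
    refine Eq.trans ?_ (integral_sub_right_eq_self _ s.im)
    refine integral_congr_ae (ae_of_all _ fun u => ?_)
    have hz : ((b - s.re : ℝ) : ℂ) + (u - s.im : ℝ) * I = b + u * I - s := by
      apply Complex.ext <;> simp
    simp only [hF, hg]
    rw [hz, ofReal_div, Complex.div_cpow_ofReal_nonneg hm.le hn'.le, smoothingKernel]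
    push_cast
    rw [Complex.cpow_neg (n : ℂ) (b + u * I - s), div_inv_eq_mul, div_eq_mul_inv (c (m + 1)),
      ← Complex.cpow_neg, show -((b : ℂ) + u * I) = -s + -(b + u * I - s) by ring,
      Complex.cpow_add _ _ (hne m)]
    ring
  rw [hint, exp_neg_rpow_eq_integral ha (σ := b - s.re) (by linarith) (div_pos hm hn')]
  ring

end MatsumotoClass

lemma exists_sum_inv_one_add_abs_sub_mul_sq_le {h : ℝ} (hh : 0 < h) :
    ∃ S : ℝ, 0 < S ∧ ∀ (n : ℕ) (u : ℝ),
      ∑ k ∈ Finset.range n, ((1 + |u - k * h|) ^ 2)⁻¹ ≤ S := by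
  set W : ℝ := ∫ u : ℝ, ((1 + |u|) ^ 2)⁻¹ with hW
  have hW0 : 0 ≤ W := integral_nonneg fun u => by positivity
  have hcont : ∀ u : ℝ, Continuous fun y : ℝ => ((1 + |u - y|) ^ 2)⁻¹ := fun u =>
    (continuous_inv_one_add_abs_pow 2).comp (continuous_const.sub continuous_id)
  refine ⟨(1 + h) ^ 2 / h * W + 1, by positivity, fun n u => ?_⟩
  have hstep : ∀ k : ℕ, ((1 + |u - k * h|) ^ 2)⁻¹ ≤
      (1 + h) ^ 2 / h * ∫ y in (k * h : ℝ)..((k + 1 : ℕ) * h : ℝ), ((1 + |u - y|) ^ 2)⁻¹ := by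
    intro k
    have hk : (k * h : ℝ) ≤ (k + 1 : ℕ) * h := by push_cast; nlinarith
    have h1 : ∫ y in (k * h : ℝ)..((k + 1 : ℕ) * h : ℝ), ((1 + h) ^ 2)⁻¹ * ((1 + |u - k * h|) ^ 2)⁻¹
        ≤ ∫ y in (k * h : ℝ)..((k + 1 : ℕ) * h : ℝ), ((1 + |u - y|) ^ 2)⁻¹ := by
      refine intervalIntegral.integral_mono_on hk (by simp) ((hcont u).intervalIntegrable _ _)
        fun y hy => ?_
      rw [← mul_inv, ← mul_pow]
      gcongr
      have h2 : |u - y| ≤ |u - k * h| + |y - k * h| := by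
        have := abs_sub_le u (k * h) y
        rwa [abs_sub_comm (k * h : ℝ) y] at this
      have h3 : |y - k * h| ≤ h := by
        rw [abs_of_nonneg (by linarith [hy.1])]
        have := hy.2
        push_cast at this
        linarith
      nlinarith [abs_nonneg (u - k * h)]
    rw [intervalIntegral.integral_const, smul_eq_mul] at h1
    have h4 : ((k + 1 : ℕ) * h - k * h : ℝ) = h := by push_cast; ring
    rw [h4] at h1
    calc _ = (1 + h) ^ 2 / h * (h * (((1 + h) ^ 2)⁻¹ * ((1 + |u - k * h|) ^ 2)⁻¹)) := by
          field_simp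
      _ ≤ _ := by gcongr
  calc _ ≤ ∑ k ∈ Finset.range n, (1 + h) ^ 2 / h *
        ∫ y in (k * h : ℝ)..((k + 1 : ℕ) * h : ℝ), ((1 + |u - y|) ^ 2)⁻¹ :=
        Finset.sum_le_sum fun k _ => hstep k
    _ = (1 + h) ^ 2 / h * ∫ y in ((0 : ℕ) * h : ℝ)..(n * h : ℝ), ((1 + |u - y|) ^ 2)⁻¹ := by
        rw [← Finset.mul_sum, intervalIntegral.sum_integral_adjacent_intervals
          (a := fun k : ℕ => (k * h : ℝ)) fun k _ => (hcont u).intervalIntegrable _ _]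
    _ ≤ (1 + h) ^ 2 / h * W := by
        gcongr
        rw [intervalIntegral.integral_of_le (by push_cast; nlinarith [n.cast_nonneg (α := ℝ)]), hW,
          ← integral_sub_left_eq_self (fun y : ℝ => ((1 + |y|) ^ 2)⁻¹) volume u]
        exact setIntegral_le_integral (integrable_inv_one_add_abs_sq.comp_sub_left u)
          (ae_of_all _ fun y => by positivity)
    _ ≤ _ := by linarith

lemma integrableOn_mul_inv_one_add_abs_sub_pow {q : ℝ → ℝ} {T₁ C : ℝ} {N : ℕ} (hC : 0 ≤ C)
    (hq : Continuous q) (hq0 : ∀ u, 0 ≤ q u) (hqb : ∀ u, T₁ ≤ u → q u ≤ C * (1 + |u|) ^ N)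
    (t : ℝ) : IntegrableOn (fun u => q u * ((1 + |u - t|) ^ (N + 4))⁻¹) (Set.Ioi T₁) := by
  have hbd : IntegrableOn (fun u : ℝ => C * (1 + |t|) ^ (N + 4) * ((1 + |u|) ^ 2)⁻¹)
      (Set.Ioi T₁) := (integrable_inv_one_add_abs_sq.const_mul _).integrableOn
  refine hbd.mono' (Continuous.aestronglyMeasurable (hq.mul
    ((continuous_inv_one_add_abs_pow (N + 4)).comp (continuous_id.sub continuous_const)))) ?_
  refine (ae_restrict_iff' measurableSet_Ioi).2 (ae_of_all _ fun u hu => ?_)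
  have h1 := inv_one_add_abs_pow_le_mul (N + 4) (u - t) t
  rw [sub_add_cancel] at h1
  rw [Real.norm_of_nonneg (mul_nonneg (hq0 u) (by positivity))]
  calc _ ≤ (C * (1 + |u|) ^ N) * ((1 + |t|) ^ (N + 4) * ((1 + |u|) ^ (N + 4))⁻¹) := by
        gcongr
        exact hqb u (le_of_lt hu)
    _ = C * (1 + |t|) ^ (N + 4) * ((1 + |u|) ^ 4)⁻¹ := by
        rw [pow_add (1 + |u|) N 4, mul_inv]
        field_simp
    _ ≤ _ := by
        gcongr ?_ * ?_
        exact inv_one_add_abs_pow_anti (by norm_num) u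

/-- Averages of `q` against translates of an integrable weight are bounded when `q` is bounded in
mean and of polynomial growth. -/
lemma exists_sum_integral_mul_inv_one_add_abs_sub_pow_le {q : ℝ → ℝ} {T₁ C D h : ℝ} {N : ℕ}
    (hh : 0 < h) (hT₁ : 0 ≤ T₁) (hC : 0 ≤ C) (hD : 0 ≤ D)
    (hq : Continuous q) (hq0 : ∀ u, 0 ≤ q u) (hqb : ∀ u, T₁ ≤ u → q u ≤ C * (1 + |u|) ^ N)
    (hmean : ∀ T, 1 ≤ T → ∫ u in (0 : ℝ)..T, q u ≤ D * T) :
    ∃ A : ℝ, 0 ≤ A ∧ ∀ n : ℕ, ∑ k ∈ Finset.range (n + 1),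
      ∫ u in Set.Ioi T₁, q u * ((1 + |u - k * h|) ^ (N + 4))⁻¹ ≤ A * (n + 1) := by
  obtain ⟨S, hS0, hS⟩ := exists_sum_inv_one_add_abs_sub_mul_sq_le hh
  set W : ℝ := ∫ u : ℝ, ((1 + |u|) ^ 2)⁻¹ with hW
  have hW0 : 0 ≤ W := integral_nonneg fun u => by positivity
  refine ⟨S * (D * (2 * h + 1)) + 2 ^ (N + 4) * C * W, by positivity, fun n => ?_⟩
  set T : ℝ := 2 * h * (n + 1) + 1 with hT
  have hT1 : 1 ≤ T := by rw [hT]; linarith [show 0 < 2 * h * ((n : ℝ) + 1) by positivity]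
  set G : ℝ → ℝ := fun u => S * (Set.Ioc 0 T).indicator q u +
    (n + 1) * 2 ^ (N + 4) * C * ((1 + |u|) ^ 2)⁻¹ with hG
  have hG1 : Integrable (fun u => S * (Set.Ioc 0 T).indicator q u) :=
    ((hq.integrableOn_Ioc).integrable_indicator measurableSet_Ioc).const_mul _
  have hG2 : Integrable (fun u : ℝ => ((n : ℝ) + 1) * 2 ^ (N + 4) * C * ((1 + |u|) ^ 2)⁻¹) :=
    integrable_inv_one_add_abs_sq.const_mul _
  have hG0 : ∀ u, 0 ≤ G u := fun u => by
    have : 0 ≤ (Set.Ioc 0 T).indicator q u := Set.indicator_nonneg (fun v _ => hq0 v) u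
    positivity
  have hJ := fun k : ℕ => integrableOn_mul_inv_one_add_abs_sub_pow hC hq hq0 hqb (k * h)
  have hpt : ∀ u ∈ Set.Ioi T₁,
      ∑ k ∈ Finset.range (n + 1), q u * ((1 + |u - k * h|) ^ (N + 4))⁻¹ ≤ G u := by
    intro u hu
    have hu0 : 0 < u := hT₁.trans_lt hu
    rw [← Finset.mul_sum]
    by_cases huT : u ≤ T
    · have h1 : ∑ k ∈ Finset.range (n + 1), ((1 + |u - k * h|) ^ (N + 4))⁻¹ ≤ S :=
        (Finset.sum_le_sum fun k _ => inv_one_add_abs_pow_anti (by omega) _).trans (hS (n + 1) u)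
      simp only [hG]
      rw [Set.indicator_of_mem (show u ∈ Set.Ioc 0 T from ⟨hu0, huT⟩)]
      have h2 : 0 ≤ ((n : ℝ) + 1) * 2 ^ (N + 4) * C * ((1 + |u|) ^ 2)⁻¹ := by positivity
      have h3 := mul_le_mul_of_nonneg_left h1 (hq0 u)
      linarith
    · have h1 : ∀ k ∈ Finset.range (n + 1), ((1 + |u - k * h|) ^ (N + 4))⁻¹ ≤
          2 ^ (N + 4) * ((1 + |u|) ^ (N + 4))⁻¹ := by
        intro k hk
        have hkn : (k : ℝ) ≤ n + 1 := by exact_mod_cast (Finset.mem_range.1 hk).le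
        have hku : k * h ≤ u / 2 := by
          have := mul_le_mul_of_nonneg_right hkn hh.le
          push Not at huT
          rw [hT] at huT
          linarith
        rw [← div_eq_mul_inv, ← div_pow, ← inv_pow]
        gcongr
        rw [le_div_iff₀ (by positivity), inv_mul_le_iff₀ (by positivity), abs_of_pos hu0,
          abs_of_nonneg (by linarith)]
        linarith
      have h2 := Finset.sum_le_sum h1
      rw [Finset.sum_const, Finset.card_range, nsmul_eq_mul] at h2
      push_cast at h2
      simp only [hG]
      rw [Set.indicator_of_notMem (fun h => huT h.2), mul_zero, zero_add]
      calc _ ≤ (C * (1 + |u|) ^ N) * (((n : ℝ) + 1) *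
            (2 ^ (N + 4) * ((1 + |u|) ^ (N + 4))⁻¹)) := by
            refine mul_le_mul (hqb u (le_of_lt hu)) h2 ?_ (by positivity)
            exact Finset.sum_nonneg fun k _ => by positivity
        _ = ((n : ℝ) + 1) * 2 ^ (N + 4) * C * ((1 + |u|) ^ 4)⁻¹ := by
            rw [pow_add (1 + |u|) N 4, mul_inv]
            field_simp
        _ ≤ _ := by
            gcongr ?_ * ?_
            exact inv_one_add_abs_pow_anti (by norm_num) u
  rw [← integral_finsetSum _ fun k _ => hJ k]
  calc _ ≤ ∫ u in Set.Ioi T₁, G u :=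
        setIntegral_mono_on (integrable_finsetSum _ fun k _ => hJ k) (hG1.add hG2).integrableOn
          measurableSet_Ioi hpt
    _ ≤ ∫ u, G u := setIntegral_le_integral (hG1.add hG2) (ae_of_all _ hG0)
    _ = S * (∫ u in (0 : ℝ)..T, q u) + ((n : ℝ) + 1) * 2 ^ (N + 4) * C * W := by
        rw [hG, integral_add hG1 hG2, integral_const_mul, integral_const_mul,
          integral_indicator measurableSet_Ioc, intervalIntegral.integral_of_le (by linarith)]
    _ ≤ S * (D * ((2 * h + 1) * (n + 1))) + ((n : ℝ) + 1) * 2 ^ (N + 4) * C * W := by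
        gcongr
        refine (hmean T hT1).trans ?_
        gcongr
        rw [hT]
        nlinarith [n.cast_nonneg (α := ℝ)]
    _ = _ := by ring

namespace MatsumotoClass

variable {φ : ℂ → ℂ} {σ₀ : ℝ} {c : ℕ → ℂ} {l : ℕ} {spole : Fin l → ℂ}

/-- Above some height `φ` is holomorphic and of polynomial growth. -/
lemma exists_height (hφ : MatsumotoClass φ σ₀ c l spole) :
    ∃ (T₁ C : ℝ) (N : ℕ), 0 ≤ T₁ ∧ 0 < C ∧
      DifferentiableOn ℂ φ {w | σ₀ ≤ w.re ∧ T₁ ≤ w.im} ∧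
      ∀ w : ℂ, σ₀ ≤ w.re → T₁ ≤ w.im → ‖φ w‖ ≤ C * (1 + |w.im|) ^ N := by
  obtain ⟨C₂, hC₂, C, hC, T₀, hT₀, hb⟩ := hφ.growth
  have hnn : 0 ≤ ∑ j, |(spole j).im| := Finset.sum_nonneg fun j _ => abs_nonneg _
  refine ⟨T₀ + ∑ j, |(spole j).im|, C, ⌈C₂⌉₊, by linarith, hC, ?_, fun w h0 h1 => ?_⟩
  · refine hφ.continuation.mono fun w hw => ⟨hw.1, fun j hj => ?_⟩
    have h1 : |(spole j).im| ≤ ∑ j, |(spole j).im| :=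
      Finset.single_le_sum (f := fun j => |(spole j).im|) (fun j _ => abs_nonneg _)
        (Finset.mem_univ j)
    have h2 := hw.2
    rw [hj] at h2
    linarith [le_abs_self (spole j).im]
  · have h2 : T₀ ≤ |w.im| := (by linarith : T₀ ≤ w.im).trans (le_abs_self _)
    refine (hb w h0 h2).trans ?_
    gcongr
    calc |w.im| ^ C₂ ≤ (1 + |w.im|) ^ C₂ := by gcongr; linarith
      _ ≤ (1 + |w.im|) ^ (⌈C₂⌉₊ : ℝ) := by
          refine Real.rpow_le_rpow_of_exponent_le (by linarith [abs_nonneg w.im]) (Nat.le_ceil _)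
      _ = _ := Real.rpow_natCast _ _

/-- The difference between the mollified series and `φ`, after moving the line of integration
to `Re w = σ₀` above the height `T₁`. -/
lemma approx_sub_eq (hφ : MatsumotoClass φ σ₀ c l spole) {T₁ C : ℝ} {N : ℕ} (hC : 0 < C)
    (hd : DifferentiableOn ℂ φ {w | σ₀ ≤ w.re ∧ T₁ ≤ w.im})
    (hgr : ∀ w : ℂ, σ₀ ≤ w.re → T₁ ≤ w.im → ‖φ w‖ ≤ C * (1 + |w.im|) ^ N)
    {a b : ℝ} (ha : 0 < a) (hb : 1 < b) {s : ℂ} (hs₀ : σ₀ < s.re) (hsa : s.re < σ₀ + a)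
    (hsb : s.re < b) (hsT : T₁ < s.im) {n : ℕ} (hn : 0 < n) :
    matsumotoZetaApprox c a n s - φ s = (1 / (2 * Real.pi) : ℝ) *
      ((∫ u in Set.Iic T₁, φ (b + u * I) * smoothingKernel a n s (b + u * I) / (b + u * I - s)) +
      (∫ u in Set.Ioi T₁, φ (σ₀ + u * I) * smoothingKernel a n s (σ₀ + u * I) /
        (σ₀ + u * I - s)) +
      I * ∫ x in σ₀..b, φ (x + T₁ * I) * smoothingKernel a n s (x + T₁ * I) /
        (x + T₁ * I - s)) := by
  have hn1 : (1 : ℝ) ≤ n := by exact_mod_cast hn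
  set F : ℂ → ℂ := fun w => φ w * smoothingKernel a n s w with hF
  have hkd : ∀ w : ℂ, σ₀ ≤ w.re → DifferentiableAt ℂ (smoothingKernel a n s) w := fun w hw =>
    differentiableAt_smoothingKernel ha hn (by linarith)
  have hFd : DifferentiableOn ℂ F {w | σ₀ ≤ w.re ∧ T₁ ≤ w.im} :=
    hd.mul fun w hw => (hkd w hw.1).differentiableWithinAt
  obtain ⟨C', hC'0, hC'⟩ := exists_norm_smoothingKernel_le (N + 2) (a := a) (d₀ := σ₀ - s.re)
    (d₁ := b - s.re) ha (by linarith)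
  have hFb : ∀ w : ℂ, σ₀ ≤ w.re → w.re ≤ b → T₁ ≤ w.im → ‖F w‖ ≤
      C * (C' * (n : ℝ) ^ (b - s.re) * (1 + |s.im|) ^ (N + 2)) * ((1 + |w.im|) ^ 2)⁻¹ := by
    intro w h0 h1 h2
    have h3 := hC' n hn s w (by linarith) (by linarith)
    have h4 := inv_one_add_abs_pow_le_mul (N + 2) (w.im - s.im) s.im
    rw [sub_add_cancel] at h4
    rw [hF, norm_mul]
    calc _ ≤ (C * (1 + |w.im|) ^ N) * (C' * (n : ℝ) ^ (b - s.re) *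
          ((1 + |s.im|) ^ (N + 2) * ((1 + |w.im|) ^ (N + 2))⁻¹)) := by
          gcongr
          · exact hgr w h0 h2
          · refine h3.trans ?_
            gcongr
      _ = _ := by
          rw [pow_add (1 + |w.im|) N 2, mul_inv]
          field_simp
  have hcauchy := halfStrip_cauchy_formula (F := F) hs₀ hsb hsT
    (hFd.continuousOn.mono fun w hw => ⟨hw.1.1, hw.2⟩)
    (hFd.mono fun w hw => ⟨hw.1.1.le, hw.2.le⟩) hFb
  have hFs : F s = φ s := by
    have : (n : ℂ) ≠ 0 := by exact_mod_cast hn.ne'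
    simp [hF, smoothingKernel]
  have hline : Integrable fun u : ℝ =>
      φ (b + u * I) * smoothingKernel a n s (b + u * I) / (b + u * I - s) := by
    have hφc : Continuous fun u : ℝ => φ (b + u * I) := by
      have h1 : (fun u : ℝ => φ (b + u * I)) =
          fun u : ℝ => ∑' k : ℕ, c (k + 1) / ((k : ℂ) + 1) ^ ((b : ℂ) + u * I) :=
        funext fun u => (hφ.dirichlet _ (by simpa using hb)).tsum_eq.symm
      rw [h1]
      refine continuous_tsum (fun k => ?_) (hφ.summable_norm_coeff hb) fun k u => ?_
      · have hne : (k : ℂ) + 1 ≠ 0 := by exact_mod_cast k.succ_ne_zero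
        refine Continuous.div continuous_const ?_ fun u => by simp [Complex.cpow_eq_zero_iff, hne]
        exact Continuous.const_cpow (by fun_prop) (Or.inl hne)
      · rw [norm_div_natCast_add_one_cpow]
        simp
    have := (integrable_smoothingKernel_div ha hsb hn).bdd_mul
      (c := ∑' k : ℕ, ‖c (k + 1)‖ / ((k : ℝ) + 1) ^ b) hφc.aestronglyMeasurable
      (ae_of_all _ fun u => by simpa using hφ.norm_le_tsum (w := b + u * I) (by simpa using hb))
    simpa only [mul_div_assoc] using this
  rw [hφ.approx_eq_integral ha hb hsb hn,
    ← intervalIntegral.integral_Iic_add_Ioi hline.integrableOn hline.integrableOn (b := T₁)]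
  rw [hFs] at hcauchy
  simp only [hF] at hcauchy
  have hpi : (Real.pi : ℂ) ≠ 0 := by exact_mod_cast Real.pi_ne_zero
  push_cast
  generalize (∫ u in Set.Ioi T₁, φ (b + u * I) * smoothingKernel a n s (b + u * I) /
    (b + u * I - s)) = R at hcauchy ⊢
  generalize (∫ u in Set.Ioi T₁, φ (σ₀ + u * I) * smoothingKernel a n s (σ₀ + u * I) /
    (σ₀ + u * I - s)) = L at hcauchy ⊢
  generalize (∫ x in σ₀..b, φ (x + T₁ * I) * smoothingKernel a n s (x + T₁ * I) /
    (x + T₁ * I - s)) = H at hcauchy ⊢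
  have hR : R = L + I * H + 2 * Real.pi * φ s := by
    linear_combination (-I) * hcauchy + (R - L - 2 * Real.pi * φ s) * I_sq
  generalize (∫ u in Set.Iic T₁, φ (b + u * I) * smoothingKernel a n s (b + u * I) /
    (b + u * I - s)) = Q
  rw [hR]
  field_simp
  ring

lemma continuous_criticalLine (hφ : MatsumotoClass φ σ₀ c l spole) :
    Continuous fun u : ℝ => φ (σ₀ + u * I) := by
  obtain ⟨Kc, -, hK, hKre⟩ := hφ.poles_compact
  refine hφ.continuation.continuousOn.comp_continuous (by fun_prop)
    fun u => ⟨by simp, fun j h => ?_⟩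
  exact hKre _ (hK j) (by simp [← h])

lemma exists_integral_norm_criticalLine_le (hφ : MatsumotoClass φ σ₀ c l spole) :
    ∃ D : ℝ, 0 ≤ D ∧ ∀ T : ℝ, 1 ≤ T → ∫ u in (0 : ℝ)..T, ‖φ (σ₀ + u * I)‖ ≤ D * T := by
  obtain ⟨C, hC, hms⟩ := hφ.meansq
  have hc := hφ.continuous_criticalLine.norm
  have hc2 : Continuous fun u : ℝ => ‖φ (σ₀ + u * I)‖ ^ 2 := hc.pow 2
  refine ⟨1 + C, by positivity, fun T hT => ?_⟩
  calc _ ≤ ∫ u in (0 : ℝ)..T, (1 + ‖φ (σ₀ + u * I)‖ ^ 2) := by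
        refine intervalIntegral.integral_mono_on (by linarith) (hc.intervalIntegrable _ _)
          ((continuous_const.add hc2).intervalIntegrable _ _) fun u _ => ?_
        nlinarith [sq_nonneg (‖φ (σ₀ + u * I)‖ - 1), sq_nonneg ‖φ (σ₀ + u * I)‖]
    _ = T + ∫ u in (0 : ℝ)..T, ‖φ (σ₀ + u * I)‖ ^ 2 := by
        rw [intervalIntegral.integral_add (by simp) (hc2.intervalIntegrable _ _)]
        simp
    _ ≤ _ := by linarith [hms T hT]

/-- A bound for the smoothing error in the strip `σ₀ + δ ≤ Re s ≤ σ₁` that is uniform in `s`. -/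
lemma exists_norm_approx_sub_le (hφ : MatsumotoClass φ σ₀ c l spole) {T₁ C : ℝ} {N : ℕ}
    (hC : 0 < C) (hd : DifferentiableOn ℂ φ {w | σ₀ ≤ w.re ∧ T₁ ≤ w.im})
    (hgr : ∀ w : ℂ, σ₀ ≤ w.re → T₁ ≤ w.im → ‖φ w‖ ≤ C * (1 + |w.im|) ^ N)
    {a δ σ₁ M : ℝ} (ha : 0 < a) (hδ : 0 < δ) (hσ₁ : 1 < σ₁) (hσ₁a : σ₁ < σ₀ + a) (hM : 0 ≤ M) :
    ∃ A : ℝ, 0 ≤ A ∧ ∀ n : ℕ, 0 < n → ∀ (s : ℂ) (t : ℝ), σ₀ + δ ≤ s.re → s.re ≤ σ₁ →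
      |s.im - t| ≤ M → T₁ + M + 1 ≤ t →
      ‖matsumotoZetaApprox c a n s - φ s‖ ≤
        A * (n : ℝ) ^ (σ₁ + 1) * ((1 + |T₁ - t|) ^ 2)⁻¹ + A * (n : ℝ) ^ (-δ) *
          ∫ u in Set.Ioi T₁, ‖φ (σ₀ + u * I)‖ * ((1 + |u - t|) ^ (N + 4))⁻¹ := by
  obtain ⟨hσ₀, hσ₀1⟩ := hφ.sigma_mem
  obtain ⟨C', hC'0, hC'⟩ := exists_norm_smoothingKernel_le (N + 4) (a := a) (d₀ := σ₀ - σ₁)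
    (d₁ := σ₁ + 1) ha (by linarith)
  set W : ℝ := ∫ u : ℝ, ((1 + |u|) ^ 2)⁻¹ with hW
  have hW0 : 0 ≤ W := integral_nonneg fun u => by positivity
  set Z : ℝ := ∑' k : ℕ, ‖c (k + 1)‖ / ((k : ℝ) + 1) ^ (σ₁ + 1) with hZ
  have hZ0 : 0 ≤ Z := tsum_nonneg fun k => by positivity
  set Y : ℝ := C * (1 + |T₁|) ^ N with hY
  have hY0 : 0 ≤ Y := by positivity
  set B : ℝ := C' * (1 + M) ^ (N + 4) with hB
  have hB0 : 0 ≤ B := by positivity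
  have hlen : 0 ≤ σ₁ + 1 - σ₀ := by linarith
  refine ⟨B * (Z * W + (σ₁ + 1 - σ₀) * Y) + B / δ, by positivity,
    fun n hn s t hs₀ hs₁ hst ht => ?_⟩
  have hn1 : (1 : ℝ) ≤ n := by exact_mod_cast hn
  have hsT : T₁ + 1 ≤ s.im := by linarith [(abs_le.1 hst).1]
  have hker : ∀ w : ℂ, σ₀ ≤ w.re → w.re ≤ σ₁ + 1 → ∀ e : ℝ, w.re - s.re ≤ e →
      ‖smoothingKernel a n s w‖ ≤ B * (n : ℝ) ^ e * ((1 + |w.im - t|) ^ (N + 4))⁻¹ := by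
    intro w h0 h1 e he
    have h2 := inv_one_add_abs_pow_le_mul (N + 4) (w.im - s.im) (s.im - t)
    rw [sub_add_sub_cancel] at h2
    calc _ ≤ C' * (n : ℝ) ^ (w.re - s.re) * ((1 + |w.im - s.im|) ^ (N + 4))⁻¹ :=
          hC' n hn s w (by linarith) (by linarith)
      _ ≤ C' * (n : ℝ) ^ e * ((1 + M) ^ (N + 4) * ((1 + |w.im - t|) ^ (N + 4))⁻¹) := by
          gcongr
          refine h2.trans ?_
          gcongr
      _ = _ := by rw [hB]; ring
  set p : ℝ := (n : ℝ) ^ (σ₁ + 1) with hp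
  have hp0 : 0 ≤ p := by positivity
  set r : ℝ := ((1 + |T₁ - t|) ^ 2)⁻¹ with hr
  have hr0 : 0 ≤ r := by positivity
  set J : ℝ := ∫ u in Set.Ioi T₁, ‖φ (σ₀ + u * I)‖ * ((1 + |u - t|) ^ (N + 4))⁻¹ with hJ
  have hJ0 : 0 ≤ J := integral_nonneg fun u => by positivity
  have hlow : ‖∫ u in Set.Iic T₁, φ ((σ₁ + 1 : ℝ) + u * I) *
      smoothingKernel a n s ((σ₁ + 1 : ℝ) + u * I) / ((σ₁ + 1 : ℝ) + u * I - s)‖ ≤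
      Z * B * p * r * W := by
    have hint : Integrable fun u : ℝ => Z * B * p * r * ((1 + |u - T₁|) ^ 2)⁻¹ :=
      (integrable_inv_one_add_abs_sq.comp_sub_right T₁).const_mul _
    refine (norm_integral_le_of_norm_le hint.integrableOn ((ae_restrict_iff' measurableSet_Iic).2
      (ae_of_all _ fun u hu => ?_))).trans ?_
    · have hu' : u ≤ T₁ := hu
      have h1 := hφ.norm_le_tsum (w := (σ₁ + 1 : ℝ) + u * I) (by simp; linarith)
      have h2 := hker ((σ₁ + 1 : ℝ) + u * I) (by simp; linarith) (by simp) (σ₁ + 1)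
        (by simp; linarith)
      have h3 : 1 ≤ ‖((σ₁ + 1 : ℝ) : ℂ) + u * I - s‖ := by
        refine le_trans ?_ (Complex.re_le_norm _)
        simp
        linarith
      have h4 : ((1 + |u - t|) ^ (N + 4))⁻¹ ≤ r * ((1 + |u - T₁|) ^ 2)⁻¹ := by
        refine (inv_one_add_abs_pow_anti (show 4 ≤ N + 4 by omega) _).trans ?_
        rw [hr, ← mul_inv, ← mul_pow]
        refine inv_anti₀ (by positivity) ?_
        rw [show (1 + |u - t|) ^ 4 = ((1 + |u - t|) * (1 + |u - t|)) ^ 2 by ring]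
        have h5 : |u - t| = |T₁ - t| + |u - T₁| := by
          rw [abs_of_nonpos (by linarith), abs_of_nonpos (by linarith),
            abs_of_nonpos (by linarith)]
          ring
        rw [h5]
        have h6 := abs_nonneg (T₁ - t)
        have h7 := abs_nonneg (u - T₁)
        exact pow_le_pow_left₀ (by positivity)
          (mul_le_mul (by linarith) (by linarith) (by positivity) (by positivity)) 2
      simp only [add_re, add_im, ofReal_re, ofReal_im, mul_re, mul_im, I_re, I_im, mul_zero,
        mul_one, sub_zero, add_zero, zero_add] at h1 h2
      rw [norm_div, norm_mul]
      calc _ ≤ Z * (B * p * ((1 + |u - t|) ^ (N + 4))⁻¹) / 1 := by gcongr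
        _ ≤ Z * (B * p * (r * ((1 + |u - T₁|) ^ 2)⁻¹)) := by
          rw [div_one]
          gcongr
        _ = _ := by ring
    · refine (setIntegral_le_integral hint (ae_of_all _ fun u => by positivity)).trans_eq ?_
      rw [integral_const_mul, integral_sub_right_eq_self (fun u : ℝ => ((1 + |u|) ^ 2)⁻¹)]
  have hhigh : ‖∫ u in Set.Ioi T₁, φ (σ₀ + u * I) * smoothingKernel a n s (σ₀ + u * I) /
      (σ₀ + u * I - s)‖ ≤ B / δ * (n : ℝ) ^ (-δ) * J := by
    have hint : IntegrableOn (fun u : ℝ => B / δ * (n : ℝ) ^ (-δ) *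
        (‖φ (σ₀ + u * I)‖ * ((1 + |u - t|) ^ (N + 4))⁻¹)) (Set.Ioi T₁) :=
      (integrableOn_mul_inv_one_add_abs_sub_pow hC.le hφ.continuous_criticalLine.norm
        (fun u => norm_nonneg _)
        (fun u hu => by simpa using hgr (σ₀ + u * I) (by simp) (by simpa using hu)) t).const_mul _
    refine (norm_integral_le_of_norm_le hint (ae_of_all _ fun u => ?_)).trans_eq
      (integral_const_mul _ _)
    have h2 := hker (σ₀ + u * I) (by simp) (by simp; linarith) (-δ) (by simp; linarith)
    have h3 : δ ≤ ‖(σ₀ : ℂ) + u * I - s‖ := by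
      refine le_trans ?_ (Complex.abs_re_le_norm _)
      rw [le_abs]
      right
      simp
      linarith
    simp only [add_im, ofReal_re, ofReal_im, mul_im, I_re, I_im, mul_zero,
      mul_one, add_zero, zero_add] at h2
    rw [norm_div, norm_mul]
    calc _ ≤ ‖φ (σ₀ + u * I)‖ * (B * (n : ℝ) ^ (-δ) * ((1 + |u - t|) ^ (N + 4))⁻¹) / δ := by
          gcongr
      _ = _ := by ring
  have hhor : ‖∫ x in σ₀..(σ₁ + 1 : ℝ), φ (x + T₁ * I) * smoothingKernel a n s (x + T₁ * I) /
      (x + T₁ * I - s)‖ ≤ Y * B * p * r * (σ₁ + 1 - σ₀) := by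
    have h := intervalIntegral.norm_integral_le_of_norm_le_const (a := σ₀) (b := σ₁ + 1)
      (C := Y * B * p * r) (f := fun x : ℝ => φ (x + T₁ * I) *
        smoothingKernel a n s (x + T₁ * I) / (x + T₁ * I - s)) fun x hx => ?_
    · rwa [abs_of_nonneg hlen] at h
    · rw [Set.uIoc_of_le (by linarith)] at hx
      have h1 := hgr (x + T₁ * I) (by simpa using hx.1.le) (by simp)
      have h2 := hker (x + T₁ * I) (by simpa using hx.1.le) (by simpa using hx.2) (σ₁ + 1)
        (by simp; linarith [hx.2])
      have h3 : 1 ≤ ‖(x : ℂ) + T₁ * I - s‖ := by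
        refine le_trans ?_ (Complex.abs_im_le_norm _)
        rw [le_abs]
        right
        simp
        linarith
      simp only [add_im, ofReal_re, ofReal_im, mul_im, I_re, I_im, mul_zero,
        mul_one, add_zero, zero_add] at h1 h2
      have h4 := inv_one_add_abs_pow_anti (show 2 ≤ N + 4 by omega) (T₁ - t)
      rw [norm_div, norm_mul]
      calc _ ≤ Y * (B * p * ((1 + |T₁ - t|) ^ (N + 4))⁻¹) / 1 := by gcongr
        _ ≤ Y * (B * p * r) := by
          rw [div_one]
          gcongr
        _ = _ := by ring
  rw [hφ.approx_sub_eq hC hd hgr ha (b := σ₁ + 1) (by linarith) (by linarith) (by linarith)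
    (by linarith) (by linarith) hn, norm_mul]
  have hpi : ‖((1 / (2 * Real.pi) : ℝ) : ℂ)‖ ≤ 1 := by
    rw [Complex.norm_real, Real.norm_of_nonneg (by positivity), div_le_one (by positivity)]
    linarith [Real.pi_gt_three]
  refine (mul_le_of_le_one_left (norm_nonneg _) hpi).trans ((norm_add₃_le).trans ?_)
  rw [norm_mul, Complex.norm_I, one_mul]
  have h1 : 0 ≤ B / δ * p * r := by positivity
  have h2 : 0 ≤ B * (Z * W + (σ₁ + 1 - σ₀) * Y) * (n : ℝ) ^ (-δ) * J := by positivity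
  calc _ ≤ Z * B * p * r * W + B / δ * (n : ℝ) ^ (-δ) * J + Y * B * p * r * (σ₁ + 1 - σ₀) := by
        gcongr
    _ ≤ _ := by linarith

/-- In a half-plane of absolute convergence the smoothed series tends to `φ` uniformly. -/
lemma exists_tendsto_norm_approx_sub_le (hφ : MatsumotoClass φ σ₀ c l spole) {a σ₁ : ℝ}
    (ha : 0 < a) (hσ₁ : 1 < σ₁) :
    ∃ E : ℕ → ℝ, Tendsto E atTop (𝓝 0) ∧ ∀ (n : ℕ) (s : ℂ), σ₁ ≤ s.re →
      ‖matsumotoZetaApprox c a n s - φ s‖ ≤ E n := by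
  have hsum := hφ.summable_norm_coeff hσ₁
  have hv : ∀ n m : ℕ, |Real.exp (-((((m : ℝ) + 1) / n) ^ a)) - 1| ≤ 1 := fun n m => by
    have h1 : Real.exp (-((((m : ℝ) + 1) / n) ^ a)) ≤ 1 :=
      Real.exp_le_one_iff.2 (by simp only [Left.neg_nonpos_iff]; positivity)
    rw [abs_le]
    constructor <;> linarith [Real.exp_pos (-((((m : ℝ) + 1) / n) ^ a))]
  refine ⟨fun n => ∑' m : ℕ, ‖c (m + 1)‖ / ((m : ℝ) + 1) ^ σ₁ *
    |Real.exp (-((((m : ℝ) + 1) / n) ^ a)) - 1|, ?_, fun n s hs => ?_⟩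
  · have h := tendsto_tsum_of_dominated_convergence (𝓕 := atTop) (g := fun _ : ℕ => (0 : ℝ))
      (f := fun n m : ℕ => ‖c (m + 1)‖ / ((m : ℝ) + 1) ^ σ₁ *
        |Real.exp (-((((m : ℝ) + 1) / n) ^ a)) - 1|) hsum (fun m => ?_)
      (Eventually.of_forall fun n m => ?_)
    · simpa using h
    · have h1 : Tendsto (fun n : ℕ => (((m : ℝ) + 1) / n) ^ a) atTop (𝓝 0) := by
        have := (tendsto_const_div_atTop_nhds_zero_nat ((m : ℝ) + 1)).rpow_const
          (Or.inr ha.le)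
        rwa [Real.zero_rpow ha.ne'] at this
      have h2 := ((Real.continuous_exp.tendsto _).comp h1.neg).sub_const 1
      simpa using (h2.abs).const_mul (‖c (m + 1)‖ / ((m : ℝ) + 1) ^ σ₁)
    · rw [Real.norm_of_nonneg (by positivity)]
      exact mul_le_of_le_one_right (by positivity) (hv n m)
  · have hd := hφ.dirichlet s (hσ₁.trans_le hs)
    set f : ℕ → ℂ := fun m => c (m + 1) / ((m : ℂ) + 1) ^ s with hf
    have hfn : ∀ m, ‖f m‖ ≤ ‖c (m + 1)‖ / ((m : ℝ) + 1) ^ σ₁ := fun m => by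
      rw [hf, norm_div_natCast_add_one_cpow]
      gcongr
      simp
    have happ : ∀ m : ℕ, c (m + 1) * Real.exp (-((((m : ℝ) + 1) / n) ^ a)) *
        ((m : ℂ) + 1) ^ (-s) = f m + f m * (Real.exp (-((((m : ℝ) + 1) / n) ^ a)) - 1 : ℝ) :=
      fun m => by
        rw [hf, Complex.cpow_neg]
        push_cast
        ring
    have hg : ∀ m, ‖f m * (Real.exp (-((((m : ℝ) + 1) / n) ^ a)) - 1 : ℝ)‖ ≤
        ‖c (m + 1)‖ / ((m : ℝ) + 1) ^ σ₁ * |Real.exp (-((((m : ℝ) + 1) / n) ^ a)) - 1| :=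
      fun m => by
        rw [norm_mul, Complex.norm_real, Real.norm_eq_abs]
        gcongr
        exact hfn m
    have hgs : Summable fun m : ℕ => ‖c (m + 1)‖ / ((m : ℝ) + 1) ^ σ₁ *
        |Real.exp (-((((m : ℝ) + 1) / n) ^ a)) - 1| :=
      hsum.of_nonneg_of_le (fun m => by positivity) fun m =>
        mul_le_of_le_one_right (by positivity) (hv n m)
    have hfg : Summable fun m : ℕ => f m * (Real.exp (-((((m : ℝ) + 1) / n) ^ a)) - 1 : ℝ) :=
      .of_norm_bounded hgs hg
    rw [matsumotoZetaApprox, tsum_congr happ, hd.summable.tsum_add hfg, hd.tsum_eq,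
      add_sub_cancel_left]
    exact tsum_of_norm_bounded hgs.hasSum hg

end MatsumotoClass

lemma tendsto_limsup_average {S : ℕ → ℕ → ℝ} {ε : ℕ → ℝ} (hS : ∀ n k, 0 ≤ S n k)
    (hε : Tendsto ε atTop (𝓝 0)) (h : ∀ n, 0 < n → ∃ D : ℝ, ∀ N : ℕ,
      ∑ k ∈ Finset.range (N + 1), S n k ≤ D + ε n * (N + 1)) :
    Tendsto (fun n : ℕ => limsup (fun N : ℕ => (N + 1 : ℝ)⁻¹ *
      ∑ k ∈ Finset.range (N + 1), S n k) atTop) atTop (𝓝 0) := by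
  have hx0 : ∀ n N : ℕ, 0 ≤ (N + 1 : ℝ)⁻¹ * ∑ k ∈ Finset.range (N + 1), S n k := fun n N =>
    mul_nonneg (by positivity) (Finset.sum_nonneg fun k _ => hS n k)
  have hle : ∀ n : ℕ, 0 < n → limsup (fun N : ℕ => (N + 1 : ℝ)⁻¹ *
      ∑ k ∈ Finset.range (N + 1), S n k) atTop ≤ ε n ∧ 0 ≤ limsup (fun N : ℕ => (N + 1 : ℝ)⁻¹ *
      ∑ k ∈ Finset.range (N + 1), S n k) atTop := by
    intro n hn
    obtain ⟨D, hD⟩ := h n hn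
    have hy : Tendsto (fun N : ℕ => D * (1 / ((N : ℝ) + 1)) + ε n) atTop (𝓝 (ε n)) := by
      simpa using (tendsto_one_div_add_atTop_nhds_zero_nat.const_mul D).add_const (ε n)
    have hxy : ∀ N : ℕ, (N + 1 : ℝ)⁻¹ * ∑ k ∈ Finset.range (N + 1), S n k ≤
        D * (1 / ((N : ℝ) + 1)) + ε n := fun N => by
      rw [inv_mul_le_iff₀ (by positivity)]
      refine (hD N).trans_eq ?_
      field_simp
    have hcob : IsCoboundedUnder (· ≤ ·) atTop fun N : ℕ => (N + 1 : ℝ)⁻¹ *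
        ∑ k ∈ Finset.range (N + 1), S n k :=
      IsBoundedUnder.isCoboundedUnder_le ⟨0, eventually_map.2 (Eventually.of_forall (hx0 n))⟩
    have hbdd : IsBoundedUnder (· ≤ ·) atTop fun N : ℕ => (N + 1 : ℝ)⁻¹ *
        ∑ k ∈ Finset.range (N + 1), S n k :=
      hy.isBoundedUnder_le.mono_le (Eventually.of_forall hxy)
    refine ⟨?_, le_limsup_of_frequently_le (Frequently.of_forall (hx0 n)) hbdd⟩
    rw [← hy.limsup_eq]
    exact limsup_le_limsup (Eventually.of_forall hxy) hcob hy.isBoundedUnder_le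
  refine tendsto_of_tendsto_of_tendsto_of_le_of_le' tendsto_const_nhds hε ?_ ?_
  · filter_upwards [eventually_gt_atTop 0] with n hn using (hle n hn).2
  · filter_upwards [eventually_gt_atTop 0] with n hn using (hle n hn).1

lemma exists_sum_range_le_add_of_le {f G : ℕ → ℝ} {k₀ : ℕ} (hf : ∀ k, 0 ≤ f k)
    (hG : ∀ k, 0 ≤ G k) (h : ∀ k, k₀ ≤ k → f k ≤ G k) :
    ∃ D : ℝ, ∀ N : ℕ, ∑ k ∈ Finset.range N, f k ≤ D + ∑ k ∈ Finset.range N, G k := by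
  refine ⟨∑ k ∈ Finset.range k₀, f k, fun N => ?_⟩
  calc ∑ k ∈ Finset.range N, f k
      ≤ ∑ k ∈ Finset.range N, ((if k < k₀ then f k else 0) + G k) := by
        refine Finset.sum_le_sum fun k _ => ?_
        split_ifs with hk
        · linarith [hG k]
        · linarith [h k (not_lt.1 hk)]
    _ ≤ _ := by
        rw [Finset.sum_add_distrib, ← Finset.sum_filter]
        gcongr ?_ + _
        refine Finset.sum_le_sum_of_subset_of_nonneg (fun k hk => ?_) fun k _ _ => hf k
        exact Finset.mem_range.2 (Finset.mem_filter.1 hk).2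

lemma IsCompact.exists_pos_add_le_re {K : Set ℂ} (hK : IsCompact K) {σ : ℝ}
    (h : ∀ s ∈ K, σ < s.re) : ∃ δ : ℝ, 0 < δ ∧ ∀ s ∈ K, σ + δ ≤ s.re := by
  rcases K.eq_empty_or_nonempty with rfl | hne
  · exact ⟨1, one_pos, by simp⟩
  · obtain ⟨z, hz, hmin⟩ := hK.exists_isMinOn hne Complex.continuous_re.continuousOn
    refine ⟨z.re - σ, sub_pos.2 (h z hz), fun s hs => ?_⟩
    have : z.re ≤ s.re := hmin hs
    linarith

/-- Approximation in the mean of a Matsumoto zeta-function `φ ∈ M` by its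
mollified partial series along the arithmetic progression with common difference `h₁`: for
every compact subset `K` of `D_φ = {Re s > σ₀, Re s ≠ Re s_j(φ)}`,
`lim_{n→∞} limsup_{N→∞} (1/(N+1)) ∑_{k=0}^N sup_{s∈K} |φ(s+ikh₁) − φ_n(s+ikh₁)| = 0`. -/
theorem approximation_in_mean_matsumotoZeta
    (φ : ℂ → ℂ) (σ₀ : ℝ) (c : ℕ → ℂ) (l : ℕ) (spole : Fin l → ℂ)
    (hφ : MatsumotoClass φ σ₀ c l spole)
    (α h₁ h₂ : ℝ) (hα0 : 0 < α) (hα1 : α < 1) (hh₁ : 0 < h₁) (hh₂ : 0 < h₂)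
    (hind : LinearIndependent ℚ ((↑) : (Lset α h₁ h₂) → ℝ))
    (σ₀star : ℝ) (hσ₀star : 1 / 2 < σ₀star)
    (K : Set ℂ) (hK : IsCompact K)
    (hKsub : K ⊆ {s : ℂ | σ₀ < s.re ∧ ∀ j, s.re ≠ (spole j).re}) :
    Tendsto (fun n : ℕ =>
      Filter.limsup (fun N : ℕ => (N + 1 : ℝ)⁻¹ *
        ∑ k ∈ Finset.range (N + 1),
          ⨆ s ∈ K, ‖
            (φ (s + k * h₁ * Complex.I) -
              matsumotoZetaApprox c σ₀star n (s + k * h₁ * Complex.I))‖)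
        Filter.atTop)
      Filter.atTop (𝓝 0) := by
  obtain ⟨hσ₀, hσ₀1⟩ := hφ.sigma_mem
  have ha : 0 < σ₀star := by linarith
  obtain ⟨σ₁, hσ₁, hσ₁a⟩ := exists_between (show 1 < σ₀ + σ₀star by linarith)
  obtain ⟨T₁, C, N₀, hT₁, hC, hd, hgr⟩ := hφ.exists_height
  obtain ⟨δ, hδ, hKδ⟩ := hK.exists_pos_add_le_re fun s hs => (hKsub hs).1
  obtain ⟨M, hM, hKM⟩ := hK.isBounded.exists_pos_norm_le
  obtain ⟨A, hA, hstrip⟩ := hφ.exists_norm_approx_sub_le hC hd hgr ha hδ hσ₁ hσ₁a hM.le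
  obtain ⟨E, hE, hright⟩ := hφ.exists_tendsto_norm_approx_sub_le ha hσ₁
  obtain ⟨D, hD, hmean⟩ := hφ.exists_integral_norm_criticalLine_le
  obtain ⟨A', hA', havg⟩ := exists_sum_integral_mul_inv_one_add_abs_sub_pow_le hh₁ hT₁ hC.le hD
    hφ.continuous_criticalLine.norm (fun u => norm_nonneg _)
    (fun u hu => by simpa using hgr (σ₀ + u * I) (by simp) (by simpa using hu)) hmean
  obtain ⟨B, hB, hsum⟩ := exists_sum_inv_one_add_abs_sub_mul_sq_le hh₁
  have hE0 : ∀ n, 0 ≤ E n := fun n => (norm_nonneg _).trans (hright n σ₁ (by simp))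
  have hS : ∀ n k : ℕ, 0 ≤ ⨆ s ∈ K, ‖φ (s + k * h₁ * Complex.I) -
      matsumotoZetaApprox c σ₀star n (s + k * h₁ * Complex.I)‖ := fun n k =>
    Real.iSup_nonneg fun s => Real.iSup_nonneg fun _ => norm_nonneg _
  have hε : Tendsto (fun n : ℕ => E n + A * (n : ℝ) ^ (-δ) * A') atTop (𝓝 0) := by
    have h1 := (tendsto_rpow_neg_atTop hδ).comp tendsto_natCast_atTop_atTop
    simpa using hE.add ((h1.const_mul A).mul_const A')
  refine tendsto_limsup_average hS hε fun n hn => ?_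
  set k₀ : ℕ := ⌈(T₁ + M + 1) / h₁⌉₊ with hk₀
  set J : ℕ → ℝ := fun k =>
    ∫ u in Set.Ioi T₁, ‖φ (σ₀ + u * I)‖ * ((1 + |u - k * h₁|) ^ (N₀ + 4))⁻¹ with hJ
  have hJ0 : ∀ k, 0 ≤ J k := fun k => integral_nonneg fun u => by positivity
  set G : ℕ → ℝ := fun k => E n + A * (n : ℝ) ^ (σ₁ + 1) * ((1 + |T₁ - k * h₁|) ^ 2)⁻¹ +
    A * (n : ℝ) ^ (-δ) * J k with hG
  have hG0 : ∀ k, 0 ≤ G k := fun k => by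
    have := hE0 n
    have := hJ0 k
    positivity
  have hSG : ∀ k, k₀ ≤ k → ⨆ s ∈ K, ‖φ (s + k * h₁ * Complex.I) -
      matsumotoZetaApprox c σ₀star n (s + k * h₁ * Complex.I)‖ ≤ G k := by
    intro k hk
    have hkT : T₁ + M + 1 ≤ k * h₁ := (div_le_iff₀ hh₁).1 (Nat.ceil_le.1 hk)
    refine Real.iSup_le (fun s => Real.iSup_le (fun hs => ?_) (hG0 k)) (hG0 k)
    rw [norm_sub_rev]
    have hre : (s + k * h₁ * I).re = s.re := by simp
    have him : (s + k * h₁ * I).im = s.im + k * h₁ := by simp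
    rcases le_total s.re σ₁ with h | h
    · refine (hstrip n hn _ (k * h₁) (by rw [hre]; exact hKδ s hs) (by rwa [hre]) ?_ hkT).trans ?_
      · rw [him, add_sub_cancel_right]
        exact (Complex.abs_im_le_norm s).trans (hKM s hs)
      · simp only [hG]
        linarith [hE0 n]
    · refine (hright n _ (by rwa [hre])).trans ?_
      have := hJ0 k
      simp only [hG, add_assoc]
      exact le_add_of_nonneg_right (by positivity)
  obtain ⟨D₀, hD₀⟩ := exists_sum_range_le_add_of_le (hS n) hG0 hSG
  refine ⟨D₀ + A * (n : ℝ) ^ (σ₁ + 1) * B, fun N => (hD₀ (N + 1)).trans ?_⟩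
  simp only [hG]
  rw [Finset.sum_add_distrib, Finset.sum_add_distrib, Finset.sum_const, Finset.card_range,
    nsmul_eq_mul, ← Finset.mul_sum, ← Finset.mul_sum]
  push_cast
  calc _ ≤ D₀ + ((N + 1) * E n + A * (n : ℝ) ^ (σ₁ + 1) * B +
        A * (n : ℝ) ^ (-δ) * (A' * (N + 1))) := by
        gcongr
        · exact hsum (N + 1) T₁
        · exact havg N
    _ = _ := by ring
end
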